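/- Let −d be a squarefree negative integer, let K = ℚ(√−d) with ring of integers O_{−d}, and let S be a nonempty finite set of nonzero prime ideals of O_{−d} (so that, together with the unique infinite place of K, at least two places are inverted and O_{−d,S}^× is infinite). When 2 splits write 2O_{−d} = p₁p₂, when 2 ramifies write 2O_{−d} = p²; when 3 splits write 3O_{−d} = q₁q₂, when 3 ramifies write 3O_{−d} = q². For a prime x among p₁, p₂, p, q₁, q₂, q, set β_x = 0 if x ∈ S and β_x = 1 if x ∉ S. Then SL₂(O_{−d,S})^ab is isomorphic to: 0 if −d ≡ 5 (mod 24); (ℤ/4)^{β_{p₁}+β_{p₂}} ⊕ (ℤ/3)^{β_{q₁}+β_{q₂}} if −d ≡ 1 (mod 24); (ℤ/4)^{β_{p₁}+β_{p₂}} ⊕ (ℤ/3)^{β_q} if −d ≡ 9 (mod 24); (ℤ/3)^{β_{q₁}+β_{q₂}} if −d ≡ 13 (mod 24); (ℤ/3)^{β_q} if −d ≡ 21 (mod 24); (ℤ/4)^{β_{p₁}+β_{p₂}} if −d ≡ 17 (mod 24); (ℤ/2)^{2β_p} if −d ≡ 2, 11, 14, 20, or 23 (mod 24); (ℤ/2)^{2β_p}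 ⊕ (ℤ/3)^{β_{q₁}+β_{q₂}} if −d ≡ 4, 7, 10, 19, or 22 (mod 24); and (ℤ/2)^{2β_p} ⊕ (ℤ/3)^{β_q} in all remaining cases. -/

import Mathlib

open IsDedekindDomain NumberField

/-- The abelianization of `SL₂(R)`, written additively. -/
abbrev SL2ab (R : Type*) [CommRing R] : Type _ :=
  Additive (Abelianization (Matrix.SpecialLinearGroup (Fin 2) R))

/-- `β_x = 0` if `x ∈ S` and `β_x = 1` otherwise. -/
noncomputable def beta {X : Type*} (S : Finset X) (x : X) : ℕ := by
  classical exact if x ∈ S then 0 else 1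

namespace SL2Ab

section Hom

variable {A C : Type*} [CommRing A] [AddCommGroup C]

/-- A homomorphism from `SL₂(A)` to an additive abelian group, as a function of the four entries of
a matrix of determinant one. -/
structure IsHom (F : A → A → A → A → C) : Prop where
  mul : ∀ {a b c d a' b' c' d' : A}, a * d - b * c = 1 → a' * d' - b' * c' = 1 →
    F (a * a' + b * c') (a * b' + b * d') (c * a' + d * c') (c * b' + d * d') =
      F a b c d + F a' b' c' d'

namespace IsHom

variable {F : A → A → A → A → C} (hF : IsHom F)

include hF

theorem mul' {a b c d a' b' c' d' a'' b'' c'' d'' : A} (h : a * d - b * c = 1)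
    (h' : a' * d' - b' * c' = 1) (ha : a'' = a * a' + b * c') (hb : b'' = a * b' + b * d')
    (hc : c'' = c * a' + d * c') (hd : d'' = c * b' + d * d') :
    F a'' b'' c'' d'' = F a b c d + F a' b' c' d' := by
  rw [ha, hb, hc, hd, hF.mul h h']

theorem one : F 1 0 0 1 = 0 := by
  have := hF.mul (a := 1) (b := 0) (c := 0) (d := 1) (a' := 1) (b' := 0) (c' := 0) (d' := 1)
    (by ring) (by ring)
  simpa using this

theorem inv {a b c d : A} (h : a * d - b * c = 1) : F d (-b) (-c) a = -F a b c d := by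
  have h2 := hF.mul' (a := a) (b := b) (c := c) (d := d) (a' := d) (b' := -b) (c' := -c) (d' := a)
    (a'' := 1) (b'' := 0) (c'' := 0) (d'' := 1) h (by linear_combination h)
    (by linear_combination -h) (by ring) (by ring) (by linear_combination -h)
  rw [hF.one] at h2
  exact (neg_eq_of_add_eq_zero_right h2.symm).symm

theorem conj {p q r s a b c d a' b' c' d' : A} (h : p * s - q * r = 1) (h1 : a * d - b * c = 1)
    (ha : a' * p + b' * r = p * a + q * c) (hb : a' * q + b' * s = p * b + q * d)
    (hc : c' * p + d' * r = r * a + s * c) (hd : c' * q + d' * s = r * b + s * d) :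
    F a' b' c' d' = F a b c d := by
  have hdet : a' * d' - b' * c' = 1 := by
    have : (a' * d' - b' * c') * (p * s - q * r) = 1 := by
      calc _ = (a' * p + b' * r) * (c' * q + d' * s) - (a' * q + b' * s) * (c' * p + d' * r) := by
            ring
        _ = (p * s - q * r) * (a * d - b * c) := by rw [ha, hb, hc, hd]; ring
        _ = 1 := by rw [h, h1, one_mul]
    simpa [h] using this
  have e1 := hF.mul hdet h
  have e2 := hF.mul h h1
  rw [ha, hb, hc, hd, e2, add_comm] at e1
  exact (add_right_cancel e1).symm

theorem upper_add (s t : A) : F 1 (s + t) 0 1 = F 1 s 0 1 + F 1 t 0 1 :=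
  hF.mul' (by ring) (by ring) (by ring) (by ring) (by ring) (by ring)

/-- The restriction to the upper unipotent subgroup. -/
def upper : A →+ C where
  toFun t := F 1 t 0 1
  map_zero' := hF.one
  map_add' := hF.upper_add

theorem upper_eq (t : A) : F 1 t 0 1 = hF.upper t := rfl

theorem lower_eq (t : A) : F 1 0 t 1 = -hF.upper t := by
  rw [← map_neg, ← hF.upper_eq]
  exact hF.conj (p := 0) (q := 1) (r := -1) (s := 0) (by ring) (by ring) (by ring) (by ring)
    (by ring) (by ring)

theorem upper_mul {a b c d b' a' : A} (j : A) (h : a * d - b * c = 1) (ha : a' = a + j * c)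
    (hb : b' = b + j * d) : F a' b' c d = hF.upper j + F a b c d :=
  hF.mul' (by ring) h (by rw [ha]; ring) (by rw [hb]; ring) (by ring) (by ring)

theorem mul_upper {a b c d b' d' : A} (j : A) (h : a * d - b * c = 1) (hb : b' = b + j * a)
    (hd : d' = d + j * c) : F a b' c d' = F a b c d + hF.upper j :=
  hF.mul' h (by ring) (by ring) (by rw [hb]; ring) (by ring) (by rw [hd]; ring)

theorem lower_mul {a b c d c' d' : A} (j : A) (h : a * d - b * c = 1) (hc : c' = c + j * a)
    (hd : d' = d + j * b) : F a b c' d' = F a b c d - hF.upper j := by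
  rw [sub_eq_neg_add, ← hF.lower_eq]
  exact hF.mul' (by ring) h (by ring) (by ring) (by rw [hc]; ring) (by rw [hd]; ring)

theorem mul_lower {a b c d a' c' : A} (j : A) (h : a * d - b * c = 1) (ha : a' = a + j * b)
    (hc : c' = c + j * d) : F a' b c' d = F a b c d - hF.upper j := by
  rw [sub_eq_add_neg, ← hF.lower_eq]
  exact hF.mul' h (by ring) (by rw [ha]; ring) (by ring) (by rw [hc]; ring) (by ring)

/-- The value on a matrix is determined by its bottom row, up to upper unipotents. -/
theorem eq_of_bottom {a b c d a' b' : A} (h : a * d - b * c = 1) (h' : a' * d - b' * c = 1) :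
    F a' b' c d = hF.upper (a * b' - a' * b) + F a b c d :=
  hF.upper_mul _ h (by linear_combination a * h' - a' * h)
    (by linear_combination b * h' - b' * h)

theorem weyl : F 0 1 (-1) 0 = 3 • hF.upper 1 := by
  have e1 := hF.lower_mul (a := 1) (b := 1) (c := 0) (d := 1) (c' := -1) (d' := 0) (-1) (by ring)
    (by ring) (by ring)
  have e2 := hF.upper_mul (a := 1) (b := 1) (c := -1) (d := 0) (a' := 0) (b' := 1) 1
    (by ring) (by ring) (by ring)
  rw [e2, e1, hF.upper_eq, map_neg]
  abel

/-- `diag(u, v)` is a product of elementary matrices. -/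
theorem diag_eq {u v : A} (h : u * v = 1) : F u 0 0 v = hF.upper (u + v + u) - 3 • hF.upper 1 := by
  have e1 := hF.lower_mul (a := 1) (b := u) (c := 0) (d := 1) (c' := -v) (d' := 0) (-v) (by ring)
    (by ring) (by linear_combination h)
  have e2 := hF.upper_mul (a := 1) (b := u) (c := -v) (d := 0) (a' := 0) (b' := u) u
    (by linear_combination h) (by linear_combination h) (by ring)
  have e3 := hF.mul' (a := 0) (b := u) (c := -v) (d := 0) (a' := 0) (b' := -1) (c' := 1) (d' := 0)
    (a'' := u) (b'' := 0) (c'' := 0) (d'' := v) (by linear_combination h) (by ring)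
    (by ring) (by ring) (by ring) (by ring)
  have e4 := hF.inv (a := 0) (b := 1) (c := -1) (d := 0) (by ring)
  rw [neg_neg, hF.weyl] at e4
  rw [e3, e4, e2, e1, hF.upper_eq]
  simp only [map_add, map_neg]
  abel

/-- Parabolic elements fixing a unimodular vector are conjugate to elementary matrices. -/
theorem parabolic {j c : A} (z : A) (h : IsCoprime j c) :
    F (1 - j * c * z) (j ^ 2 * z) (-(c ^ 2 * z)) (1 + j * c * z) = hF.upper z := by
  obtain ⟨s, t, h⟩ := h
  rw [← hF.upper_eq]
  exact hF.conj (p := j) (q := -t) (r := c) (s := s) (by linear_combination h) (by ring)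
    (by ring) (by linear_combination j * z * h) (by ring) (by linear_combination c * z * h)

/-- Comparison of a matrix congruent to `1` modulo `r` with its conjugate by an upper unipotent, by
means of a unit close to `1` modulo an entry. -/
theorem conj_upper_of_unit {q₀ : A} (h₀ : ∀ t, hF.upper (q₀ * t) = 0)
    {a b c d r k u v z : A} (hdet : (1 + r * a) * (1 + r * d) - r * b * (r * c) = 1)
    (huv : u * v = 1) (hk : IsCoprime k r) (hu : u ^ 2 - 1 = (1 + r * d - k * r * c) * (q₀ * z))
    {j : A} (hj : j = (1 - u ^ 2) * k) :
    F (1 + r * a + j * r * c) (b + j * (d - a) - j ^ 2 * c) (r ^ 2 * c) (1 + r * d - j * r * c) =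
      F (1 + r * a) b (r ^ 2 * c) (1 + r * d) := by
  have hUV : u ^ 2 * v ^ 2 = 1 := by rw [← mul_pow, huv, one_pow]
  generalize hq : q₀ * z = q at hu
  have e0 := hF.conj (p := u) (q := 0) (r := 0) (s := v) (a := 1 + r * a) (b := b)
    (c := r ^ 2 * c) (d := 1 + r * d) (a' := 1 + r * a) (b' := u ^ 2 * b)
      (c' := v ^ 2 * (r ^ 2 * c))
    (d' := 1 + r * d) (by linear_combination huv) (by linear_combination hdet) (by ring)
    (by linear_combination u * b * huv) (by linear_combination (r ^ 2 * c * v) * huv) (by ring)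
  have e1 : F (1 - u ^ 2 * k * r * (-(v ^ 2 * q * c))) (-((u ^ 2 * k) ^ 2 * (-(v ^ 2 * q * c))))
      (r ^ 2 * (-(v ^ 2 * q * c))) (1 + u ^ 2 * k * r * (-(v ^ 2 * q * c))) = 0 := by
    have hc : IsCoprime (-(u ^ 2 * k)) r := by
      refine IsCoprime.neg_left (IsCoprime.mul_left ?_ hk)
      exact ⟨v ^ 2, 0, by linear_combination hUV⟩
    have := hF.parabolic (v ^ 2 * q * c) hc
    rw [← hq, show v ^ 2 * (q₀ * z) * c = q₀ * (v ^ 2 * z * c) by ring, h₀] at this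
    rw [← this, ← hq]
    congr 1 <;> ring
  have e2 : hF.upper (q * (b + k * (d - a) - k ^ 2 * c)) = 0 := by
    rw [← hq, mul_assoc, h₀]
  have hW : (1 + r * a + j * r * c) * (1 + r * d - j * r * c) -
      (b + j * (d - a) - j ^ 2 * c) * (r ^ 2 * c) = 1 := by linear_combination hdet
  have e3 := hF.upper_mul (a' := 1 + r * a + j * r * c +
    (q * (b + k * (d - a) - k ^ 2 * c)) * (r ^ 2 * c)) (q * (b + k * (d - a) - k ^ 2 * c)) hW rfl rfl
  rw [e2, zero_add] at e3
  have hP : (1 - u ^ 2 * k * r * (-(v ^ 2 * q * c))) * (1 + u ^ 2 * k * r * (-(v ^ 2 * q * c))) -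
      (-((u ^ 2 * k) ^ 2 * (-(v ^ 2 * q * c)))) * (r ^ 2 * (-(v ^ 2 * q * c))) = 1 := by ring
  have hX : (1 + r * a + j * r * c + (q * (b + k * (d - a) - k ^ 2 * c)) * (r ^ 2 * c)) *
      (1 + r * d - j * r * c) - (b + j * (d - a) - j ^ 2 * c +
      q * (b + k * (d - a) - k ^ 2 * c) * (1 + r * d - j * r * c)) * (r ^ 2 * c) = 1 := by
    linear_combination hW
  rw [← e0, ← e3]
  refine ((hF.mul' (a'' := 1 + r * a) (b'' := u ^ 2 * b) (c'' := v ^ 2 * (r ^ 2 * c))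
    (d'' := 1 + r * d) hX hP ?_ ?_ ?_ ?_).trans (by rw [e1, add_zero])).symm
  all_goals clear e0 e1 e2 e3 hX hP hW h₀ hk; subst hj; clear hq
  · grind
  · grind
  · grind
  · grind

end IsHom

end Hom

end SL2Ab

namespace SL2Ab

open QuadraticAlgebra

local notation "𝐍" => QuadraticAlgebra.norm (R := ℤ)

/-- The quadratic order `ℤ[ω]` with `ω² = a + b ω`. -/
abbrev Quad (a b : ℤ) := QuadraticAlgebra ℤ a b

namespace Quad

variable {a b : ℤ}

theorem mul_star_self (z : Quad a b) : z * star z = ((𝐍 z : ℤ) : Quad a b) := by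
  rw [← algebraMap_norm_eq_mul_star]; rfl

theorem four_mul_norm (z : Quad a b) :
    4 * 𝐍 z = (2 * z.re + b * z.im) ^ 2 - (b ^ 2 + 4 * a) * z.im ^ 2 := by
  rw [norm_def]; ring

theorem norm_pos (h : b ^ 2 + 4 * a < 0) {z : Quad a b} (hz : z ≠ 0) : 0 < 𝐍 z := by
  by_contra! hn
  have h4 := four_mul_norm z
  have him : z.im = 0 := by
    by_contra him
    have : 0 < z.im ^ 2 := by positivity
    nlinarith [sq_nonneg (2 * z.re + b * z.im)]
  have hre : z.re = 0 := by
    rw [him] at h4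
    nlinarith [sq_nonneg z.re]
  exact hz (QuadraticAlgebra.ext hre him)

theorem intCast_dvd_iff {n : ℤ} {z : Quad a b} : (n : Quad a b) ∣ z ↔ n ∣ z.re ∧ n ∣ z.im := by
  constructor
  · rintro ⟨w, rfl⟩
    exact ⟨⟨w.re, by simp⟩, ⟨w.im, by simp⟩⟩
  · rintro ⟨⟨x, hx⟩, ⟨y, hy⟩⟩
    exact ⟨⟨x, y⟩, by ext <;> simp [hx, hy]⟩

theorem dvd_norm (z : Quad a b) : z ∣ ((𝐍 z : ℤ) : Quad a b) := ⟨star z, (mul_star_self z).symm⟩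

theorem norm_add_intCast_mul (z w : Quad a b) (n : ℤ) : ∃ m,
    𝐍 (z + (n : Quad a b) * w) = 𝐍 z + n * m := by
  refine ⟨2 * z.re * w.re + b * (z.re * w.im + z.im * w.re) - 2 * a * z.im * w.im + n * 𝐍 w, ?_⟩
  simp only [norm_def, re_add, re_mul, im_add, im_mul, re_intCast, im_intCast, Int.cast_id]
  ring

theorem norm_modEq {z w : Quad a b} {n : ℤ} (h : (n : Quad a b) ∣ z - w) :
    𝐍 z ≡ 𝐍 w [ZMOD n] := by
  obtain ⟨t, ht⟩ := h
  obtain ⟨m, hm⟩ := norm_add_intCast_mul w t n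
  rw [← ht, add_sub_cancel] at hm
  exact (Int.modEq_iff_add_fac.mpr ⟨m, hm⟩).symm

/-- Powers of an element repeat modulo a nonzero integer. -/
theorem exists_pow_repeat (z : Quad a b) {n : ℤ} (hn : n ≠ 0) :
    ∃ i m, 0 < m ∧ (n : Quad a b) ∣ z ^ i * (z ^ m - 1) := by
  have : NeZero n.natAbs := ⟨by simpa⟩
  obtain ⟨i, j, hij, h⟩ := Finite.exists_ne_map_eq_of_infinite
    (fun i : ℕ => (((z ^ i).re : ZMod n.natAbs), ((z ^ i).im : ZMod n.natAbs)))
  wlog hlt : i < j generalizing i j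
  · exact this j i hij.symm h.symm (by omega)
  obtain ⟨m, rfl⟩ := Nat.exists_eq_add_of_lt hlt
  refine ⟨i, m + 1, by omega, ?_⟩
  rw [Prod.mk.injEq, ZMod.intCast_eq_intCast_iff_dvd_sub, ZMod.intCast_eq_intCast_iff_dvd_sub] at h
  rw [mul_sub, mul_one, ← pow_add, intCast_dvd_iff, re_sub, im_sub]
  simpa [add_assoc] using h

theorem two_mul_pow_prime (z : Quad a b) {s : ℕ} [Fact s.Prime] (hs2 : s ≠ 2) :
    (s : Quad a b) ∣ 2 * z ^ s - (2 * z.re + b * z.im +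
      ((legendreSym s (b ^ 2 + 4 * a) : ℤ) : Quad a b) * z.im * ⟨-b, 2⟩) := by
  have hs : s.Prime := Fact.out
  set L := legendreSym s (b ^ 2 + 4 * a) with hL
  set δ : Quad a b := ⟨-b, 2⟩ with hδ
  have hδ2 : δ ^ 2 = ((b ^ 2 + 4 * a : ℤ) : Quad a b) := by
    ext <;> simp [hδ, pow_two] <;> ring
  have hfl : ∀ x : ℤ, (s : ℤ) ∣ x ^ s - x := fun x => by
    rw [← ZMod.intCast_zmod_eq_zero_iff_dvd]
    push_cast
    rw [ZMod.pow_card, sub_self]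
  have hcast : ∀ {x : ℤ}, (s : ℤ) ∣ x → (s : Quad a b) ∣ (x : Quad a b) := by
    rintro x ⟨y, rfl⟩
    exact ⟨y, by push_cast; rfl⟩
  have h2z : (2 : Quad a b) * z = ((2 * z.re + b * z.im : ℤ) : Quad a b) +
    (z.im : Quad a b) * δ := by
    ext <;> simp [hδ] <;> ring
  obtain ⟨t, ht⟩ := exists_add_pow_prime_eq hs ((2 * z.re + b * z.im : ℤ) : Quad a b) (z.im * δ)
  rw [← h2z, mul_pow, mul_pow] at ht
  obtain ⟨k, hk⟩ : Odd s := hs.odd_of_ne_two hs2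
  have hleg : (s : ℤ) ∣ (b ^ 2 + 4 * a) ^ k - L := by
    rw [← ZMod.intCast_zmod_eq_zero_iff_dvd]
    push_cast
    have := legendreSym.eq_pow s (b ^ 2 + 4 * a)
    rw [show s / 2 = k by omega] at this
    rw [hL, this]; push_cast; ring
  have hδs : δ ^ s = (((b ^ 2 + 4 * a) ^ k : ℤ) : Quad a b) * δ := by
    rw [hk, pow_succ, pow_mul, hδ2]; push_cast; rfl
  obtain ⟨t1, h1⟩ := hcast (hfl 2)
  obtain ⟨t2, h2⟩ := hcast (hfl (2 * z.re + b * z.im))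
  obtain ⟨t3, h3⟩ := hcast (hfl z.im)
  obtain ⟨t4, h4⟩ := hcast hleg
  rw [hδs] at ht
  push_cast at h1 h2 h3 h4 ht ⊢
  refine ⟨t2 + t3 * ((b : Quad a b) ^ 2 + 4 * a) ^ k * δ + z.im * t4 * δ +
    (2 * z.re + b * z.im) * (z.im * δ) * t - t1 * z ^ s, ?_⟩
  linear_combination ht - z ^ s * h1 + h2 + (((b : Quad a b) ^ 2 + 4 * a) ^ k * δ) * h3 +
    z.im * δ * h4

theorem two_mul_cancel {s : ℕ} (hs : Odd s) {z : Quad a b} (h : (s : Quad a b) ∣ 2 * z) :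
    (s : Quad a b) ∣ z := by
  obtain ⟨k, rfl⟩ := hs
  obtain ⟨w, hw⟩ := h
  exact ⟨z - k * w, by push_cast at hw ⊢; linear_combination -k * hw⟩

theorem pow_prime_of_split (z : Quad a b) {s : ℕ} [Fact s.Prime] (hs2 : s ≠ 2)
    (h : legendreSym s (b ^ 2 + 4 * a) = 1) : (s : Quad a b) ∣ z ^ s - z := by
  apply two_mul_cancel ((Fact.out : s.Prime).odd_of_ne_two hs2)
  have := two_mul_pow_prime z hs2
  rw [h] at this
  convert this using 1
  rw [mul_sub]
  congr 1
  ext <;> simp <;> ring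

theorem pow_prime_of_inert (z : Quad a b) {s : ℕ} [Fact s.Prime] (hs2 : s ≠ 2)
    (h : legendreSym s (b ^ 2 + 4 * a) = -1) : (s : Quad a b) ∣ z ^ s - star z := by
  apply two_mul_cancel ((Fact.out : s.Prime).odd_of_ne_two hs2)
  have := two_mul_pow_prime z hs2
  rw [h] at this
  convert this using 1
  rw [mul_sub]
  congr 1
  ext <;> simp <;> ring

theorem pow_prime_sq (z : Quad a b) {s : ℕ} [Fact s.Prime] (hs2 : s ≠ 2)
    (h : ¬ (s : ℤ) ∣ b ^ 2 + 4 * a) : (s : Quad a b) ∣ z ^ s ^ 2 - z := by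
  rw [← ZMod.intCast_zmod_eq_zero_iff_dvd] at h
  rw [pow_two, pow_mul]
  rcases legendreSym.eq_one_or_neg_one s h with h | h
  · convert (pow_prime_of_split (z ^ s) hs2 h).add (pow_prime_of_split z hs2 h) using 1
    ring
  · have h1 := pow_prime_of_inert (z ^ s) hs2 h
    have h2 := pow_prime_of_inert z hs2 h
    obtain ⟨w, hw⟩ := h2
    have h3 : (s : Quad a b) ∣ star (z ^ s) - z := by
      refine ⟨star w, ?_⟩
      nth_rw 2 [← star_star z]
      rw [← star_sub, hw, star_mul', star_natCast]
    convert dvd_add h1 h3 using 1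
    ring

/-- In the inert case, an element not divisible by `r` has norm prime to `r`. -/
theorem not_dvd_norm {r : ℕ} [Fact r.Prime] (h : legendreSym r (b ^ 2 + 4 * a) = -1)
    (hr2 : r ≠ 2) {z : Quad a b} (hz : ¬ (r : Quad a b) ∣ z) : ¬ (r : ℤ) ∣ 𝐍 z := by
  intro hN
  apply hz
  obtain ⟨h1, h2⟩ := legendreSym.prime_dvd_of_eq_neg_one h (x := 2 * z.re + b * z.im) (y := z.im)
    (by rw [← four_mul_norm]; exact hN.mul_left 4)
  apply two_mul_cancel ((Fact.out : r.Prime).odd_of_ne_two hr2)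
  rw [show (r : Quad a b) = ((r : ℤ) : Quad a b) by simp, intCast_dvd_iff]
  constructor
  · have := dvd_sub h1 (h2.mul_left b)
    simpa using this
  · simpa using h2.mul_left 2

end Quad

/-- A ring obtained from an imaginary quadratic order by inverting an element, which has a unit of
infinite order. -/
structure Ctx {a b : ℤ} {A : Type*} [CommRing A] (ι : Quad a b →+* A) (π : Quad a b) : Prop where
  inj : Function.Injective ι
  neg : b ^ 2 + 4 * a < 0
  unit : IsUnit (ι π)
  den : ∀ x, ∃ k y, ι π ^ k * x = ι y
  inf : ∃ ε : A, IsUnit ε ∧ ∀ k > 0, ε ^ k ≠ 1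

theorem intCast_dvd_of_dvd {A : Type*} [CommRing A] {m n : ℤ} (h : m ∣ n) : (m : A) ∣ (n : A) := by
  obtain ⟨k, rfl⟩ := h
  exact ⟨k, by push_cast; rfl⟩

theorem isCoprime_intCast {A : Type*} [CommRing A] {m n : ℤ} (h : IsCoprime m n) :
    IsCoprime (m : A) (n : A) := by
  simpa using h.map (Int.castRingHom A)

theorem dvd_pow_sub_pow {A : Type*} [CommRing A] {n x y : A} (h : n ∣ x - y) (k : ℕ) :
    n ∣ x ^ k - y ^ k := h.trans (sub_dvd_pow_sub_pow x y k)

theorem dvd_pow_mul_sub_one {A : Type*} [CommRing A] {n x : A} {m : ℕ} (h : n ∣ x ^ m - 1) (k : ℕ) :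
    n ∣ x ^ (m * k) - 1 := by
  rw [pow_mul]
  simpa using dvd_pow_sub_pow h k

/-- A finite commutative ring has stable rank one. -/
theorem exists_isUnit_add_mul {R : Type*} [CommRing R] [Finite R] {c j : R} (h : IsCoprime c j) :
    ∃ t, IsUnit (c + t * j) := by
  obtain ⟨i, k, hlt, hik⟩ : ∃ i k : ℕ, i < k ∧ c ^ i = c ^ k := by
    obtain ⟨i, k, hne, h⟩ := Finite.exists_ne_map_eq_of_infinite (fun i : ℕ => c ^ i)
    rcases lt_or_gt_of_ne hne with h' | h'
    exacts [⟨i, k, h', h⟩, ⟨k, i, h', h.symm⟩]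
  obtain ⟨m, rfl⟩ := Nat.exists_eq_add_of_lt hlt
  have hper : ∀ n, c ^ (i + n * (m + 1)) = c ^ i := by
    intro n
    induction n with
    | zero => simp
    | succ n ih =>
      rw [show i + (n + 1) * (m + 1) = (i + n * (m + 1)) + (m + 1) by ring, pow_add, ih, ← pow_add,
        hik]
      congr 1
  refine ⟨1 - c ^ ((i + 1) * (m + 1)), ?_⟩
  have hid : c ^ ((i + 1) * (m + 1)) * (1 - c ^ ((i + 1) * (m + 1))) = 0 := by
    rw [mul_sub, mul_one, ← pow_add]
    have h1 : c ^ ((i + 1) * (m + 1)) = c ^ (i + ((i + 1) * (m + 1) - i)) := by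
      congr 1
      have : i ≤ (i + 1) * (m + 1) := by nlinarith
      omega
    have h2 : (i + 1) * (m + 1) + (i + 1) * (m + 1) =
        (i + (i + 1) * (m + 1)) + ((i + 1) * (m + 1) - i) := by
      have : i ≤ (i + 1) * (m + 1) := by nlinarith
      omega
    rw [h2, pow_add, hper, ← pow_add, ← h1, sub_self]
  by_contra hu
  obtain ⟨M, hM, hmem⟩ := exists_max_ideal_of_mem_nonunits hu
  have hP := hM.isPrime
  by_cases hc : c ∈ M
  · have he : c ^ ((i + 1) * (m + 1)) ∈ M := M.pow_mem_of_mem hc _ (by positivity)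
    have h1 : (1 - c ^ ((i + 1) * (m + 1))) * j ∈ M := (M.add_mem_iff_right hc).mp hmem
    have hj : j ∈ M := by
      have := M.add_mem h1 (M.mul_mem_right j he)
      rwa [← add_mul, sub_add_cancel, one_mul] at this
    obtain ⟨s, t, hst⟩ := h
    exact hP.one_notMem (hst ▸ M.add_mem (M.mul_mem_left s hc) (M.mul_mem_left t hj))
  · have h0 : c ^ ((i + 1) * (m + 1)) * (1 - c ^ ((i + 1) * (m + 1))) ∈ M := hid ▸ M.zero_mem
    rcases hP.mem_or_mem h0 with h1 | h1
    · exact hc (hP.mem_of_pow_mem _ h1)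
    · exact hc ((M.add_mem_iff_left (M.mul_mem_right j h1)).mp hmem)

theorem isCoprime_of_prime {x y : ℤ} (h : ∀ p : ℕ, p.Prime → (p : ℤ) ∣ x → ¬ (p : ℤ) ∣ y) :
    IsCoprime x y := by
  rw [Int.isCoprime_iff_gcd_eq_one]
  refine Nat.coprime_of_dvd fun p hp h1 h2 => h p hp ?_ ?_
  · exact Int.natCast_dvd.mpr h1
  · exact Int.natCast_dvd.mpr h2

theorem not_dvd_of_isCoprime {x y : ℤ} (h : IsCoprime x y) {p : ℕ} (hp : p.Prime)
    (hx : (p : ℤ) ∣ x) : ¬ (p : ℤ) ∣ y := by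
  intro hy
  have := h.isUnit_of_dvd' hx hy
  rw [Int.ofNat_isUnit, Nat.isUnit_iff] at this
  exact hp.one_lt.ne' this

theorem isCoprime_natPrime {p : ℕ} (hp : p.Prime) {x : ℤ} (h : ¬ (p : ℤ) ∣ x) :
    IsCoprime (p : ℤ) x :=
  (Prime.coprime_iff_not_dvd (Nat.prime_iff_prime_int.mp hp)).mpr h

/-- Integers coprime as a triple can be adjusted to a coprime pair. -/
theorem exists_isCoprime_add_mul {x y E : ℤ} (hy : y ≠ 0) (h : ∀ p : ℕ, p.Prime → (p : ℤ) ∣ x →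
    (p : ℤ) ∣ y → ¬ (p : ℤ) ∣ E) (hE : E ≠ 0) : ∃ i, IsCoprime (x + E * i) y := by
  obtain ⟨g, x', E', hg, hc, rfl, rfl⟩ := Int.exists_gcd_one' (m := x) (n := E)
    (Int.gcd_pos_of_ne_zero_right _ hE)
  have hE' : E'.natAbs ≠ 0 := by
    rw [Int.natAbs_ne_zero]; rintro rfl; simp at hE
  obtain ⟨p, hp1, hp2, hp3⟩ := Nat.forall_exists_prime_gt_and_zmodEq y.natAbs hE'
    (a := x') (by
      rw [Int.isCoprime_iff_gcd_eq_one]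
      simpa [Int.gcd, Int.natAbs_abs] using hc)
  obtain ⟨i, hi⟩ : E' ∣ (p : ℤ) - x' := by
    have := hp3.symm.dvd
    rwa [Int.natCast_natAbs, abs_dvd] at this
  refine ⟨i, ?_⟩
  rw [show x' * (g : ℤ) + E' * g * i = p * g by linear_combination (-g : ℤ) * hi]
  refine IsCoprime.mul_left ?_ ?_
  · refine isCoprime_natPrime hp2 fun hd => ?_
    have := Nat.le_of_dvd (by positivity) (Int.natCast_dvd.mp hd)
    omega
  · exact isCoprime_of_prime fun q hq h1 h2 => h q hq (h1.mul_left _) h2 (h1.mul_left _)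

theorem isCoprime_of_modEq {x z m : ℤ} (h : z ≡ x [ZMOD m]) (hx : IsCoprime x m) :
    IsCoprime z m := by
  obtain ⟨k, hk⟩ := h.dvd
  rw [show z = x + m * (-k) by linear_combination -hk]
  exact hx.add_mul_left_left _

/-- Dirichlet's theorem with two coprime moduli. -/
theorem exists_prime_of_crt (B : ℕ) {m n x y : ℤ} (hm : m ≠ 0) (hn : n ≠ 0) (hmn : IsCoprime m n)
    (hx : IsCoprime x m) (hy : IsCoprime y n) :
    ∃ p : ℕ, B < p ∧ p.Prime ∧ (p : ℤ) ≡ x [ZMOD m] ∧ (p : ℤ) ≡ y [ZMOD n] := by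
  obtain ⟨s, t, hst⟩ := hmn
  set z := x + (y - x) * (s * m) with hz
  have hzx : z ≡ x [ZMOD m] :=
    Int.modEq_iff_dvd.mpr ⟨-(y - x) * s, by rw [hz]; ring⟩
  have hzy : z ≡ y [ZMOD n] :=
    Int.modEq_iff_dvd.mpr ⟨(y - x) * t, by rw [hz]; linear_combination (-(y - x)) * hst⟩
  have h1 := isCoprime_of_modEq hzx hx
  have h2 := isCoprime_of_modEq hzy hy
  obtain ⟨p, hp1, hp2, hp3⟩ := Nat.forall_exists_prime_gt_and_zmodEq B (q := (m * n).natAbs)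
    (a := z) (by simp [hm, hn]) (by
      rw [Int.natCast_natAbs]
      exact (h1.mul_right h2).abs_right)
  have h3 : (p : ℤ) ≡ z [ZMOD m * n] := by
    rw [Int.modEq_iff_dvd] at hp3 ⊢
    rwa [Int.natCast_natAbs, abs_dvd] at hp3
  exact ⟨p, hp1, hp2, (h3.of_mul_right n).trans hzx, (h3.of_mul_left m).trans hzy⟩

namespace Quad

variable {a b : ℤ}

theorem norm_ne_zero (h : b ^ 2 + 4 * a < 0) {z : Quad a b} (hz : z ≠ 0) : 𝐍 z ≠ 0 :=
  (norm_pos h hz).ne'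

theorem intCast_dvd_of_dvd_mul {n P : ℤ} (h : IsCoprime n P) {z : Quad a b}
    (hz : (n : Quad a b) ∣ (P : Quad a b) * z) : (n : Quad a b) ∣ z :=
  (isCoprime_intCast h).dvd_of_dvd_mul_left hz

/-- Primitive elements: the coordinates are coprime. -/
def Primitive (z : Quad a b) : Prop := IsCoprime z.re z.im

theorem Primitive.im_coprime_norm {z : Quad a b} (h : Primitive z) : IsCoprime z.im (𝐍 z) := by
  have : 𝐍 z = z.re * z.re + z.im * (b * z.re - a * z.im) := by rw [norm_def]; ring
  rw [this]
  exact (IsCoprime.mul_right h.symm h.symm).add_mul_left_right _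

/-- Modulo a primitive element, every element is an integer. -/
theorem Primitive.exists_int {z : Quad a b} (h : Primitive z) (w : Quad a b) :
    ∃ i : ℤ, z ∣ w - i := by
  obtain ⟨s, t, hst⟩ := h.im_coprime_norm
  refine ⟨w.re - w.im * s * z.re, ?_⟩
  have : w - ((w.re - w.im * s * z.re : ℤ) : Quad a b) =
      z * ((w.im * s : ℤ) : Quad a b) + ((𝐍 z : ℤ) : Quad a b) * ((t * w.im : ℤ) : Quad a b) *
        ⟨0, 1⟩ := by
    ext
    · simp; ring
    · simp; linear_combination (-w.im) * hst
  rw [this]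
  exact dvd_add (dvd_mul_right _ _) (((dvd_norm z).mul_right _).mul_right _)

/-- Lifting an element with no common factor with `E` to a primitive one in its class mod `E`. -/
theorem exists_primitive {z : Quad a b} {E : ℤ} (hE : E ≠ 0) (h : ∀ p : ℕ, p.Prime →
    (p : ℤ) ∣ z.re → (p : ℤ) ∣ z.im → ¬ (p : ℤ) ∣ E) :
    ∃ w : Quad a b, Primitive (z + (E : Quad a b) * w) := by
  obtain ⟨j, hj⟩ : ∃ j, z.im + E * j ≠ 0 := by
    by_cases h0 : z.im = 0
    · exact ⟨1, by simpa [h0]⟩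
    · exact ⟨0, by simpa⟩
  obtain ⟨i, hi⟩ := exists_isCoprime_add_mul (x := z.re) hj (E := E) (fun p hp h1 h2 h3 =>
    h p hp h1 ((dvd_add_left (h3.mul_right _)).mp h2) h3) hE
  exact ⟨⟨i, j⟩, by simpa [Primitive] using hi⟩

theorem isCoprime_norm {z u : Quad a b} {E : ℤ} (h : (E : Quad a b) ∣ z * u - 1) :
    IsCoprime (𝐍 z) E := by
  have := norm_modEq h
  rw [map_mul, map_one] at this
  obtain ⟨k, hk⟩ := this.symm.dvd
  exact ⟨𝐍 u, -k, by linear_combination hk⟩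

theorem no_common_factor {z : Quad a b} {E : ℤ} (h : IsCoprime (𝐍 z) E) (p : ℕ) (hp : p.Prime)
    (h1 : (p : ℤ) ∣ z.re) (h2 : (p : ℤ) ∣ z.im) : ¬ (p : ℤ) ∣ E := by
  refine not_dvd_of_isCoprime h hp ?_
  rw [norm_def]
  exact dvd_sub (dvd_add (h1.mul_left _) (h2.mul_left _)) (h2.mul_left _)

instance finite_quotient {E : ℤ} [NeZero E] : Finite (Quad a b ⧸ Ideal.span {(E : Quad a b)}) := by
  have : NeZero E.natAbs := ⟨by simpa using NeZero.ne E⟩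
  refine Finite.of_surjective (fun x : ZMod E.natAbs × ZMod E.natAbs =>
    Ideal.Quotient.mk (Ideal.span {(E : Quad a b)}) ⟨x.1.cast, x.2.cast⟩) fun y => ?_
  obtain ⟨z, rfl⟩ := Ideal.Quotient.mk_surjective y
  refine ⟨(z.re, z.im), ?_⟩
  rw [Ideal.Quotient.mk_eq_mk_iff_sub_mem, Ideal.mem_span_singleton, intCast_dvd_iff]
  have : ∀ n : ℤ, E ∣ ((n : ZMod E.natAbs).cast : ℤ) - n := fun n => by
    rw [← Int.natAbs_dvd, ← ZMod.intCast_zmod_eq_zero_iff_dvd]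
    simp
  exact ⟨this _, this _⟩

/-- Primitive elements in a class modulo an ideal, of norm prime to a given integer. -/
theorem exists_primitive_add_mul {c u j : Quad a b} (h : c * u + j = 1) {E : ℤ} (hE : E ≠ 0) :
    ∃ t w, Primitive (c + t * j + (E : Quad a b) * w) ∧
      IsCoprime (𝐍 (c + t * j + (E : Quad a b) * w)) E := by
  have : NeZero E := ⟨hE⟩
  obtain ⟨t, ht⟩ := exists_isUnit_add_mul (R := Quad a b ⧸ Ideal.span {(E : Quad a b)})
    (c := Ideal.Quotient.mk _ c) (j := Ideal.Quotient.mk _ j)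
    ⟨Ideal.Quotient.mk _ u, 1, by
      rw [one_mul, mul_comm, ← map_mul, ← map_add, h, map_one]⟩
  obtain ⟨t, rfl⟩ := Ideal.Quotient.mk_surjective t
  obtain ⟨v, hv⟩ := ht.exists_right_inv
  obtain ⟨v, rfl⟩ := Ideal.Quotient.mk_surjective v
  rw [← map_mul, ← map_add, ← map_mul, ← map_one (Ideal.Quotient.mk _),
    Ideal.Quotient.mk_eq_mk_iff_sub_mem, Ideal.mem_span_singleton] at hv
  obtain ⟨w, hw⟩ := exists_primitive hE (no_common_factor (isCoprime_norm hv))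
  refine ⟨t, w, hw, isCoprime_norm (u := v) ?_⟩
  rw [show (c + t * j + (E : Quad a b) * w) * v - 1 = (c + t * j) * v - 1 + E * (w * v) by ring]
  exact dvd_add hv (dvd_mul_right _ _)

end Quad

theorem map_dvd_int {a b : ℤ} {A : Type*} [CommRing A] (ι : Quad a b →+* A) {n : ℤ} {z : Quad a b}
    (h : (n : Quad a b) ∣ z) : (n : A) ∣ ι z := by
  simpa using map_dvd ι h

namespace Ctx

variable {a b : ℤ} {A : Type*} [CommRing A] {ι : Quad a b →+* A} {π : Quad a b} (hc : Ctx ι π)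

include hc

theorem exists_rep {n : ℤ} (hn : n ≠ 0) (x : A) : ∃ y, (n : A) ∣ x - ι y := by
  obtain ⟨k, y, hy⟩ := hc.den x
  obtain ⟨i, m, hm, hd⟩ := Quad.exists_pow_repeat π hn
  have h1 : (n : A) ∣ ι π ^ m - 1 := by
    have := map_dvd ι hd
    rw [map_intCast, map_mul, map_sub, map_pow, map_pow, map_one] at this
    exact (hc.unit.pow i).dvd_mul_left.mp this
  obtain ⟨l, rfl⟩ : ∃ l, m = l + 1 := ⟨m - 1, by omega⟩
  have h2 := dvd_pow_mul_sub_one h1 k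
  refine ⟨π ^ (l * k) * y, ?_⟩
  have : x - ι (π ^ (l * k) * y) = -(x * (ι π ^ ((l + 1) * k) - 1)) := by
    rw [map_mul, ← hy, map_pow, add_mul, one_mul, pow_add]; ring
  rw [this]
  exact (h2.mul_left x).neg_right

theorem dvd_norm_pow_mul {x y : A} (h : x ∣ y) {x' y' : Quad a b} (hx : x = ι x') (hy : y = ι y') :
    ∃ k, x' ∣ π ^ k * y' := by
  obtain ⟨z, hz⟩ := h
  obtain ⟨k, w, hw⟩ := hc.den z
  refine ⟨k, w, hc.inj ?_⟩
  rw [map_mul, map_mul, map_pow, ← hy, hz, ← hw, hx]; ring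

theorem norm_dvd_norm {c y : Quad a b} (h : ι c ∣ ι y) (hP : IsCoprime (𝐍 c) (𝐍 π)) :
    𝐍 c ∣ 𝐍 y := by
  obtain ⟨k, hk⟩ := hc.dvd_norm_pow_mul h rfl rfl
  have := map_dvd (QuadraticAlgebra.norm (R := ℤ)) hk
  rw [map_mul, map_pow] at this
  exact (hP.pow_right).dvd_of_dvd_mul_left this

theorem intCast_dvd_of_map {n : ℤ} {y : Quad a b} (h : (n : A) ∣ ι y) (hP : IsCoprime n (𝐍 π)) :
    (n : Quad a b) ∣ y := by
  obtain ⟨k, hk⟩ := hc.dvd_norm_pow_mul h (x' := (n : Quad a b)) (by simp) rfl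
  refine Quad.intCast_dvd_of_dvd_mul (hP.pow_right (n := k)) ?_
  push_cast
  rw [← Quad.mul_star_self, mul_pow, mul_assoc, mul_comm, mul_assoc, mul_comm y]
  exact (hk.mul_left _)

theorem int_dvd_of_dvd {n m : ℤ} (h : (n : A) ∣ (m : A)) (hP : IsCoprime n (𝐍 π)) : n ∣ m := by
  have := hc.intCast_dvd_of_map (y := (m : Quad a b)) (by simpa using h) hP
  rw [Quad.intCast_dvd_iff] at this
  simpa using this.1

theorem norm_pi_ne_zero [Nontrivial A] : 𝐍 π ≠ 0 := by
  refine Quad.norm_ne_zero hc.neg ?_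
  rintro rfl
  simpa using hc.unit

theorem exists_int_multiple {x : A} (hx : x ≠ 0) : ∃ m : ℤ, m ≠ 0 ∧ x ∣ (m : A) := by
  obtain ⟨k, y, hy⟩ := hc.den x
  have hy0 : y ≠ 0 := by
    rintro rfl
    rw [map_zero] at hy
    exact hx ((hc.unit.pow k).mul_right_eq_zero.mp hy)
  refine ⟨𝐍 y, Quad.norm_ne_zero hc.neg hy0, ?_⟩
  have := map_dvd ι (Quad.dvd_norm y)
  rw [map_intCast, ← hy] at this
  exact (dvd_mul_left _ _).trans this

theorem charZero : CharZero A := by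
  refine charZero_of_inj_zero fun n hn => ?_
  have h : ι ((n : ℕ) : Quad a b) = ι 0 := by simpa using hn
  have := congrArg QuadraticAlgebra.re (hc.inj h)
  simpa using this

theorem exists_pow_sub_one {x : A} (hx : IsUnit x) {n : ℤ} (hn : n ≠ 0) :
    ∃ m > 0, (n : A) ∣ x ^ m - 1 := by
  obtain ⟨y, hy⟩ := hc.exists_rep hn x
  obtain ⟨i, m, hm, hd⟩ := Quad.exists_pow_repeat y hn
  refine ⟨m, hm, (hx.pow i).dvd_mul_left.mp ?_⟩
  have h1 := map_dvd_int ι hd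
  have h2 := dvd_pow_sub_pow hy (i + m)
  have h3 := dvd_pow_sub_pow hy i
  rw [map_mul, map_sub, map_pow, map_pow, map_one] at h1
  convert (h1.add h2).sub h3 using 1
  ring

theorem pow_prime_sq_sub_one {x : A} (hx : IsUnit x) {s : ℕ} (hs : s.Prime) (hs2 : s ≠ 2)
    (h : ¬ (s : ℤ) ∣ b ^ 2 + 4 * a) : ((s : ℤ) : A) ∣ x ^ (s ^ 2 - 1) - 1 := by
  have := Fact.mk hs
  obtain ⟨y, hy⟩ := hc.exists_rep (n := s) (by exact_mod_cast hs.ne_zero) x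
  have h1 := map_dvd ι (Quad.pow_prime_sq y hs2 h)
  have h2 := dvd_pow_sub_pow hy (s ^ 2)
  rw [map_natCast, map_sub, map_pow] at h1
  refine hx.dvd_mul_left.mp ?_
  have h3 : x * (x ^ (s ^ 2 - 1) - 1) = x ^ s ^ 2 - x := by
    rw [mul_sub, ← pow_succ', mul_one, Nat.sub_add_cancel]
    exact Nat.one_le_pow _ _ hs.pos
  rw [h3]
  push_cast at hy h2 ⊢
  convert (h1.add h2).sub hy using 1
  ring

/-- Adjust one entry of a unimodular row by a multiple of the other to make it a primitive element
of the quadratic order with norm prime to a given integer. -/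
theorem exists_primitive [Nontrivial A] {c d : A} (h : IsCoprime c d) (hd : d ≠ 0) {B : ℤ}
    (hB : B ≠ 0) :
    ∃ m c', c + m * d = ι c' ∧ Quad.Primitive c' ∧ IsCoprime (𝐍 c') B := by
  obtain ⟨n, hn, hdn⟩ := hc.exists_int_multiple hd
  obtain ⟨c₁, hc₁⟩ := hc.exists_rep hn c
  obtain ⟨u, v, huv⟩ := h
  obtain ⟨u₁, hu₁⟩ := hc.exists_rep hn u
  have hj : d ∣ ι (1 - c₁ * u₁) := by
    have h1 := hdn.trans hc₁
    have h2 := hdn.trans hu₁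
    rw [map_sub, map_one, map_mul]
    convert ((dvd_mul_left d v).add (h1.mul_right u)).add (h2.mul_left (ι c₁)) using 1
    linear_combination -huv
  obtain ⟨t, w, hw, hw'⟩ := Quad.exists_primitive_add_mul (c := c₁) (u := u₁)
    (j := 1 - c₁ * u₁) (by ring) (mul_ne_zero hB hn)
  have h3 : d ∣ ι (c₁ + t * (1 - c₁ * u₁) + ((B * n : ℤ) : Quad a b) * w) - c := by
    have h4 : d ∣ ι (((B * n : ℤ) : Quad a b) * w) := by
      rw [map_mul, map_intCast]
      push_cast
      exact (hdn.mul_left _).mul_right _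
    rw [map_add, map_add, map_mul]
    convert ((hj.mul_left (ι t)).add h4).sub (hdn.trans hc₁) using 1
    ring
  obtain ⟨m, hm⟩ := h3
  exact ⟨m, _, by rw [mul_comm m, ← hm]; ring, hw, IsCoprime.of_mul_right_left hw'⟩

theorem exists_int {c : Quad a b} (h : Quad.Primitive c) [Nontrivial A] (x : A) :
    ∃ i : ℤ, ι c ∣ x - i := by
  have hc0 : c ≠ 0 := by
    rintro rfl
    have : IsCoprime (0 : ℤ) 0 := h
    exact not_isUnit_zero (isCoprime_zero_left.mp this)
  obtain ⟨y, hy⟩ := hc.exists_rep (Quad.norm_ne_zero hc.neg hc0) x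
  obtain ⟨i, hi⟩ := h.exists_int y
  refine ⟨i, ?_⟩
  have h1 := map_dvd ι (Quad.dvd_norm c)
  rw [map_intCast] at h1
  have h2 := map_dvd ι hi
  rw [map_sub, map_intCast] at h2
  convert (h1.trans hy).add h2 using 1
  ring

/-- An integer invertible modulo `c` is coprime to the norm of `c`. -/
theorem isCoprime_norm [Nontrivial A] {c : Quad a b} (hc0 : c ≠ 0) (hP : IsCoprime (𝐍 c) (𝐍 π))
    {i : ℤ}
    (h : IsCoprime (i : A) (ι c)) : IsCoprime i (𝐍 c) := by
  have hn := Quad.norm_ne_zero hc.neg hc0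
  obtain ⟨u, v, huv⟩ := h
  obtain ⟨u₁, hu₁⟩ := hc.exists_rep hn u
  have h1 := map_dvd ι (Quad.dvd_norm c)
  rw [map_intCast] at h1
  have h2 : ι c ∣ ι (u₁ * i - 1) := by
    rw [map_sub, map_mul, map_intCast, map_one]
    convert ((h1.trans hu₁).mul_right (i : A)).add (dvd_mul_left (ι c) v) |>.neg_right using 1
    linear_combination huv
  have h3 := hc.norm_dvd_norm h2 hP
  refine isCoprime_of_prime fun p hp hpi hpn => ?_
  obtain ⟨k, rfl⟩ := hpi
  obtain ⟨m, hm⟩ := Quad.norm_add_intCast_mul (-1 : Quad a b) (k * u₁) p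
  have h4 : u₁ * (((p : ℤ) * k : ℤ) : Quad a b) - 1 = -1 + ((p : ℤ) : Quad a b) * (k * u₁) := by
    push_cast; ring
  rw [h4, hm, QuadraticAlgebra.norm_neg, map_one] at h3
  have h5 := (hpn.trans h3).sub (dvd_mul_right _ m)
  rw [add_sub_cancel_right] at h5
  have := (Int.natCast_dvd.mp h5)
  exact hp.one_lt.ne' (by simpa using this)

end Ctx

end SL2Ab

namespace SL2Ab

/-- Choice of a residue `1 + t` prime to `o` and `n`, with `t` divisible by `n` and `(1 + t)² - 1`
not too divisible by primes dividing `o`. -/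
theorem exists_residue_not_dvd {o n B : ℕ} (ho : o ≠ 0) (h : ¬ o ∣ 96 * n * B) :
    ∃ t : ℕ, (1 + t).Coprime (o * n) ∧ n ∣ t ∧ ¬ o ∣ t * (t + 2) * B := by
  obtain ⟨q, k, hq, hqo, hqn⟩ : ∃ q k : ℕ, q.Prime ∧ q ^ k ∣ o ∧ ¬ q ^ k ∣ 96 * n * B := by
    by_contra! hcon
    exact h ((Nat.dvd_iff_prime_pow_dvd_dvd _ _).mpr fun p k hp hpk => hcon p k hp hpk)
  obtain ⟨e, M, hqM, hoM⟩ := Nat.exists_eq_pow_mul_and_not_dvd ho q hq.ne_one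
  have hred : ∀ {X Y : ℕ}, ¬ q ∣ X → q ^ k ∣ X * Y → q ^ k ∣ Y := fun hX hd =>
    Nat.Coprime.dvd_of_dvd_mul_left (((Nat.Prime.coprime_iff_not_dvd hq).mpr hX).pow_left k) hd
  have hcop : ∀ t : ℕ, n * M ∣ t → (q ∣ t ∨ ¬ q ∣ 1 + t) → (1 + t).Coprime (o * n) := by
    intro t ht hqt
    refine Nat.coprime_of_dvd fun p hp h1 h2 => ?_
    have key : p ∣ t → False := fun h3 => hp.one_lt.ne'
      (Nat.dvd_one.mp ((Nat.dvd_add_left h3).mp h1))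
    rcases (Nat.Prime.dvd_mul hp).mp h2 with h2 | h2
    · rw [hoM] at h2
      rcases (Nat.Prime.dvd_mul hp).mp h2 with h2 | h2
      · have := (Nat.prime_dvd_prime_iff_eq hp hq).mp (hp.dvd_of_dvd_pow h2)
        subst this
        rcases hqt with h | h
        exacts [key h, h h1]
      · exact key ((h2.mul_left n).trans ht)
    · exact key ((h2.mul_right M).trans ht)
  by_cases hqn' : q ∣ n
  · refine ⟨2 * (n * M), hcop _ (dvd_mul_left _ _) (Or.inl ((hqn'.mul_right M).mul_left 2)),
      (dvd_mul_right n M).mul_left 2, fun hd => hqn ?_⟩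
    have h1 : q ^ k ∣ M * ((1 + n * M) * (4 * n * B)) := by
      exact (hqo.trans hd).trans (dvd_of_eq (by ring))
    have h2 := hred (fun h3 => hq.one_lt.ne' (Nat.dvd_one.mp
      ((Nat.dvd_add_left (hqn'.mul_right M)).mp h3))) (hred hqM h1)
    exact (h2.mul_left 24).trans (dvd_of_eq (by ring))
  have hqnM : ¬ q ∣ n * M := by
    rw [hq.dvd_mul]; tauto
  have hcopr : (n * M).Coprime (q ^ 2) :=
    (((Nat.Prime.coprime_iff_not_dvd hq).mpr hqnM).pow_left 2).symm
  by_cases hq2 : q = 2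
  · subst hq2
    have hodd : n * M % 2 = 1 := by omega
    have h4 : (n * M) ^ 2 % 4 = 1 := by
      rw [Nat.pow_mod]
      have : n * M % 4 = 1 ∨ n * M % 4 = 3 := by omega
      rcases this with h | h <;> simp [h]
    refine ⟨2 * (n * M) ^ 2, hcop _ ⟨2 * (n * M), by ring⟩ (Or.inl (dvd_mul_right _ _)),
      ⟨2 * (n * M) * M, by ring⟩, fun hd => hqn ?_⟩
    obtain ⟨m, hm⟩ : ∃ m, (n * M) ^ 2 + 1 = 2 * (2 * m + 1) := ⟨(n * M) ^ 2 / 4, by omega⟩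
    have h1 : 2 ^ k ∣ (n * M) ^ 2 * ((2 * m + 1) * (8 * B)) := by
      refine (hqo.trans hd).trans (dvd_of_eq ?_)
      rw [show 2 * (n * M) ^ 2 + 2 = 2 * (2 * (2 * m + 1)) by omega]; ring
    have h2 := hred (by omega) (hred (fun h => hqnM (hq.dvd_of_dvd_pow h)) h1)
    exact (h2.mul_left (12 * n)).trans (dvd_of_eq (by ring))
  · have h1 : (n * M) ^ Nat.totient (q ^ 2) ≡ 1 [MOD q ^ 2] := Nat.ModEq.pow_totient hcopr
    set t := (n * M) ^ Nat.totient (q ^ 2) with ht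
    have hnt : n * M ∣ t := dvd_pow_self _ (Nat.totient_pos.mpr (by have := hq.pos; positivity)).ne'
    have hqt : ¬ q ∣ t := fun h => hqnM (hq.dvd_of_dvd_pow h)
    have htpos : 1 ≤ t := Nat.one_le_iff_ne_zero.mpr fun h => hqt (h ▸ dvd_zero q)
    obtain ⟨m, hm⟩ := (Nat.modEq_iff_dvd' htpos).mp h1.symm
    have hq1 : ¬ q ∣ 1 + t := by
      rw [show 1 + t = 2 + q * (q * m) by rw [← mul_assoc, ← pow_two, ← hm]; omega]
      intro h
      have := (Nat.dvd_add_left (dvd_mul_right q (q * m))).mp h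
      exact hq2 ((Nat.prime_dvd_prime_iff_eq hq Nat.prime_two).mp this)
    refine ⟨t, hcop _ hnt (Or.inr hq1), (dvd_mul_right n M).trans hnt, fun hd => hqn ?_⟩
    have h2 : q ^ k ∣ (t + 2) * B := hred hqt ((hqo.trans hd).trans (dvd_of_eq (by ring)))
    have ht2 : t + 2 = 3 + q * (q * m) := by rw [← mul_assoc, ← pow_two, ← hm]; omega
    by_cases hq3 : q = 3
    · rw [ht2, show (3 + q * (q * m)) * B = (1 + q * m) * (3 * B) by rw [hq3]; ring] at h2
      have h3 := hred (fun h => hq.one_lt.ne' (Nat.dvd_one.mp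
        ((Nat.dvd_add_left (dvd_mul_right q m)).mp h))) h2
      exact (h3.mul_left (32 * n)).trans (dvd_of_eq (by ring))
    · have h3 := hred (fun h => hq3 ((Nat.prime_dvd_prime_iff_eq hq Nat.prime_three).mp
        ((Nat.dvd_add_left (dvd_mul_right q (q * m))).mp (ht2 ▸ h)))) h2
      exact h3.mul_left _

end SL2Ab

namespace SL2Ab

open QuadraticAlgebra Filter

local notation "𝐍" => QuadraticAlgebra.norm (R := ℤ)

/-- A prime modulo which `Δ` is not a square. -/
structure Inert (Δ : ℤ) (r : ℕ) : Prop where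
  prime : r.Prime
  sym : jacobiSym Δ r = -1

namespace Inert

variable {Δ : ℤ} {r : ℕ} (h : Inert Δ r)

include h

theorem ne_two : r ≠ 2 := by
  rintro rfl
  have h1 := h.sym
  have : Fact (Nat.Prime 2) := ⟨Nat.prime_two⟩
  rw [← jacobiSym.legendreSym.to_jacobiSym, legendreSym] at h1
  by_cases h0 : (Δ : ZMod 2) = 0
  · rw [h0, quadraticChar_zero] at h1
    norm_num at h1
  · rw [quadraticChar_eq_one_of_char_two (ZMod.ringChar_zmod_n 2) h0] at h1
    norm_num at h1

theorem legendre [Fact r.Prime] : legendreSym r Δ = -1 := by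
  rw [jacobiSym.legendreSym.to_jacobiSym, h.sym]

theorem not_dvd : ¬ (r : ℤ) ∣ Δ := by
  have := Fact.mk h.prime
  intro hd
  have h1 := h.legendre
  rw [(legendreSym.eq_zero_iff r Δ).mpr ((ZMod.intCast_zmod_eq_zero_iff_dvd Δ r).mpr hd)] at h1
  norm_num at h1

end Inert

theorem eventually_not_dvd {m : ℤ} (hm : m ≠ 0) : ∀ᶠ r : ℕ in atTop, ¬ (r : ℤ) ∣ m := by
  filter_upwards [eventually_gt_atTop m.natAbs] with r hr hd
  have := Int.natAbs_le_of_dvd_ne_zero hd hm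
  simp at this
  omega

namespace Ctx

variable {a b : ℤ} {A : Type*} [CommRing A] {ι : Quad a b →+* A} {π : Quad a b} (hc : Ctx ι π)

include hc

theorem isCoprime_of_not_dvd {r : ℕ} (hr : Inert (b ^ 2 + 4 * a) r) {x : A} (hx : ¬ (r : A) ∣ x) :
    IsCoprime x (r : A) := by
  have := Fact.mk hr.prime
  obtain ⟨y, w, hy⟩ := hc.exists_rep (n := r) (by exact_mod_cast hr.prime.ne_zero) x
  have h1 : ¬ (r : Quad a b) ∣ y := by
    intro h
    have := map_dvd ι h
    rw [map_natCast] at this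
    apply hx
    rw [sub_eq_iff_eq_add] at hy
    rw [hy]
    exact dvd_add (by simp) this
  have h2 := isCoprime_intCast (A := A) (isCoprime_natPrime hr.prime
    (Quad.not_dvd_norm hr.legendre hr.ne_two h1)).symm
  have h3 := h2.of_isCoprime_of_dvd_left (x := ι y) (by simpa using map_dvd ι (Quad.dvd_norm y))
  rw [sub_eq_iff_eq_add'] at hy
  rw [hy]
  simpa using h3.add_mul_left_left w

theorem unit_supply [Nontrivial A] {q₀ : ℤ} (hq₀ : q₀ ≠ 0) {n : ℕ} (hn : n ≠ 0) :
    ∀ᶠ r : ℕ in atTop, Inert (b ^ 2 + 4 * a) r → ∃ (o t : ℕ) (η : A), o ≠ 0 ∧ o.Coprime r ∧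
      (1 + t).Coprime (o * n) ∧ n ∣ t ∧ ¬ (r : A) ∣ 1 - η ∧ ∀ s : ℕ, s.Prime → s ≠ 2 →
      ¬ (s : ℤ) ∣ b ^ 2 + 4 * a → ¬ (s : ℤ) ∣ q₀ → (s : ℤ) ≡ 1 + t [ZMOD o] →
      ∃ u v z : A, u * v = 1 ∧ u ^ 2 - 1 = s * (q₀ * z) ∧ (r : A) ∣ u ^ 2 - η := by
  obtain ⟨ε, hε, hinf⟩ := hc.inf
  obtain ⟨B, hB, hqB⟩ := hc.exists_pow_sub_one hε hq₀
  obtain ⟨m, hm, hdm⟩ := hc.exists_int_multiple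
    (sub_ne_zero.mpr (hinf (2 * (96 * n * B)) (by positivity)))
  filter_upwards [eventually_not_dvd hm, eventually_not_dvd hc.norm_pi_ne_zero] with r hrm hrP hr
  set o := orderOf (Ideal.Quotient.mk (Ideal.span {(r : A)}) (ε ^ 2)) with ho
  have key : ∀ k : ℕ, o ∣ k ↔ (r : A) ∣ ε ^ (2 * k) - 1 := by
    intro k
    rw [ho, orderOf_dvd_iff_pow_eq_one, ← map_pow, ← map_one (Ideal.Quotient.mk _),
      Ideal.Quotient.mk_eq_mk_iff_sub_mem, Ideal.mem_span_singleton, pow_mul]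
  have hor : o ∣ r ^ 2 - 1 := by
    rw [key, mul_comm]
    exact dvd_pow_mul_sub_one (by simpa using hc.pow_prime_sq_sub_one hε hr.prime hr.ne_two hr.not_dvd) 2
  have hr1 : r ^ 2 - 1 + 1 = r ^ 2 := Nat.sub_add_cancel (Nat.one_le_pow _ _ hr.prime.pos)
  have hr2 : r ^ 2 - 1 ≠ 0 := by
    have := hr.prime.two_le
    have : 2 ^ 2 ≤ r ^ 2 := Nat.pow_le_pow_left this 2
    omega
  have ho0 : o ≠ 0 := fun h => hr2 (zero_dvd_iff.mp (h ▸ hor))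
  have hcop : o.Coprime r := by
    refine Nat.Coprime.coprime_dvd_left hor ?_
    refine Nat.Coprime.coprime_dvd_right (dvd_pow_self r two_ne_zero) ?_
    rw [← hr1]; simp
  have hno : ¬ o ∣ 96 * n * B := by
    rw [key]
    intro h
    apply hrm
    refine hc.int_dvd_of_dvd ?_ (isCoprime_natPrime hr.prime hrP)
    simpa using h.trans hdm
  obtain ⟨t, ht1, ht2, ht3⟩ := exists_residue_not_dvd ho0 hno
  refine ⟨o, t, ε ^ (2 * (t * (t + 2) * B)), ho0, hcop, ht1, ht2, ?_, ?_⟩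
  · rw [dvd_sub_comm, ← key]; exact ht3
  · intro s hs hs2 hsD hsq hst
    obtain ⟨v, hv⟩ := (hε.pow ((s ^ 2 - 1) * B)).exists_right_inv
    have h1 : (s : A) ∣ (ε ^ ((s ^ 2 - 1) * B)) ^ 2 - 1 := by
      rw [← pow_mul, mul_assoc]
      simpa using dvd_pow_mul_sub_one (hc.pow_prime_sq_sub_one hε hs hs2 hsD) (B * 2)
    have h2 : (q₀ : A) ∣ (ε ^ ((s ^ 2 - 1) * B)) ^ 2 - 1 := by
      rw [← pow_mul, mul_comm _ B, mul_assoc]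
      exact dvd_pow_mul_sub_one hqB _
    have h3 : IsCoprime (s : A) (q₀ : A) := by
      simpa using isCoprime_intCast (A := A) (isCoprime_natPrime hs hsq)
    obtain ⟨z, hz⟩ := h3.mul_dvd h1 h2
    refine ⟨_, v, z, hv, by rw [hz, mul_assoc], ?_⟩
    have hs1 : s ^ 2 - 1 + 1 = s ^ 2 := Nat.sub_add_cancel (Nat.one_le_pow _ _ hs.pos)
    have h4 : (s ^ 2 - 1) * B ≡ t * (t + 2) * B [MOD o] := by
      refine Nat.ModEq.mul_right B (Nat.ModEq.add_right_cancel' 1 ?_)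
      rw [hs1, show t * (t + 2) + 1 = (1 + t) ^ 2 by ring]
      exact Nat.ModEq.pow 2 (by rw [← Int.natCast_modEq_iff]; exact_mod_cast hst)
    have h5 : Ideal.Quotient.mk (Ideal.span {(r : A)}) (ε ^ 2) ^ ((s ^ 2 - 1) * B) =
        Ideal.Quotient.mk (Ideal.span {(r : A)}) (ε ^ 2) ^ (t * (t + 2) * B) := by
      have h4' : (s ^ 2 - 1) * B % o = t * (t + 2) * B % o := h4
      rw [← pow_mod_orderOf, ← ho, h4', ho, pow_mod_orderOf]
    rw [← map_pow, ← map_pow, Ideal.Quotient.mk_eq_mk_iff_sub_mem, Ideal.mem_span_singleton,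
      ← pow_mul,
      ← pow_mul] at h5
    rwa [← pow_mul, mul_comm _ 2]

end Ctx

/-- Dirichlet's theorem with three pairwise coprime moduli. -/
theorem exists_prime_of_crt₃ (B : ℕ) {l m n x y z : ℤ} (hl : l ≠ 0) (hm : m ≠ 0) (hn : n ≠ 0)
    (hlm : IsCoprime l m) (hln : IsCoprime l n) (hmn : IsCoprime m n)
    (hx : IsCoprime x l) (hy : IsCoprime y m) (hz : IsCoprime z n) :
    ∃ p : ℕ, B < p ∧ p.Prime ∧ (p : ℤ) ≡ x [ZMOD l] ∧ (p : ℤ) ≡ y [ZMOD m] ∧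
      (p : ℤ) ≡ z [ZMOD n] := by
  obtain ⟨q, -, -, hqy, hqz⟩ := exists_prime_of_crt 0 hm hn hmn hy hz
  obtain ⟨p, hp1, hp2, hp3, hp4⟩ := exists_prime_of_crt (x := x) (y := q) B hl (mul_ne_zero hm hn)
    (hlm.mul_right hln) hx ((isCoprime_of_modEq hqy hy).mul_right (isCoprime_of_modEq hqz hz))
  exact ⟨p, hp1, hp2, hp3, (hp4.of_dvd (dvd_mul_right _ _)).trans hqy,
    (hp4.of_dvd (dvd_mul_left _ _)).trans hqz⟩

theorem not_dvd_of_lt {s : ℕ} {m : ℤ} (hm : m ≠ 0) (h : m.natAbs < s) : ¬ (s : ℤ) ∣ m :=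
    fun hd => by
  have := Int.natAbs_le_of_dvd_ne_zero hd hm
  simp at this
  omega

theorem Quad.eq_add_mul {a b : ℤ} (z : Quad a b) :
    z = ((z.re : ℤ) : Quad a b) + ((z.im : ℤ) : Quad a b) * (⟨0, 1⟩ : Quad a b) := by
  ext <;> simp

variable {a b : ℤ} {A : Type*} [CommRing A] {ι : Quad a b →+* A} {π : Quad a b}
variable {C : Type*} [AddCommGroup C] {F : A → A → A → A → C}

theorem IsHom.exists_level (hF : IsHom F) (hc : Ctx ι π) :
    ∃ q : ℤ, q ≠ 0 ∧ ∀ t, hF.upper (q * t) = 0 := by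
  obtain ⟨ε, hε, hinf⟩ := hc.inf
  obtain ⟨v, hv⟩ := hε.exists_right_inv
  obtain ⟨m, hm, k, hk⟩ := hc.exists_int_multiple (sub_ne_zero.mpr (hinf 2 two_pos))
  refine ⟨m, hm, fun t => ?_⟩
  have h1 : hF.upper (ε ^ 2 * (k * t)) = hF.upper (k * t) := by
    rw [← hF.upper_eq, ← hF.upper_eq]
    exact hF.conj (p := ε) (q := 0) (r := 0) (s := v) (by linear_combination hv) (by ring) (by ring)
      (by linear_combination (ε * (k * t)) * hv) (by ring) (by ring)
  rw [hk, show (ε ^ 2 - 1) * k * t = ε ^ 2 * (k * t) - k * t by ring, map_sub, h1, sub_self]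

theorem IsHom.conj_upper_add_mul (hF : IsHom F) {a b c d r j m j' : A}
    (hdet : (1 + r * a) * (1 + r * d) - r * b * (r * c) = 1) (hj : j' = j + r * m) :
    F (1 + r * a + j' * r * c) (b + j' * (d - a) - j' ^ 2 * c) (r ^ 2 * c)
      (1 + r * d - j' * r * c) =
    F (1 + r * a + j * r * c) (b + j * (d - a) - j ^ 2 * c) (r ^ 2 * c)
      (1 + r * d - j * r * c) := by
  subst hj
  exact hF.conj (p := 1) (q := m) (r := 0) (s := 1) (by ring) (by linear_combination hdet)
    (by ring) (by ring) (by ring) (by ring)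

variable [IsDomain A]

theorem Ctx.upper_sq_aux (hc : Ctx ι π) (hF : IsHom F) {q₀ : ℤ} (hq₀ : q₀ ≠ 0)
    (h₀ : ∀ t, hF.upper (q₀ * t) = 0) {z : Quad a b} (hz : z ≠ 0) :
    ∀ᶠ r : ℕ in atTop, Inert (b ^ 2 + 4 * a) r → hF.upper (((r : A) ^ 2 - 1) * ι z) = 0 := by
  obtain ⟨n, hn⟩ : ∃ n : ℕ, 𝐍 z = n := ⟨(𝐍 z).toNat, (Int.toNat_of_nonneg
    (Quad.norm_pos hc.neg hz).le).symm⟩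
  have hn0 : n ≠ 0 := by
    rintro rfl
    exact Quad.norm_ne_zero hc.neg hz (by simpa using hn)
  filter_upwards [hc.unit_supply hq₀ hn0, eventually_not_dvd (m := n) (by exact_mod_cast hn0),
    eventually_not_dvd hc.norm_pi_ne_zero] with r hU hrn hrP hr
  obtain ⟨o, t, η, ho, hor, htc, hnt, hη, hU⟩ := hU hr
  have hr0 : (r : ℤ) ≠ 0 := by exact_mod_cast hr.prime.ne_zero
  have hcrn : IsCoprime (r : ℤ) n := isCoprime_natPrime hr.prime hrn
  obtain ⟨s, hs1, hs, hso, hsr⟩ := exists_prime_of_crt (2 + (b ^ 2 + 4 * a).natAbs + q₀.natAbs)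
    (m := o * n) (n := r ^ 2) (x := 1 + t) (y := 1 + r * n) (by positivity) (by positivity)
    (((Nat.isCoprime_iff_coprime.mpr hor).mul_left hcrn.symm).pow_right)
    (by exact_mod_cast Nat.isCoprime_iff_coprime.mpr htc)
    (IsCoprime.pow_right ⟨1, -n, by ring⟩)
  obtain ⟨u, v, z', huv, hu, hur⟩ := hU s hs (by omega) (not_dvd_of_lt hc.neg.ne (by omega))
    (not_dvd_of_lt hq₀ (by omega)) (hso.of_dvd (dvd_mul_right _ _))
  obtain ⟨w, hw⟩ : (r * n : ℤ) ∣ s - 1 := by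
    refine hcrn.mul_dvd ?_ ?_
    · obtain ⟨k, hk⟩ := hsr.symm.dvd
      exact ⟨r * k + n, by linear_combination hk⟩
    · obtain ⟨k, hk⟩ := hso.symm.dvd
      obtain ⟨l, rfl⟩ := hnt
      exact ⟨o * k + l, by push_cast at hk; linear_combination hk⟩
  have hwr : IsCoprime w (r : ℤ) := by
    have h1 : (r : ℤ) ∣ n * (w - 1) := by
      obtain ⟨k, hk⟩ := hsr.symm.dvd
      exact ⟨k, mul_left_cancel₀ hr0 (by linear_combination hk - hw)⟩
    obtain ⟨k, hk⟩ := hcrn.dvd_of_dvd_mul_left h1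
    exact ⟨1, -k, by linear_combination hk⟩
  have hzz : ι z * ι (star z) = (n : A) := by
    rw [← map_mul, Quad.mul_star_self, hn]; simp
  have hwA : (r : A) * n * w = s - 1 := by
    have := congrArg (Int.cast : ℤ → A) hw
    push_cast at this
    exact this.symm
  have hkr : IsCoprime (-(w : A) * ι (star z)) (r : A) := by
    refine IsCoprime.mul_left (IsCoprime.neg_left ?_) ?_
    · simpa using isCoprime_intCast (A := A) hwr
    · refine IsCoprime.of_isCoprime_of_dvd_left (y := (n : A)) ?_ ⟨ι z, by rw [← hzz]; ring⟩
      simpa using isCoprime_intCast (A := A) hcrn.symm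
  have hjr : IsCoprime ((1 - u ^ 2) * (-(w : A) * ι (star z))) (r : A) := by
    refine IsCoprime.mul_left (hc.isCoprime_of_not_dvd hr fun h => hη ?_) hkr
    have := dvd_add h hur
    rwa [show 1 - u ^ 2 + (u ^ 2 - η) = 1 - η by ring] at this
  have key := hF.conj_upper_of_unit h₀ (a := 0) (b := 0) (c := ι z) (d := 0) (r := (r : A))
    (by ring) huv hkr (z := z') (by
      rw [hu]
      linear_combination (-w * r * (q₀ * z')) * hzz - (q₀ * z') * hwA) rfl
  have h2 := hF.parabolic (-ι z) hjr
  have h3 := hF.lower_eq ((r : A) ^ 2 * ι z)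
  rw [sub_mul, one_mul, map_sub, sub_eq_zero]
  rw [map_neg] at h2
  refine neg_injective ?_
  rw [← h2, ← h3]
  convert key.symm using 1 <;> congr 1 <;> ring

/-- Upper unipotents are invariant under multiplication by `r²`. -/
theorem Ctx.upper_sq (hc : Ctx ι π) (hF : IsHom F) {q₀ : ℤ} (hq₀ : q₀ ≠ 0)
    (h₀ : ∀ t, hF.upper (q₀ * t) = 0) :
    ∀ᶠ r : ℕ in atTop, Inert (b ^ 2 + 4 * a) r → ∀ x, hF.upper (((r : A) ^ 2 - 1) * x) = 0 := by
  filter_upwards [hc.upper_sq_aux hF hq₀ h₀ one_ne_zero, hc.upper_sq_aux hF hq₀ h₀ (z := ⟨0, 1⟩)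
    (fun h => by simpa using congrArg QuadraticAlgebra.im h)] with r h1 h2 hr x
  obtain ⟨y, w, hy⟩ := hc.exists_rep hq₀ x
  rw [map_one] at h1
  have hx : ((r : A) ^ 2 - 1) * x = q₀ * (((r : A) ^ 2 - 1) * w) + y.re • (((r : A) ^ 2 - 1) * 1) +
      y.im • (((r : A) ^ 2 - 1) * ι ⟨0, 1⟩) := by
    rw [sub_eq_iff_eq_add.mp hy]
    conv_lhs => rw [Quad.eq_add_mul y]
    simp only [map_add, map_mul, map_intCast, zsmul_eq_mul]
    ring
  rw [hx, map_add, map_add, map_zsmul, map_zsmul, h1 hr, h2 hr, h₀]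
  simp

/-- Invariance of twisted values on the principal congruence subgroup of level `r` under conjugation
by upper unipotents. -/
theorem Ctx.central (hc : Ctx ι π) (hF : IsHom F) {q₀ : ℤ} (hq₀ : q₀ ≠ 0)
    (h₀ : ∀ t, hF.upper (q₀ * t) = 0) :
    ∀ᶠ r : ℕ in atTop, Inert (b ^ 2 + 4 * a) r → ∀ a b c d j : A,
      (1 + r * a) * (1 + r * d) - r * b * (r * c) = 1 →
      F (1 + r * a + j * r * c) (b + j * (d - a) - j ^ 2 * c) (r ^ 2 * c) (1 + r * d - j * r * c) =
        F (1 + r * a) b (r ^ 2 * c) (1 + r * d) := by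
  filter_upwards [hc.unit_supply hq₀ one_ne_zero, hc.upper_sq hF hq₀ h₀,
    eventually_not_dvd hc.norm_pi_ne_zero] with r hU hS hrP hr a₁ b₁ c d j hdet
  by_cases hj : (r : A) ∣ j
  · obtain ⟨m, rfl⟩ := hj
    rw [hF.conj_upper_add_mul hdet (j := 0) (m := m) (by ring)]
    congr 1 <;> ring
  obtain ⟨o, t, η, ho, hor, htc, -, hη, hU⟩ := hU hr
  have hr1 : ¬ (r : A) ∣ 1 := by
    intro h
    have := hc.int_dvd_of_dvd (n := r) (m := 1) (by simpa using h) (isCoprime_natPrime hr.prime hrP)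
    exact hr.prime.one_lt.ne' (by exact_mod_cast Int.eq_one_of_dvd_one (by positivity) this)
  have := hc.charZero
  have hrA : (r : A) ≠ 0 := by exact_mod_cast hr.prime.ne_zero
  have hjr := hc.isCoprime_of_not_dvd hr hj
  obtain ⟨x, y, hxy⟩ := hc.isCoprime_of_not_dvd hr hη
  obtain ⟨k₀, hk₀⟩ : ∃ k₀, (r : A) ∣ (1 - η) * k₀ - j :=
    ⟨x * j, -(y * j), by linear_combination j * hxy⟩
  have hk₀r : IsCoprime k₀ (r : A) := hc.isCoprime_of_not_dvd hr fun h => hj (by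
    have := dvd_sub (h.mul_left (1 - η)) hk₀
    rwa [sub_sub_cancel] at this)
  obtain ⟨μ, hμ⟩ : ∃ μ : ℤ, ¬ (r : A) ∣ d - μ := by
    by_cases h : (r : A) ∣ d
    · exact ⟨1, fun h' => hr1 (by simpa using dvd_sub h h')⟩
    · exact ⟨0, by simpa⟩
  have hμr := hc.isCoprime_of_not_dvd hr hμ
  obtain ⟨c', hc'⟩ : ∃ c', (r : A) ∣ k₀ * c' - (d - μ) := by
    obtain ⟨x, y, hxy⟩ := hk₀r
    exact ⟨x * (d - μ), -(y * (d - μ)), by linear_combination (d - μ) * hxy⟩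
  have hc'r : IsCoprime c' (r : A) := hc.isCoprime_of_not_dvd hr fun h => hμ (by
    have := dvd_sub (h.mul_left k₀) hc'
    rwa [sub_sub_cancel] at this)
  have hD : 1 + r * d ≠ 0 := fun h => hr1 ⟨-d, by linear_combination h⟩
  have hcop : IsCoprime (c + (c' - c) * (1 + r * d)) (r * (1 + r * d)) := by
    refine IsCoprime.mul_right ?_ ?_
    · obtain ⟨x, y, hxy⟩ := hc'r
      exact ⟨x, y - x * d * (c' - c), by linear_combination hxy⟩
    · exact ⟨-r * b₁ * r, 1 + r * a₁ + r * b₁ * r * (c' - c), by linear_combination hdet⟩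
  obtain ⟨m, e, hme, hep, hen⟩ := hc.exists_primitive hcop (mul_ne_zero hrA hD)
    (B := o * 𝐍 π * r) (mul_ne_zero (mul_ne_zero (by exact_mod_cast ho) hc.norm_pi_ne_zero)
      (by exact_mod_cast hr.prime.ne_zero))
  have hner := hen.of_mul_right_right
  have hneo := hen.of_mul_right_left.of_mul_right_left
  have hneP := hen.of_mul_right_left.of_mul_right_right
  have he0 : e ≠ 0 := by
    rintro rfl
    have : IsCoprime (0 : ℤ) 0 := hep
    exact not_isUnit_zero (isCoprime_zero_left.mp this)
  have hne := Quad.norm_ne_zero hc.neg he0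
  set M := c' - c + m * r with hM
  have heM : ι e = c + M * (1 + r * d) := by rw [← hme, hM]; ring
  have hdet' : (1 + r * (a₁ + r * b₁ * M)) * (1 + r * d) - r * b₁ * (r * ι e) = 1 := by
    rw [heM]; linear_combination hdet
  obtain ⟨i, hi⟩ := hc.exists_int hep (1 + r * d)
  have hin : IsCoprime i (𝐍 e) := by
    refine hc.isCoprime_norm he0 hneP ?_
    obtain ⟨w, hw⟩ := hi
    refine ⟨1 + r * (a₁ + r * b₁ * M), w * (1 + r * (a₁ + r * b₁ * M)) - r * b₁ * r, ?_⟩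
    linear_combination hdet' - (1 + r * (a₁ + r * b₁ * M)) * hw
  obtain ⟨s, hs1, hs, hso, hsr, hsn⟩ := exists_prime_of_crt₃
    (2 + (b ^ 2 + 4 * a).natAbs + q₀.natAbs)
    (l := o) (m := r ^ 2) (n := 𝐍 e) (x := 1 + t) (y := 1 + r * μ) (z := i) (by exact_mod_cast ho)
    (pow_ne_zero 2 (by exact_mod_cast hr.prime.ne_zero)) hne
    ((Nat.isCoprime_iff_coprime.mpr hor).pow_right) hneo.symm hner.symm.pow_left
    (by
      have : (1 + t).Coprime o := by simpa using htc
      exact_mod_cast Nat.isCoprime_iff_coprime.mpr this)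
    (IsCoprime.pow_right ⟨1, -μ, by ring⟩) hin
  obtain ⟨u, v, z', huv, hu, hur⟩ := hU s hs (by omega) (not_dvd_of_lt hc.neg.ne (by omega))
    (not_dvd_of_lt hq₀ (by omega)) hso
  have her : IsCoprime (r : A) (ι e) := by
    have := (isCoprime_intCast (A := A) hner).of_isCoprime_of_dvd_left (x := ι e)
      (by simpa using map_dvd ι (Quad.dvd_norm e))
    simpa using this.symm
  obtain ⟨f, hf⟩ : ∃ f : ℤ, (s : ℤ) = 1 + r * μ + r ^ 2 * f := by
    obtain ⟨f, hf⟩ := hsr.symm.dvd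
    exact ⟨f, by linear_combination hf⟩
  have hfA : (s : A) = 1 + r * μ + r ^ 2 * f := by
    have := congrArg (Int.cast : ℤ → A) hf
    push_cast at this
    exact this
  obtain ⟨k, hk⟩ : (r * ι e : A) ∣ 1 + r * d - s := by
    refine her.mul_dvd ⟨d - μ - r * f, by rw [hfA]; ring⟩ ?_
    obtain ⟨g, hg⟩ := hsn.dvd
    have h1 : ι e ∣ ((𝐍 e : ℤ) : A) := by simpa using map_dvd ι (Quad.dvd_norm e)
    have h2 : ι e ∣ (i : A) - s := by
      have := congrArg (Int.cast : ℤ → A) hg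
      push_cast at this
      rw [this]
      exact h1.mul_right _
    simpa using dvd_add hi h2
  have hke : ι e * k = d - μ - r * f := by
    apply mul_left_cancel₀ hrA
    rw [hfA] at hk
    linear_combination -hk
  have hek : (r : A) ∣ k - k₀ := by
    refine (hc'r.symm).dvd_of_dvd_mul_left ?_
    obtain ⟨g, hg⟩ := hc'
    refine ⟨-f - g - k * (d * (c' - c) + m * (1 + r * d)), ?_⟩
    have : ι e = c' + r * (d * (c' - c) + m * (1 + r * d)) := by rw [← hme]; ring
    rw [this] at hke
    linear_combination hke - hg
  have hkr : IsCoprime k (r : A) := by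
    obtain ⟨g, hg⟩ := hek
    rw [show k = k₀ + r * g by linear_combination hg]
    exact hk₀r.add_mul_left_left g
  have hjj : ∃ g, j = (1 - u ^ 2) * k + r * g := by
    obtain ⟨g₁, h₁⟩ := hek
    obtain ⟨g₂, h₂⟩ := hur
    obtain ⟨g₃, h₃⟩ := hk₀
    exact ⟨g₂ * k - (1 - η) * g₁ - g₃, by linear_combination k * h₂ - (1 - η) * h₁ - h₃⟩
  obtain ⟨g, hg⟩ := hjj
  have key := hF.conj_upper_of_unit h₀ hdet' huv hkr (z := z') (by
    rw [hu]; linear_combination (-q₀ * z') * hk) rfl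
  rw [← hF.conj_upper_add_mul hdet' hg] at key
  have hp := hF.parabolic (-M) hjr
  have hrM := hS hr M
  rw [sub_mul, one_mul, map_sub, sub_eq_zero] at hrM
  rw [map_neg, ← hrM] at hp
  have e1 := hF.mul' (a'' := 1 + r * (a₁ + r * b₁ * M)) (b'' := b₁) (c'' := r ^ 2 * ι e)
    (d'' := 1 + r * d) (a := 1 + r * a₁) (b := b₁) (c := r ^ 2 * c) (d := 1 + r * d)
    (a' := 1) (b' := 0) (c' := r ^ 2 * M) (d' := 1) (by linear_combination hdet) (by ring)
    (by ring) (by ring) (by rw [heM]; ring) (by ring)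
  have e2 := hF.mul' (a'' := 1 + r * (a₁ + r * b₁ * M) + j * r * ι e)
    (b'' := b₁ + j * (d - (a₁ + r * b₁ * M)) - j ^ 2 * ι e) (c'' := r ^ 2 * ι e)
    (d'' := 1 + r * d - j * r * ι e) (a := 1 + r * a₁ + j * r * c)
    (b := b₁ + j * (d - a₁) - j ^ 2 * c) (c := r ^ 2 * c) (d := 1 + r * d - j * r * c)
    (a' := 1 - j * r * (-M)) (b' := j ^ 2 * (-M)) (c' := -(r ^ 2 * (-M))) (d' := 1 + j * r * (-M))
    (by linear_combination hdet) (by ring)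
    (by rw [heM]; ring) (by rw [heM]; ring) (by rw [heM]; ring) (by rw [heM]; ring)
  rw [hF.lower_eq] at e1
  rw [hp] at e2
  rw [e1, e2] at key
  exact add_right_cancel key

end SL2Ab

namespace SL2Ab

open Matrix

section Twist

variable {A C : Type*} [CommRing A] [AddCommGroup C]

/-- Upper elementary matrices. -/
def elemU (t : A) : SpecialLinearGroup (Fin 2) A := ⟨!![1, t; 0, 1], by simp⟩

/-- Lower elementary matrices. -/
def elemL (t : A) : SpecialLinearGroup (Fin 2) A := ⟨!![1, 0; t, 1], by simp⟩

/-- The Weyl element. -/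
def weylElt : SpecialLinearGroup (Fin 2) A := ⟨!![0, 1; -1, 0], by simp⟩

@[simp] theorem mul_00 (g h : SpecialLinearGroup (Fin 2) A) :
    (g * h) 0 0 = g 0 0 * h 0 0 + g 0 1 * h 1 0 := by
  simp [Matrix.mul_apply, Fin.sum_univ_two]

@[simp] theorem mul_01 (g h : SpecialLinearGroup (Fin 2) A) :
    (g * h) 0 1 = g 0 0 * h 0 1 + g 0 1 * h 1 1 := by
  simp [Matrix.mul_apply, Fin.sum_univ_two]

@[simp] theorem mul_10 (g h : SpecialLinearGroup (Fin 2) A) :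
    (g * h) 1 0 = g 1 0 * h 0 0 + g 1 1 * h 1 0 := by
  simp [Matrix.mul_apply, Fin.sum_univ_two]

@[simp] theorem mul_11 (g h : SpecialLinearGroup (Fin 2) A) :
    (g * h) 1 1 = g 1 0 * h 0 1 + g 1 1 * h 1 1 := by
  simp [Matrix.mul_apply, Fin.sum_univ_two]

theorem det_eq (g : SpecialLinearGroup (Fin 2) A) : g 0 0 * g 1 1 - g 0 1 * g 1 0 = 1 := by
  rw [← Matrix.det_fin_two]; exact g.2

@[simp] theorem inv_00 (g : SpecialLinearGroup (Fin 2) A) : g⁻¹ 0 0 = g 1 1 := by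
  simp [adjugate_fin_two]

@[simp] theorem inv_01 (g : SpecialLinearGroup (Fin 2) A) : g⁻¹ 0 1 = -g 0 1 := by
  simp [adjugate_fin_two]

@[simp] theorem inv_10 (g : SpecialLinearGroup (Fin 2) A) : g⁻¹ 1 0 = -g 1 0 := by
  simp [adjugate_fin_two]

@[simp] theorem inv_11 (g : SpecialLinearGroup (Fin 2) A) : g⁻¹ 1 1 = g 0 0 := by
  simp [adjugate_fin_two]

@[simp] theorem elemU_00 (t : A) : elemU t 0 0 = 1 := rfl

@[simp] theorem elemU_01 (t : A) : elemU t 0 1 = t := rfl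

@[simp] theorem elemU_10 (t : A) : elemU t 1 0 = 0 := rfl

@[simp] theorem elemU_11 (t : A) : elemU t 1 1 = 1 := rfl

@[simp] theorem elemL_00 (t : A) : elemL t 0 0 = 1 := rfl

@[simp] theorem elemL_01 (t : A) : elemL t 0 1 = 0 := rfl

@[simp] theorem elemL_10 (t : A) : elemL t 1 0 = t := rfl

@[simp] theorem elemL_11 (t : A) : elemL t 1 1 = 1 := rfl

@[simp] theorem weylElt_00 : (weylElt : SpecialLinearGroup (Fin 2) A) 0 0 = 0 := rfl

@[simp] theorem weylElt_01 : (weylElt : SpecialLinearGroup (Fin 2) A) 0 1 = 1 := rfl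

@[simp] theorem weylElt_10 : (weylElt : SpecialLinearGroup (Fin 2) A) 1 0 = -1 := rfl

@[simp] theorem weylElt_11 : (weylElt : SpecialLinearGroup (Fin 2) A) 1 1 = 0 := rfl

theorem sl_ext {g h : SpecialLinearGroup (Fin 2) A} (h1 : g 0 0 = h 0 0) (h2 : g 0 1 = h 0 1)
    (h3 : g 1 0 = h 1 0) (h4 : g 1 1 = h 1 1) : g = h := by
  ext i j
  fin_cases i <;> fin_cases j <;> assumption

theorem elemU_add (s t : A) : elemU (s + t) = elemU s * elemU t := by
  apply sl_ext <;> simp [add_comm]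

theorem elemL_add (s t : A) : elemL (s + t) = elemL s * elemL t := by
  apply sl_ext <;> simp

theorem elemU_neg (t : A) : elemU (-t) = (elemU t)⁻¹ := by
  rw [eq_inv_iff_mul_eq_one, ← elemU_add, neg_add_cancel]
  apply sl_ext <;> simp

theorem elemL_neg (t : A) : elemL (-t) = (elemL t)⁻¹ := by
  rw [eq_inv_iff_mul_eq_one, ← elemL_add, neg_add_cancel]
  apply sl_ext <;> simp

/-- The principal congruence subgroup. -/
def princ (r : A) : Subgroup (SpecialLinearGroup (Fin 2) A) :=
  (SpecialLinearGroup.map (Ideal.Quotient.mk (Ideal.span {r}))).ker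

instance (r : A) : (princ r).Normal := by unfold princ; infer_instance

theorem mem_princ {r : A} {g : SpecialLinearGroup (Fin 2) A} :
    g ∈ princ r ↔ r ∣ g 0 0 - 1 ∧ r ∣ g 0 1 ∧ r ∣ g 1 0 ∧ r ∣ g 1 1 - 1 := by
  rw [princ, MonoidHom.mem_ker]
  refine (Matrix.SpecialLinearGroup.ext_iff _ _).trans ?_
  simp only [Fin.forall_fin_two, ← Ideal.mem_span_singleton, ← Ideal.Quotient.eq_zero_iff_mem,
    map_sub,
    sub_eq_zero, map_one, and_assoc]
  rfl

open Classical in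
/-- A homomorphism on `SL₂`, twisted by conjugation by the diagonal matrix with entries `r, 1`; it
is meaningful on matrices with upper right entry divisible by `r`. -/
noncomputable def twist (F : A → A → A → A → C) (r : A) (g : SpecialLinearGroup (Fin 2) A) : C :=
  F (g 0 0) (if h : r ∣ g 0 1 then h.choose else 0) (r * g 1 0) (g 1 1)

variable [IsDomain A] {F : A → A → A → A → C} {r : A}

omit [AddCommGroup C] in
theorem twist_eq (hr : r ≠ 0) {g : SpecialLinearGroup (Fin 2) A} {β : A} (h : g 0 1 = r * β) :
    twist F r g = F (g 0 0) β (r * g 1 0) (g 1 1) := by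
  have hd : r ∣ g 0 1 := ⟨β, h⟩
  have := hd.choose_spec
  rw [twist, dif_pos hd, mul_left_cancel₀ hr (this.symm.trans h)]

omit [IsDomain A] in
theorem dvd_mul_01 {g h : SpecialLinearGroup (Fin 2) A} (hg : r ∣ g 0 1) (hh : r ∣ h 0 1) :
    r ∣ (g * h) 0 1 := by
  rw [mul_01]; exact dvd_add (hh.mul_left _) (hg.mul_right _)

theorem IsHom.twist_mul (hF : IsHom F) (hr : r ≠ 0) {g h : SpecialLinearGroup (Fin 2) A}
    (hg : r ∣ g 0 1) (hh : r ∣ h 0 1) : twist F r (g * h) = twist F r g + twist F r h := by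
  obtain ⟨β, hβ⟩ := hg
  obtain ⟨γ, hγ⟩ := hh
  have d1 := det_eq g
  have d2 := det_eq h
  rw [twist_eq hr hβ, twist_eq hr hγ, twist_eq hr (β := g 0 0 * γ + β * h 1 1)
    (by rw [mul_01, hβ, hγ]; ring), mul_00, mul_10, mul_11]
  rw [hβ] at d1
  rw [hγ] at d2
  exact hF.mul' (by linear_combination d1) (by linear_combination d2) (by rw [hβ]; ring) rfl
    (by ring)
    (by rw [hγ]; ring)

theorem IsHom.twist_inv (hF : IsHom F) (hr : r ≠ 0) {g : SpecialLinearGroup (Fin 2) A}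
    (hg : r ∣ g 0 1) : twist F r g⁻¹ = -twist F r g := by
  have h1 : r ∣ g⁻¹ 0 1 := by rw [inv_01]; exact hg.neg_right
  have h2 := hF.twist_mul hr h1 hg
  rw [inv_mul_cancel, twist_eq hr (β := 0) (by simp)] at h2
  have h3 : F ((1 : SpecialLinearGroup (Fin 2) A) 0 0) 0
    (r * (1 : SpecialLinearGroup (Fin 2) A) 1 0)
      ((1 : SpecialLinearGroup (Fin 2) A) 1 1) = 0 := by
    convert hF.one using 1
    congr 1
    exact mul_zero r
  rw [h3] at h2
  exact eq_neg_of_add_eq_zero_left h2.symm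

/-- Elements whose conjugation action preserves the twist on the principal congruence subgroup. -/
def Preserves (F : A → A → A → A → C) (r : A) (g : SpecialLinearGroup (Fin 2) A) : Prop :=
  ∀ n ∈ princ r, twist F r (g * n * g⁻¹) = twist F r n

omit [AddCommGroup C] [IsDomain A] in
theorem Preserves.mul {g h : SpecialLinearGroup (Fin 2) A} (hg : Preserves F r g)
    (hh : Preserves F r h) : Preserves F r (g * h) := by
  intro n hn
  rw [show g * h * n * (g * h)⁻¹ = g * (h * n * h⁻¹) * g⁻¹ by group,
    hg _ ((inferInstance : (princ r).Normal).conj_mem n hn h), hh n hn]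

/-- Equality up to elements of the principal congruence subgroup with trivial twist. -/
def Rel (F : A → A → A → A → C) (r : A) (g h : SpecialLinearGroup (Fin 2) A) : Prop :=
  ∃ n ∈ princ r, twist F r n = 0 ∧ g = n * h

theorem IsHom.rel_mul (hF : IsHom F) (hr : r ≠ 0) {g h g' h' : SpecialLinearGroup (Fin 2) A}
    (hg : Rel F r g g') (hh : Rel F r h h') (hp : Preserves F r g') :
      Rel F r (g * h) (g' * h') := by
  obtain ⟨n, hn, hn0, rfl⟩ := hg
  obtain ⟨m, hm, hm0, rfl⟩ := hh
  have h1 := (inferInstance : (princ r).Normal).conj_mem m hm g'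
  refine ⟨n * (g' * m * g'⁻¹), mul_mem hn h1, ?_, by group⟩
  rw [hF.twist_mul hr (mem_princ.mp hn).2.1 (mem_princ.mp h1).2.1, hp m hm, hn0, hm0, add_zero]

theorem IsHom.preserves_elemL (hF : IsHom F) (hr : r ≠ 0) (j : A) : Preserves F r (elemL j) := by
  intro n hn
  obtain ⟨⟨a, ha⟩, ⟨b, hb⟩, ⟨c, hc⟩, d, hd⟩ := mem_princ.mp hn
  have hdet := det_eq n
  rw [sub_eq_iff_eq_add] at ha hd
  rw [twist_eq hr hb, twist_eq hr (β := b) (by simp [hb])]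
  refine hF.conj (p := 1) (q := 0) (r := r * j) (s := 1) (by ring)
    (by rw [hb] at hdet; linear_combination hdet) ?_ ?_ ?_ ?_ <;>
    simp [hb] <;> ring

omit [AddCommGroup C] in
theorem preserves_elemU (hr : r ≠ 0) (hcen : ∀ a b c d j : A,
      (1 + r * a) * (1 + r * d) - r * b * (r * c) = 1 →
      F (1 + r * a + j * r * c) (b + j * (d - a) - j ^ 2 * c) (r ^ 2 * c) (1 + r * d - j * r * c) =
        F (1 + r * a) b (r ^ 2 * c) (1 + r * d)) (j : A) : Preserves F r (elemU j) := by
  intro n hn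
  obtain ⟨⟨a, ha⟩, ⟨b, hb⟩, ⟨c, hc⟩, d, hd⟩ := mem_princ.mp hn
  have hdet := det_eq n
  rw [sub_eq_iff_eq_add'] at ha hd
  rw [ha, hb, hc, hd] at hdet
  rw [twist_eq hr hb, twist_eq hr (β := b + j * (d - a) - j ^ 2 * c) (by
    simp [ha, hb, hc, hd]; ring)]
  have := hcen a b c d j hdet
  simp only [mul_00, mul_10, mul_11, mul_01, inv_00, inv_01, inv_10, inv_11, elemU_00, elemU_01,
    elemU_10,
    elemU_11, ha, hb, hc, hd]
  convert this using 2 <;> ring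

end Twist

section Symbol

variable {A C : Type*} [CommRing A] [AddCommGroup C]

/-- The value of `F` on a matrix with bottom row `(r, x)`, where `x` is congruent to `y` modulo `r`
and the diagonal entries are divisible by `q`. -/
noncomputable def phi (F : A → A → A → A → C) (q r y : A) : C :=
  Classical.epsilon fun v : C =>
    ∃ a b x, q ∣ a ∧ q ∣ x ∧ r ∣ x - y ∧ a * x - b * r = 1 ∧ F a b r x = v

variable [IsDomain A] {F : A → A → A → A → C} {q r : A}

omit [IsDomain A] in
theorem IsHom.phi_wd (hF : IsHom F) (h₀ : ∀ t, hF.upper (q * t) = 0) (hqr : IsCoprime q r)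
    {a b x a' b' x' : A} (ha : q ∣ a) (hx : q ∣ x) (hd : a * x - b * r = 1)
    (ha' : q ∣ a') (hx' : q ∣ x') (hd' : a' * x' - b' * r = 1) (h : r ∣ x' - x) :
    F a b r x = F a' b' r x' := by
  obtain ⟨k, hk⟩ := h
  have h1 : q ∣ k := hqr.dvd_of_dvd_mul_left (hk ▸ dvd_sub hx' hx)
  have e1 := hF.mul_upper (b' := b + k * a) (d' := x') k hd rfl (by linear_combination hk)
  have e2 := hF.eq_of_bottom (a := a) (b := b + k * a) (c := r) (d := x') (a' := a') (b' := b')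
    (by linear_combination a * hk + hd) hd'
  obtain ⟨z, hz⟩ : q ∣ a * b' - a' * (b + k * a) := dvd_sub (ha.mul_right _) (ha'.mul_right _)
  obtain ⟨k', rfl⟩ := h1
  rw [e2, e1, hz, h₀, h₀, zero_add, add_zero]

omit [IsDomain A] in
theorem IsHom.phi_eq (hF : IsHom F) (h₀ : ∀ t, hF.upper (q * t) = 0) (hqr : IsCoprime q r)
    {a b x y : A} (ha : q ∣ a) (hx : q ∣ x) (hd : a * x - b * r = 1) (h : r ∣ x - y) :
    phi F q r y = F a b r x := by
  have hex : ∃ v : C, ∃ a b x, q ∣ a ∧ q ∣ x ∧ r ∣ x - y ∧ a * x - b * r = 1 ∧ F a b r x = v :=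
    ⟨_, a, b, x, ha, hx, h, hd, rfl⟩
  obtain ⟨a', b', x', ha', hx', h', hd', hv⟩ := Classical.epsilon_spec hex
  rw [phi, ← hv]
  exact hF.phi_wd h₀ hqr ha' hx' hd' ha hx hd (by simpa using dvd_sub h h')

omit [IsDomain A] in
theorem phi_congr {y y' : A} (h : r ∣ y - y') : phi F q r y = phi F q r y' := by
  have : (fun x => r ∣ x - y) = fun x => r ∣ x - y' := by
    funext x
    rw [show x - y' = (x - y) + (y - y') by ring, dvd_add_left h]
  unfold phi
  simp only [congrFun this]

/-- A lift of a diagonal matrix with entries `s, s'`. -/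
def diagLift (s s' : A) : SpecialLinearGroup (Fin 2) A :=
  elemU s * elemL (-s') * elemU s * weylElt⁻¹

omit [IsDomain A] in
@[simp] theorem diagLift_00 (s s' : A) : diagLift s s' 0 0 = 2 * s - s ^ 2 * s' := by
  simp only [diagLift, mul_00, mul_01, inv_00, inv_10, elemU_00, elemU_01, elemU_10, elemU_11,
    elemL_00, elemL_01, elemL_10, elemL_11, weylElt_11, weylElt_10]
  ring

omit [IsDomain A] in
@[simp] theorem diagLift_01 (s s' : A) : diagLift s s' 0 1 = -(1 - s * s') := by
  simp only [diagLift, mul_00, mul_01, inv_01, inv_11, elemU_00, elemU_01, elemU_10, elemU_11,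
    elemL_00, elemL_01, elemL_10, elemL_11, weylElt_01, weylElt_00]
  ring

omit [IsDomain A] in
@[simp] theorem diagLift_10 (s s' : A) : diagLift s s' 1 0 = 1 - s * s' := by
  simp only [diagLift, mul_10, mul_11, inv_00, inv_10, elemU_00, elemU_01, elemU_10, elemU_11,
    elemL_00, elemL_01, elemL_10, elemL_11, weylElt_11, weylElt_10]
  ring

omit [IsDomain A] in
@[simp] theorem diagLift_11 (s s' : A) : diagLift s s' 1 1 = s' := by
  simp only [diagLift, mul_10, mul_11, inv_01, inv_11, elemU_00, elemU_01, elemU_10, elemU_11,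
    elemL_00, elemL_01, elemL_10, elemL_11, weylElt_01, weylElt_00]
  ring

theorem IsHom.twist_diagLift (hF : IsHom F) (h₀ : ∀ t, hF.upper (q * t) = 0) (hqr : IsCoprime q r)
    (hr : r ≠ 0) {s s' : A} (hs : q ∣ s) (hs' : q ∣ s') (h : r ∣ 1 - s * s') :
    twist F r (diagLift s s') = phi F q r s' := by
  obtain ⟨u, hu⟩ := h
  rw [hF.phi_eq h₀ hqr hs hs' (b := -u) (by linear_combination -hu) (by simp),
    twist_eq hr (β := -u) (by rw [diagLift_01, hu]; ring), diagLift_00, diagLift_10, diagLift_11]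
  obtain ⟨v, rfl⟩ := hs
  have := hF.mul_lower (a := 2 * (q * v) - (q * v) ^ 2 * s') (b := -u) (c := r * (1 - q * v * s'))
    (d := s') (a' := q * v) (c' := r) (q * (r * v)) (by linear_combination (1 - q * v * s') * -hu)
    (by linear_combination (q * v) * -hu) (by ring)
  rw [this, h₀, sub_zero]

omit [IsDomain A] in
theorem conj_elemU_00 (g : SpecialLinearGroup (Fin 2) A) (t : A) :
    (g * elemU t * g⁻¹) 0 0 = 1 - t * g 0 0 * g 1 0 := by
  simp only [mul_00, mul_01, inv_00, inv_10, elemU_00, elemU_01, elemU_10, elemU_11]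
  linear_combination det_eq g

omit [IsDomain A] in
theorem conj_elemU_01 (g : SpecialLinearGroup (Fin 2) A) (t : A) :
    (g * elemU t * g⁻¹) 0 1 = t * g 0 0 ^ 2 := by
  simp only [mul_00, mul_01, inv_01, inv_11, elemU_00, elemU_01, elemU_10, elemU_11]
  ring

omit [IsDomain A] in
theorem conj_elemU_10 (g : SpecialLinearGroup (Fin 2) A) (t : A) :
    (g * elemU t * g⁻¹) 1 0 = -(t * g 1 0 ^ 2) := by
  simp only [mul_10, mul_11, inv_00, inv_10, elemU_00, elemU_01, elemU_10, elemU_11]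
  ring

omit [IsDomain A] in
theorem conj_elemU_11 (g : SpecialLinearGroup (Fin 2) A) (t : A) :
    (g * elemU t * g⁻¹) 1 1 = 1 + t * g 0 0 * g 1 0 := by
  simp only [mul_10, mul_11, inv_01, inv_11, elemU_00, elemU_01, elemU_10, elemU_11]
  linear_combination det_eq g

omit [IsDomain A] in
theorem conj_elemL_00 (g : SpecialLinearGroup (Fin 2) A) (t : A) :
    (g * elemL t * g⁻¹) 0 0 = 1 + t * g 0 1 * g 1 1 := by
  simp only [mul_00, mul_01, inv_00, inv_10, elemL_00, elemL_01, elemL_10, elemL_11]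
  linear_combination det_eq g

omit [IsDomain A] in
theorem conj_elemL_01 (g : SpecialLinearGroup (Fin 2) A) (t : A) :
    (g * elemL t * g⁻¹) 0 1 = -(t * g 0 1 ^ 2) := by
  simp only [mul_00, mul_01, inv_01, inv_11, elemL_00, elemL_01, elemL_10, elemL_11]
  ring

omit [IsDomain A] in
theorem conj_elemL_10 (g : SpecialLinearGroup (Fin 2) A) (t : A) :
    (g * elemL t * g⁻¹) 1 0 = t * g 1 1 ^ 2 := by
  simp only [mul_10, mul_11, inv_00, inv_10, elemL_00, elemL_01, elemL_10, elemL_11]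
  ring

omit [IsDomain A] in
theorem conj_elemL_11 (g : SpecialLinearGroup (Fin 2) A) (t : A) :
    (g * elemL t * g⁻¹) 1 1 = 1 - t * g 0 1 * g 1 1 := by
  simp only [mul_10, mul_11, inv_01, inv_11, elemL_00, elemL_01, elemL_10, elemL_11]
  linear_combination det_eq g

omit [IsDomain A] in
theorem conj_elemU_mem_princ {g : SpecialLinearGroup (Fin 2) A} {r s u : A}
    (h0 : g 0 0 = s + r * (s * u)) (h1 : g 1 0 = r * u) (t : A) :
    g * elemU t * g⁻¹ * elemU (-(s ^ 2 * t)) ∈ princ r := by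
  rw [mem_princ]
  have e0 := conj_elemU_00 g t
  have e1 := conj_elemU_01 g t
  have e2 := conj_elemU_10 g t
  have e3 := conj_elemU_11 g t
  generalize g * elemU t * g⁻¹ = M at *
  simp only [mul_00, mul_01, mul_10, mul_11, elemU_00, elemU_01, elemU_10, elemU_11, e0, e1, e2, e3,
    h0, h1]
  exact ⟨⟨-(t * (s + r * (s * u)) * u), by ring⟩,
    ⟨t * (2 * s ^ 2 * u + r * s ^ 2 * u ^ 2) + s ^ 2 * t ^ 2 * (s + r * (s * u)) * u, by ring⟩,
    ⟨-(t * r * u ^ 2), by ring⟩,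
    ⟨t * u * (s + r * (s * u)) + s ^ 2 * t ^ 2 * (r * u ^ 2), by ring⟩⟩

omit [IsDomain A] in
theorem conj_elemL_mem_princ {g : SpecialLinearGroup (Fin 2) A} {r s u : A}
    (h0 : g 0 1 = r * u) (h1 : g 1 1 = s) (t : A) :
    g * elemL t * g⁻¹ * elemL (-(s ^ 2 * t)) ∈ princ r := by
  rw [mem_princ]
  have e0 := conj_elemL_00 g t
  have e1 := conj_elemL_01 g t
  have e2 := conj_elemL_10 g t
  have e3 := conj_elemL_11 g t
  generalize g * elemL t * g⁻¹ = M at *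
  simp only [mul_00, mul_01, mul_10, mul_11, elemL_00, elemL_01, elemL_10, elemL_11, e0, e1, e2, e3,
    h0, h1]
  exact ⟨⟨t * u * s + t ^ 2 * r * u ^ 2 * s ^ 2, by ring⟩,
    ⟨-(t * r * u ^ 2), by ring⟩,
    ⟨s ^ 3 * t ^ 2 * u, by ring⟩,
    ⟨-(t * u * s), by ring⟩⟩

theorem IsHom.rel_conj_elemU (hF : IsHom F) (h₀ : ∀ t, hF.upper (q * t) = 0) {r : ℕ}
    (hr : (r : A) ≠ 0) (hC : ∀ c : C, r • c = 0 → c = 0)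
      (hp : ∀ j : A, Preserves F (r : A) (elemU j))
    {s s' : A} (h : (r : A) ∣ 1 - s * s') (t : A) :
    Rel F (r : A) (diagLift s s' * elemU (q * t) * (diagLift s s')⁻¹)
      (elemU (s ^ 2 * (q * t))) := by
  obtain ⟨g, hg⟩ : ∃ g, g = diagLift s s' := ⟨_, rfl⟩
  obtain ⟨W, hWd⟩ : ∃ W : A → SpecialLinearGroup (Fin 2) A, ∀ t, W t = g * elemU t * g⁻¹ *
    elemU (-(s ^ 2 * t)) := ⟨_, fun _ => rfl⟩
  rw [← hg]
  have hgr : (r : A) ∣ g 0 1 := by rw [hg, diagLift_01]; exact h.neg_right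
  have hW : ∀ t, W t ∈ princ (r : A) := by
    obtain ⟨u, hu⟩ := h
    intro t
    rw [hWd]
    exact conj_elemU_mem_princ (u := u) (by rw [hg, diagLift_00]; linear_combination s * hu)
      (by rw [hg, diagLift_10, hu]) t
  have hadd : ∀ t t', twist F (r : A) (W (t + t')) = twist F (r : A) (W t) + twist F (r : A)
    (W t') := by
    intro t t'
    have h1 := (inferInstance : (princ (r : A)).Normal).conj_mem _ (hW t') (elemU (s ^ 2 * t))
    rw [← hp (s ^ 2 * t) _ (hW t'), ← hF.twist_mul hr (mem_princ.mp (hW t)).2.1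
      (mem_princ.mp h1).2.1]
    congr 1
    simp only [hWd, mul_add, elemU_neg, elemU_add, _root_.mul_inv_rev, mul_assoc,
      inv_mul_cancel_left]
  have hnat : ∀ n : ℕ, ∀ t, twist F (r : A) (W (n * t)) = n • twist F (r : A) (W t) := by
    intro n t
    induction n with
    | zero =>
      have := hadd 0 0
      rw [add_zero, left_eq_add] at this
      simpa using this
    | succ n ih => rw [Nat.cast_succ, add_mul, one_mul, hadd, ih, succ_nsmul]
  have hgi : (r : A) ∣ g⁻¹ 0 1 := by rw [inv_01]; exact hgr.neg_right
  have hz : ∀ t, twist F (r : A) (W (r * t)) = hF.upper t - hF.upper (s ^ 2 * t) := by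
    intro t
    have h1 : (r : A) ∣ elemU (r * t) 0 1 := by simp
    rw [hWd, hF.twist_mul hr (dvd_mul_01 (dvd_mul_01 hgr h1) hgi) (by
      rw [elemU_01]; exact ⟨-(s ^ 2 * t), by ring⟩), hF.twist_mul hr (dvd_mul_01 hgr h1) hgi,
      hF.twist_mul hr hgr h1, hF.twist_inv hr hgr, twist_eq hr (g := elemU (r * t)) (β := t) rfl,
      twist_eq hr (g := elemU (-(s ^ 2 * (r * t)))) (β := -(s ^ 2 * t)) (by rw [elemU_01]; ring)]
    simp only [elemU_00, elemU_10, elemU_11, mul_zero, hF.upper_eq, map_neg]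
    abel
  refine ⟨W (q * t), hW _, hC _ ?_, ?_⟩
  · rw [← hnat, hz, h₀, show s ^ 2 * (q * t) = q * (s ^ 2 * t) by ring, h₀, sub_zero]
  · rw [hWd, elemU_neg, inv_mul_cancel_right]

theorem IsHom.rel_conj_elemL (hF : IsHom F) (h₀ : ∀ t, hF.upper (q * t) = 0) (hr : r ≠ 0)
    {s s' : A} (h : r ∣ 1 - s * s') (t : A) :
    Rel F r (diagLift s s' * elemL (q * t) * (diagLift s s')⁻¹) (elemL (s' ^ 2 * (q * t))) := by
  have hg : r ∣ diagLift s s' 0 1 := by rw [diagLift_01]; exact h.neg_right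
  have hgi : r ∣ (diagLift s s')⁻¹ 0 1 := by rw [inv_01]; exact hg.neg_right
  have hL : ∀ x : A, r ∣ elemL x 0 1 := fun x => by rw [elemL_01]; exact dvd_zero _
  have ht : ∀ x : A, twist F r (elemL (q * x)) = 0 := fun x => by
    rw [twist_eq hr (β := 0) (by simp), elemL_00, elemL_11, elemL_10, hF.lower_eq,
      show r * (q * x) = q * (r * x) by ring, h₀, neg_zero]
  refine ⟨_, conj_elemL_mem_princ (g := diagLift s s') (u := -(h.choose)) (s := s') ?_ ?_ (q * t),
    ?_, ?_⟩
  · rw [diagLift_01, mul_neg, ← h.choose_spec]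
  · rw [diagLift_11]
  · rw [hF.twist_mul hr (dvd_mul_01 (dvd_mul_01 hg (hL _)) hgi) (hL _),
      hF.twist_mul hr (dvd_mul_01 hg (hL _)) hgi, hF.twist_mul hr hg (hL _), hF.twist_inv hr hg,
      show -(s' ^ 2 * (q * t)) = q * (-(s' ^ 2 * t)) by ring, ht, ht]
    abel
  · rw [elemL_neg]
    group

/-- The function `phi` transforms by translations under multiplication by squares. -/
theorem IsHom.phi_sq_mul (hF : IsHom F) (h₀ : ∀ t, hF.upper (q * t) = 0) {r : ℕ}
    (hqr : IsCoprime q (r : A)) (hr : (r : A) ≠ 0) (hC : ∀ c : C, r • c = 0 → c = 0)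
    (hp : ∀ j : A, Preserves F (r : A) (elemU j)) {s : A} (hs : IsCoprime s (r : A)) :
    ∃ l : C, ∀ y, IsCoprime y (r : A) → phi F q r (s ^ 2 * y) = l + phi F q r y := by
  have hlift : ∀ y, IsCoprime y (r : A) → ∃ t t', q ∣ t ∧ q ∣ t' ∧ (r : A) ∣ 1 - t * t' ∧
      (r : A) ∣ t' - y := by
    rintro y ⟨y', v', hy⟩
    obtain ⟨u, v, huv⟩ := hqr
    refine ⟨u * q * y', u * q * y, ⟨u * y', by ring⟩, ⟨u * y, by ring⟩,
      ⟨v * (1 + u * q) + (u * q) ^ 2 * v', ?_⟩, ⟨-(v * y), by linear_combination y * huv⟩⟩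
    linear_combination (-(1 + u * q)) * huv - (u * q) ^ 2 * hy
  obtain ⟨s', v', hs'⟩ := hs
  have hss : (r : A) ∣ 1 - s' * s := ⟨v', by linear_combination -hs'⟩
  set g := diagLift s' s with hg
  have hgr : (r : A) ∣ g 0 1 := by rw [hg, diagLift_01]; exact hss.neg_right
  refine ⟨twist F (r : A) g + twist F (r : A) (weylElt * g⁻¹ * weylElt⁻¹), fun y hy => ?_⟩
  obtain ⟨t, t', ⟨k, hk⟩, ⟨k', hk'⟩, htt, hty⟩ := hlift y hy
  have hpL := hF.preserves_elemL (r := (r : A)) hr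
  have r1 := hF.rel_conj_elemU h₀ hr hC hp hss k
  have r2 := hF.rel_conj_elemL h₀ hr hss (-k')
  obtain ⟨n, hn, hn0, hnn⟩ := hF.rel_mul hr (hF.rel_mul hr r1 r2 (hp _)) r1 ((hp _).mul (hpL _))
  rw [← hg, ← hk, mul_neg, ← hk', mul_neg] at hnn
  have key : g * diagLift t t' * (weylElt * g⁻¹ * weylElt⁻¹) = n * diagLift (s' ^ 2 * t)
    (s ^ 2 * t') := by
    have : g * diagLift t t' * (weylElt * g⁻¹ * weylElt⁻¹) =
      (g * elemU t * g⁻¹ * (g * elemL (-t') * g⁻¹) *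
      (g * elemU t * g⁻¹)) * weylElt⁻¹ := by
      rw [diagLift]; group
    rw [this, hnn, diagLift]; group
  have hV : ∀ {t t' : A}, (r : A) ∣ 1 - t * t' → (r : A) ∣ diagLift t t' 0 1 := fun h => by
    rw [diagLift_01]; exact h.neg_right
  have hw : (r : A) ∣ (weylElt * g⁻¹ * weylElt⁻¹ : SpecialLinearGroup (Fin 2) A) 0 1 := by
    simp only [mul_00, mul_01, inv_00, inv_01, inv_11, inv_10, weylElt_00, weylElt_01, hg,
      diagLift_00, diagLift_01, diagLift_10, diagLift_11]
    exact hss.trans (dvd_of_eq (by ring))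
  have htt' : (r : A) ∣ 1 - s' ^ 2 * t * (s ^ 2 * t') := by
    have h1 : 1 - s' ^ 2 * t * (s ^ 2 * t') = (1 - t * t') + t * t' * (1 + s' * s) * (1 - s' * s) :=
      by ring
    rw [h1]
    exact dvd_add htt (hss.mul_left _)
  have e := congrArg (twist F (r : A)) key
  rw [hF.twist_mul hr (dvd_mul_01 hgr (hV htt)) hw, hF.twist_mul hr hgr (hV htt),
    hF.twist_mul hr (mem_princ.mp hn).2.1 (hV htt'), hn0, zero_add,
    hF.twist_diagLift h₀ hqr hr (hk ▸ ⟨k, rfl⟩) (hk' ▸ ⟨k', rfl⟩) htt,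
    hF.twist_diagLift h₀ hqr hr (hk ▸ ⟨s' ^ 2 * k, by ring⟩)
      (hk' ▸ ⟨s ^ 2 * k', by ring⟩) htt'] at e
  rw [phi_congr (y := y) (y' := t') ((dvd_sub_comm).mp hty),
    phi_congr (y := s ^ 2 * y) (y' := s ^ 2 * t')
    (by rw [← mul_sub]; exact (dvd_sub_comm.mp hty).mul_left _), ← e]
  abel

end Symbol

end SL2Ab

namespace SL2Ab

open Matrix

set_option linter.unusedSectionVars false

section Good

variable {A C : Type*} [CommRing A] [AddCommGroup C] [IsDomain A]

/-- The standing assumptions on an auxiliary prime `r`. -/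
structure Good (F : A → A → A → A → C) (q m : ℤ) (r : ℕ) : Prop where
  hom : IsHom F
  prime : r.Prime
  odd : Odd r
  ne : (r : A) ≠ 0
  nonunit : ¬ IsUnit (r : A)
  cop : IsCoprime q (r : ℤ)
  level : ∀ t, hom.upper ((q : A) * t) = 0
  dvd : m ∣ q
  mod : m ∣ r - 1
  int : ∀ a b c d : ℤ, a * d - b * c = 1 → m ∣ a - 1 → m ∣ b → m ∣ c → m ∣ d - 1 → F a b c d = 0
  cen : ∀ a b c d j : A, (1 + r * a) * (1 + r * d) - r * b * (r * c) = 1 →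
      F (1 + r * a + j * r * c) (b + j * (d - a) - j ^ 2 * c) (r ^ 2 * c) (1 + r * d - j * r * c) =
        F (1 + r * a) b (r ^ 2 * c) (1 + r * d)
  tors : ∀ c : C, r • c = 0 → c = 0
  half : ∀ c : C, ((r + 1) / 2) • c = 0 → c = 0
  sqr : ∀ n : ℤ, ∃ i : A, (r : A) ∣ i ^ 2 - n
  pow : ∀ y : A, ∃ n : ℤ, (r : A) ∣ y ^ (r + 1) - n

namespace Good

variable {F : A → A → A → A → C} {q m : ℤ} {r : ℕ} (hG : Good F q m r)

include hG

theorem cop' : IsCoprime (q : A) (r : A) := by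
  simpa using hG.cop.map (Int.castRingHom A)

theorem isCoprime_of_dvd_sub {x y : A} (hx : IsCoprime x (r : A)) (h : (r : A) ∣ x - y) :
    IsCoprime y (r : A) := by
  obtain ⟨k, hk⟩ := h
  obtain ⟨u, v, huv⟩ := hx
  exact ⟨u, v + u * k, by linear_combination huv - u * hk⟩

theorem isCoprime_of_cast {n : ℤ} (h : IsCoprime (n : A) (r : A)) : IsCoprime n (r : ℤ) := by
  refine ((Int.isCoprime_iff_gcd_eq_one.mpr ?_ : IsCoprime (r : ℤ) n)).symm
  rw [← Int.isCoprime_iff_gcd_eq_one, Prime.coprime_iff_not_dvd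
    (Nat.prime_iff_prime_int.mp hG.prime)]
  rintro ⟨k, rfl⟩
  obtain ⟨u, v, huv⟩ := h
  refine hG.nonunit (IsUnit.of_mul_eq_one (u * k + v) ?_)
  push_cast at huv
  linear_combination huv

theorem phi_int {n : ℤ} (hn : IsCoprime n (r : ℤ)) : phi F (q : A) r n = phi F (q : A) r 1 := by
  have hlift : ∀ y : ℤ, IsCoprime y (r : ℤ) → ∃ a b x : ℤ, q ∣ a ∧ q ∣ x ∧ a * x - b * r = 1 ∧
      (r : ℤ) ∣ x - y := by
    rintro y ⟨y', v', hy⟩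
    obtain ⟨u, v, huv⟩ := hG.cop
    refine ⟨u * q * y', -(v * (1 + u * q) + (u * q) ^ 2 * v'), u * q * y, ⟨u * y', by ring⟩,
      ⟨u * y, by ring⟩,
      ?_, ⟨-(v * y), by linear_combination y * huv⟩⟩
    linear_combination (1 + u * q) * huv + (u * q) ^ 2 * hy
  obtain ⟨a, b, x, ha, hx, hd, hr⟩ := hlift n hn
  obtain ⟨a', b', x', ha', hx', hd', hr'⟩ := hlift 1 isCoprime_one_left
  have hc : ∀ {x y : ℤ}, x ∣ y → (x : A) ∣ y := fun h => map_dvd (Int.castRingHom A) h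
  have hdA : (a : A) * x - b * r = 1 := by exact_mod_cast congrArg (Int.cast : ℤ → A) hd
  have hdA' : (a' : A) * x' - b' * r = 1 := by exact_mod_cast congrArg (Int.cast : ℤ → A) hd'
  rw [hG.hom.phi_eq hG.level hG.cop' (hc ha) (hc hx) hdA (by simpa using hc hr),
    hG.hom.phi_eq (y := 1) hG.level hG.cop' (hc ha') (hc hx') hdA' (by simpa using hc hr')]
  have h1 := hG.int (a * x' - b * r) (b * a' - a * b') (r * x' - x * r) (x * a' - r * b')
    (by linear_combination (a' * x' - b' * r) * hd + hd') ?_ ?_ ?_ ?_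
  · push_cast at h1
    have h2 := hG.hom.mul' (a'' := (a : A)) (b'' := b) (c'' := r) (d'' := x) (a := a * x' - b * r)
      (b := b * a' - a * b') (c := r * x' - x * r)
      (d := x * a' - r * b') (by linear_combination ((a' : A) * x' - b' * r) * hdA + hdA') hdA'
      (by linear_combination (-a : A) * hdA') (by linear_combination (-b : A) * hdA')
      (by linear_combination (-r : A) * hdA') (by linear_combination (-x : A) * hdA')
    rw [h2, h1, zero_add]
  · exact (hG.dvd.trans (dvd_add (hx'.mul_left a) (hx.mul_left (-a)))).trans
      (dvd_of_eq (by linear_combination -hd))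
  · exact hG.dvd.trans (dvd_sub (ha'.mul_left _) (ha.mul_right _))
  · exact hG.dvd.trans (dvd_sub (hx'.mul_left _) (hx.mul_right _))
  · exact (hG.dvd.trans (dvd_sub (hx.mul_right a') (hx'.mul_left a'))).trans
      (dvd_of_eq (by linear_combination -hd'))

theorem phi_sq {s y : A} (hs : IsCoprime s (r : A)) (hy : IsCoprime y (r : A)) :
    phi F (q : A) r (s ^ 2 * y) = phi F (q : A) r y := by
  obtain ⟨l, hl⟩ := hG.hom.phi_sq_mul hG.level hG.cop' hG.ne hG.tors
    (preserves_elemU hG.ne hG.cen) hs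
  have hk : ∀ k : ℕ, phi F (q : A) r ((s ^ 2) ^ k) = k • l + phi F (q : A) r 1 := by
    intro k
    induction k with
    | zero => simp
    | succ k ih => rw [pow_succ', hl _ hs.pow_left.pow_left, ih, succ_nsmul']; abel
  have h2 : 2 * ((r + 1) / 2) = r + 1 := by have := hG.odd; rw [Nat.odd_iff] at this; omega
  obtain ⟨n, hn⟩ := hG.pow s
  have h3 := hk ((r + 1) / 2)
  rw [← pow_mul, h2, phi_congr hn, hG.phi_int (hG.isCoprime_of_cast (hG.isCoprime_of_dvd_sub
    hs.pow_left hn)), right_eq_add] at h3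
  rw [hl y hy, hG.half l h3, zero_add]

theorem phi_neg_inv {y y' : A} (h : (r : A) ∣ y * y' + 1) :
    phi F (q : A) r y + phi F (q : A) r y' = F (-1) 0 0 (-1) := by
  obtain ⟨k, hk⟩ := h
  obtain ⟨u, v, huv⟩ := hG.cop'
  have h1 : (r : A) ∣ u * q * y - y := ⟨-(v * y), by linear_combination y * huv⟩
  have h2 : (r : A) ∣ u * q * y' - y' := ⟨-(v * y'), by linear_combination y' * huv⟩
  have hd : -(u * q * y') * (u * q * y) - -((u * q) ^ 2 * k + v * (1 + u * q)) * r = 1 := by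
    linear_combination (1 + u * q) * huv - (u * q) ^ 2 * hk
  have q1 : (q : A) ∣ u * q * y := ⟨u * y, by ring⟩
  have q2 : (q : A) ∣ u * q * y' := ⟨u * y', by ring⟩
  rw [hG.hom.phi_eq hG.level hG.cop' q2.neg_right q1 hd h1,
    hG.hom.phi_eq (b := -((u * q) ^ 2 * k + v * (1 + u * q))) hG.level hG.cop' q1.neg_right q2
      (by linear_combination hd) h2]
  refine (hG.hom.mul' hd (by linear_combination hd) ?_ ?_ ?_ ?_).symm
  · linear_combination hd
  · ring
  · ring
  · linear_combination hd

theorem eval {a b c : A} (hd : a * r - q * b * (q * c) = 1) :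
    F a (q * b) (q * c) r = phi F (q : A) r (-(q * c)) - phi F (q : A) r 1 := by
  have key : ∀ {a b c : A}, a * r - q * b * (q * c) = 1 →
      F a (q * b) (q * c) r = phi F (q : A) r (-(q * c)) + 3 • hG.hom.upper 1 := by
    intro a b c hd
    rw [hG.hom.phi_eq (y := -(q * c)) hG.level hG.cop' (a := q * b) (x := -(q * c)) (b := -a)
      (dvd_mul_right _ _) (dvd_mul_right _ _).neg_right (by linear_combination hd) (by simp),
        ← hG.hom.weyl]
    exact hG.hom.mul' (by linear_combination hd) (by ring) (by ring) (by ring) (by ring) (by ring)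
  obtain ⟨u, v, huv⟩ := (hG.cop.pow_left (m := 2))
  have h0 := hG.int v (q * -u) q r (by linear_combination huv) ?_ (hG.dvd.mul_right _) hG.dvd hG.mod
  · have h1 := key (a := v) (b := -u) (c := 1) (by
      have := congrArg (Int.cast : ℤ → A) huv
      push_cast at this
      linear_combination this)
    push_cast at h0
    rw [mul_one, h0] at h1
    have h2 : phi F (q : A) r (-q) = phi F (q : A) r 1 := by
      have := hG.phi_int (n := -q) hG.cop.neg_left
      push_cast at this
      exact this
    rw [h2] at h1
    rw [key hd, ← sub_neg_eq_add]
    congr 1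
    exact neg_eq_of_add_eq_zero_left h1.symm
  · have h1 : m ∣ u * q ^ 2 := (hG.dvd.mul_left (u * q)).trans (dvd_of_eq (by ring))
    exact (dvd_sub (dvd_neg.mpr h1) (hG.mod.mul_left v)).trans
      (dvd_of_eq (by linear_combination -huv))

theorem cop_of_det {a b c : A} (hd : a * r - q * b * (q * c) = 1) : IsCoprime c (r : A) :=
  ⟨-(q * b * q), a, by linear_combination hd⟩

theorem eq_of_sq {a b c a' b' c' s : A} (hd : a * r - q * b * (q * c) = 1)
    (hd' : a' * r - q * b' * (q * c') = 1) (hs : (r : A) ∣ c * c' - s ^ 2) :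
    F a (q * b) (q * c) r = F a' (q * b') (q * c') r := by
  rw [hG.eval hd, hG.eval hd']
  congr 1
  have hc := hG.cop_of_det hd
  have hc' := hG.cop_of_det hd'
  have hs' : IsCoprime s (r : A) :=
    IsCoprime.of_isCoprime_of_dvd_left (hG.isCoprime_of_dvd_sub (hc.mul_left hc') hs)
      (dvd_pow_self s two_ne_zero)
  obtain ⟨u, v, huv⟩ := hc
  have hu : IsCoprime u (r : A) := ⟨c, v, by linear_combination huv⟩
  rw [← hG.phi_sq (s := u * s) (y := -(q * c)) (hu.mul_left hs')
    ((hG.cop'.mul_left ⟨u, v, huv⟩).neg_left)]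
  obtain ⟨k, hk⟩ := hs
  refine phi_congr ⟨q * c * u ^ 2 * k + q * c' * (v * (1 + u * c)), ?_⟩
  linear_combination (q * c * u ^ 2) * hk - q * c' * (1 + u * c) * huv

theorem eq_zero_of_sq {a b c s : A} (hd : a * r - q * b * (q * c) = 1) (hs : (r : A) ∣ c - s ^ 2) :
    F a (q * b) (q * c) r = 0 := by
  have hs' : IsCoprime s (r : A) := IsCoprime.of_isCoprime_of_dvd_left
    (hG.isCoprime_of_dvd_sub (hG.cop_of_det hd) hs) (dvd_pow_self s two_ne_zero)
  rw [hG.eval hd, sub_eq_zero]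
  obtain ⟨i, hi⟩ := hG.sqr (-q)
  have hi' : IsCoprime i (r : A) := by
    refine IsCoprime.of_isCoprime_of_dvd_left (y := i ^ 2) ?_ (dvd_pow_self i two_ne_zero)
    refine hG.isCoprime_of_dvd_sub (x := ((-q : ℤ) : A)) ?_ (dvd_sub_comm.mp hi)
    push_cast
    exact hG.cop'.neg_left
  rw [← hG.phi_sq (s := i * s) (y := 1) (hi'.mul_left hs') isCoprime_one_left]
  obtain ⟨k, hk⟩ := hs
  obtain ⟨l, hl⟩ := hi
  push_cast at hl
  refine phi_congr ⟨-(q * k) - l * s ^ 2, ?_⟩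
  linear_combination (-(q : A)) * hk - s ^ 2 * hl

theorem eq_zero_of_odd (h2 : ∀ c : C, 2 • c = 0 → c = 0) {a b c : A}
    (hd : a * r - q * b * (q * c) = 1) : F a (q * b) (q * c) r = 0 := by
  rw [hG.eval hd]
  have hy : IsCoprime (-(q * c)) (r : A) := (hG.cop'.mul_left (hG.cop_of_det hd)).neg_left
  generalize -((q : A) * c) = y at hy
  obtain ⟨u, v, huv⟩ := hy
  obtain ⟨i, l, hi⟩ := hG.sqr (-1)
  push_cast at hi
  have hu : IsCoprime u (r : A) := ⟨y, v, by linear_combination huv⟩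
  have hi' : IsCoprime i (r : A) := ⟨-i, l, by linear_combination -hi⟩
  have e1 := hG.phi_neg_inv (y := y) (y' := (i * u) ^ 2 * y)
    ⟨l * u ^ 2 * y ^ 2 + v * (1 + u * y), by
    linear_combination (u ^ 2 * y ^ 2) * hi - (1 + u * y) * huv⟩
  have e2 := hG.phi_neg_inv (y := 1) (y' := i ^ 2 * 1) ⟨l, by linear_combination hi⟩
  rw [hG.phi_sq (hi'.mul_left hu) ⟨u, v, huv⟩] at e1
  rw [hG.phi_sq hi' isCoprime_one_left] at e2
  refine h2 _ ?_
  rw [smul_sub, two_smul, two_smul, e1, e2, sub_self]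

end Good

end Good

end SL2Ab

namespace SL2Ab

open QuadraticAlgebra Filter

local notation "𝐍" => QuadraticAlgebra.norm (R := ℤ)

namespace Inert

variable {r : ℕ}

/-- An integer with quadratic symbol one is a square modulo `r`. -/
theorem exists_sq_of_sym (hr : r.Prime) {n : ℤ} (h : jacobiSym n r = 1) : ∃ m : ℤ,
    (r : ℤ) ∣ m ^ 2 - n := by
  have := Fact.mk hr
  rw [← jacobiSym.legendreSym.to_jacobiSym] at h
  have h0 : (n : ZMod r) ≠ 0 := fun h0 => by
    rw [(legendreSym.eq_zero_iff r n).mpr h0] at h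
    exact zero_ne_one h
  obtain ⟨x, hx⟩ := (legendreSym.eq_one_iff r h0).mp h
  obtain ⟨m, rfl⟩ := ZMod.intCast_surjective x
  refine ⟨m, (ZMod.intCast_zmod_eq_zero_iff_dvd _ r).mp ?_⟩
  push_cast
  rw [hx]
  ring

theorem not_dvd_of_sym (hr : r.Prime) {n : ℤ} (h : jacobiSym n r ≠ 0) : ¬ (r : ℤ) ∣ n := by
  have := Fact.mk hr
  rw [← jacobiSym.legendreSym.to_jacobiSym] at h
  intro hd
  exact h ((legendreSym.eq_zero_iff r n).mpr ((ZMod.intCast_zmod_eq_zero_iff_dvd n r).mpr hd))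

theorem sym_ne_zero (hr : r.Prime) {n : ℤ} (h : ¬ (r : ℤ) ∣ n) : jacobiSym n r = 1 ∨
    jacobiSym n r = -1 := by
  have := Fact.mk hr
  rw [← jacobiSym.legendreSym.to_jacobiSym]
  refine legendreSym.eq_one_or_neg_one r ?_
  rwa [Ne, ZMod.intCast_zmod_eq_zero_iff_dvd]

variable {a b : ℤ} (h : Inert (b ^ 2 + 4 * a) r)

include h

/-- Integers are squares modulo an inert prime. -/
theorem exists_sq (n : ℤ) : ∃ i : Quad a b, (r : Quad a b) ∣ i ^ 2 - n := by
  by_cases hn : (r : ℤ) ∣ n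
  · refine ⟨0, ?_⟩
    have := intCast_dvd_of_dvd (A := Quad a b) hn
    rw [zero_pow two_ne_zero, zero_sub]
    simpa using this.neg_right
  rcases sym_ne_zero h.prime hn with h1 | h1
  · obtain ⟨m, hm⟩ := exists_sq_of_sym h.prime h1
    refine ⟨m, ?_⟩
    simpa using intCast_dvd_of_dvd (A := Quad a b) hm
  · obtain ⟨m, hm⟩ := exists_sq_of_sym h.prime (n := n * (b ^ 2 + 4 * a))
      (by rw [jacobiSym.mul_left, h1, h.sym]; norm_num)
    obtain ⟨u, v, huv⟩ := isCoprime_natPrime h.prime h.not_dvd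
    set D := b ^ 2 + 4 * a with hD
    have hδ2 : (⟨-b, 2⟩ : Quad a b) ^ 2 = ((D : ℤ) : Quad a b) := by
      ext
      · rw [pow_two, re_mul, re_intCast, Int.cast_id, hD]; ring
      · rw [pow_two, im_mul, im_intCast]; ring
    refine ⟨((m * v : ℤ) : Quad a b) * ⟨-b, 2⟩, ?_⟩
    rw [mul_pow, hδ2]
    have : (r : ℤ) ∣ (m * v) ^ 2 * D - n := by
      obtain ⟨k, hk⟩ := hm
      refine ⟨k * v ^ 2 * D - n * u * (1 + v * D), ?_⟩
      linear_combination (v ^ 2 * D) * hk + n * (1 + v * D) * huv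
    simpa using intCast_dvd_of_dvd (A := Quad a b) this

/-- Modulo an inert prime, elements whose norm is a quadratic residue are squares. -/
theorem exists_sq_of_norm {z : Quad a b} (hz : jacobiSym (𝐍 z) r = 1) :
    ∃ s : Quad a b, (r : Quad a b) ∣ z - s ^ 2 := by
  have := Fact.mk h.prime
  obtain ⟨n, k, hk⟩ := exists_sq_of_sym h.prime hz
  have hk' : (n : Quad a b) ^ 2 - ((𝐍 z : ℤ) : Quad a b) = r * k := by
    have := congrArg (Int.cast : ℤ → Quad a b) hk
    push_cast at this
    exact this
  by_cases hw : (r : Quad a b) ∣ z + ((n : ℤ) : Quad a b)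
  · obtain ⟨i, hi⟩ := h.exists_sq (-n)
    refine ⟨i, (dvd_sub hw hi).trans (dvd_of_eq ?_)⟩
    push_cast
    ring
  · have hN := Quad.not_dvd_norm h.legendre h.ne_two hw
    obtain ⟨u, v, huv⟩ := isCoprime_natPrime h.prime hN
    have huv' : (u : Quad a b) * r + v * ((𝐍 (z + ((n : ℤ) : Quad a b)) : ℤ) : Quad a b) = 1 := by
      have := congrArg (Int.cast : ℤ → Quad a b) huv
      push_cast at this
      exact this
    obtain ⟨i, l, hl⟩ := h.exists_sq (n * v)
    push_cast at hl
    have e1 := Quad.mul_star_self z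
    have e2 := Quad.mul_star_self (z + ((n : ℤ) : Quad a b))
    rw [star_add, star_intCast] at e2
    refine ⟨i * (z + ((n : ℤ) : Quad a b)), z * u - l * (z + ((n : ℤ) : Quad a b)) ^ 2 - v *
      (z + ((n : ℤ) : Quad a b)) * k, ?_⟩
    rw [← e1] at hk'
    rw [← e2] at huv'
    linear_combination (-z) * huv' - (z + ((n : ℤ) : Quad a b)) ^ 2 * hl - v *
      (z + ((n : ℤ) : Quad a b)) * hk'

end Inert

theorem Ctx.good {a b : ℤ} {A : Type*} [CommRing A] {ι : Quad a b →+* A} {π : Quad a b}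
    (hc : Ctx ι π)
    [IsDomain A] {C : Type*} [AddCommGroup C] {F : A → A → A → A → C} (hF : IsHom F) {q m : ℤ}
    (hq : q ≠ 0) (h₀ : ∀ t, hF.upper (q * t) = 0) (hm : m ∣ q)
    (hInt : ∀ a b c d : ℤ, a * d - b * c = 1 → m ∣ a - 1 → m ∣ b → m ∣ c → m ∣ d - 1 →
      F a b c d = 0)
    {l : ℕ} (hl : l.Prime) (hC : ∀ n : ℕ, n.Coprime l → ∀ c : C, n • c = 0 → c = 0) :
    ∀ᶠ r : ℕ in atTop, Inert (b ^ 2 + 4 * a) r → m ∣ r - 1 → ((r + 1) / 2).Coprime l →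
      Good F q m r := by
  filter_upwards [hc.central hF hq h₀, eventually_not_dvd hc.norm_pi_ne_zero, eventually_not_dvd hq,
    eventually_gt_atTop l] with r hcen hrP hrq hrl hr hrm hh
  have := Fact.mk hr.prime
  have := hc.charZero
  exact {
    hom := hF
    prime := hr.prime
    odd := hr.prime.odd_of_ne_two hr.ne_two
    ne := by exact_mod_cast hr.prime.ne_zero
    nonunit := fun h => by
      have := hc.int_dvd_of_dvd (n := r) (m := 1) (by simpa using h.dvd (a := 1))
        (isCoprime_natPrime hr.prime hrP)
      exact hr.prime.one_lt.ne' (by exact_mod_cast Int.eq_one_of_dvd_one (by positivity) this)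
    cop := (isCoprime_natPrime hr.prime hrq).symm
    level := h₀
    dvd := hm
    mod := hrm
    int := hInt
    cen := hcen hr
    tors := hC r ((Nat.coprime_primes hr.prime hl).mpr hrl.ne')
    half := hC _ hh
    sqr := fun n => by
      obtain ⟨i, hi⟩ := hr.exists_sq n
      exact ⟨ι i, by simpa using map_dvd ι hi⟩
    pow := fun y => by
      obtain ⟨z, hz⟩ := hc.exists_rep (n := r) (by exact_mod_cast hr.prime.ne_zero) y
      refine ⟨𝐍 z, ?_⟩
      have h1 := (Quad.pow_prime_of_inert z hr.ne_two hr.legendre).mul_left z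
      rw [mul_sub, ← pow_succ', Quad.mul_star_self] at h1
      have h2 := map_dvd ι h1
      rw [map_sub, map_pow, map_natCast, map_intCast] at h2
      have h3 := dvd_pow_sub_pow hz (r + 1)
      rw [Int.cast_natCast] at h3
      simpa using dvd_add h3 h2 }

namespace Good

variable {a b : ℤ} {A : Type*} [CommRing A] {ι : Quad a b →+* A} [IsDomain A] {C : Type*}
  [AddCommGroup C]
  {F : A → A → A → A → C} {q m : ℤ} {r : ℕ} (hG : Good F q m r) (hr : Inert (b ^ 2 + 4 * a) r)

include hG hr

theorem eq_zero_of_norm {z : Quad a b} {x y : A} (hd : x * r - q * y * (q * ι z) = 1)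
    (hz : jacobiSym (𝐍 z) r = 1) : F x (q * y) (q * ι z) r = 0 := by
  obtain ⟨s, hs⟩ := hr.exists_sq_of_norm hz
  exact hG.eq_zero_of_sq (s := ι s) hd (by simpa using map_dvd ι hs)

theorem eq_of_norm {z z' : Quad a b} {x y x' y' : A} (hd : x * r - q * y * (q * ι z) = 1)
    (hd' : x' * r - q * y' * (q * ι z') = 1) (hz : jacobiSym (𝐍 z) r = jacobiSym (𝐍 z') r)
    (h0 : jacobiSym (𝐍 z) r ≠ 0) :
    F x (q * y) (q * ι z) r = F x' (q * y') (q * ι z') r := by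
  have h1 : jacobiSym (𝐍 (z * z')) r = 1 := by
    rw [map_mul, jacobiSym.mul_left, ← hz]
    rcases jacobiSym.trichotomy (𝐍 z) r with h | h | h
    · exact absurd h h0
    · rw [h]; norm_num
    · rw [h]; norm_num
  obtain ⟨s, hs⟩ := hr.exists_sq_of_norm h1
  exact hG.eq_of_sq (s := ι s) hd hd' (by simpa using map_dvd ι hs)

end Good

end SL2Ab

namespace SL2Ab

section Rademacher

/-- A formula for the homomorphism from `SL₂(ℤ)` to `ℤ/12`, valid modulo `3` and modulo `4`. -/
def chi {R : Type*} [CommRing R] (a b c d : R) : R :=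
  (1 - c ^ 2) * (b * d + 3 * (c - 1) * d + c + 3) + c * (a + d - 3)

theorem isHom_chi_three : IsHom (chi (R := ZMod 3)) := by
  have : ∀ a b c d : ZMod 3, a * d - b * c = 1 → ∀ a' b' c' d' : ZMod 3, a' * d' - b' * c' = 1 →
      chi (a * a' + b * c') (a * b' + b * d') (c * a' + d * c') (c * b' + d * d') =
      chi a b c d + chi a' b' c' d' := by decide +kernel
  exact ⟨fun h h' => this _ _ _ _ h _ _ _ _ h'⟩

theorem isHom_chi_four : IsHom (chi (R := ZMod 4)) := by
  have : ∀ a b c d : ZMod 4, a * d - b * c = 1 → ∀ a' b' c' d' : ZMod 4, a' * d' - b' * c' = 1 →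
      chi (a * a' + b * c') (a * b' + b * d') (c * a' + d * c') (c * b' + d * d') =
      chi a b c d + chi a' b' c' d' := by decide +kernel
  exact ⟨fun h h' => this _ _ _ _ h _ _ _ _ h'⟩

end Rademacher

namespace IsHom

variable {A C : Type*} [CommRing A] [AddCommGroup C] {F : A → A → A → A → C}

theorem comp_ringHom {B : Type*} [CommRing B] (hF : IsHom F) (f : B →+* A) :
    IsHom (fun a b c d => F (f a) (f b) (f c) (f d)) where
  mul h h' := by
    simp only [map_add, map_mul]
    exact hF.mul (by rw [← map_mul, ← map_mul, ← map_sub, h, map_one])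
      (by rw [← map_mul, ← map_mul, ← map_sub, h', map_one])

theorem comp_addHom {C' : Type*} [AddCommGroup C'] (hF : IsHom F) (f : C →+ C') :
    IsHom (fun a b c d => f (F a b c d)) where
  mul h h' := by
    rw [hF.mul h h', map_add]

theorem sub {F' : A → A → A → A → C} (hF : IsHom F) (hF' : IsHom F') :
    IsHom (fun a b c d => F a b c d - F' a b c d) where
  mul h h' := by
    rw [hF.mul h h', hF'.mul h h']
    abel

theorem twelve_nsmul (hF : IsHom F) : 12 • hF.upper 1 = 0 := by
  have h2 := hF.mul' (a := 0) (b := 1) (c := -1) (d := 0) (a' := 0) (b' := 1) (c' := -1) (d' := 0)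
    (a'' := -1) (b'' := 0) (c'' := 0) (d'' := -1) (by ring) (by ring) (by ring) (by ring) (by ring)
      (by ring)
  have h4 := hF.mul' (a := -1) (b := 0) (c := 0) (d := -1) (a' := -1) (b' := 0) (c' := 0) (d' := -1)
    (a'' := 1) (b'' := 0) (c'' := 0) (d'' := 1) (by ring) (by ring) (by ring) (by ring) (by ring)
      (by ring)
  rw [h2, hF.weyl, hF.one] at h4
  rw [h4]
  abel

/-- A homomorphism on `SL₂(ℤ)` vanishes if it vanishes on the elementary matrix. -/
theorem eq_zero_of_int {F : ℤ → ℤ → ℤ → ℤ → C} (hF : IsHom F) (h : hF.upper 1 = 0) {a b c d : ℤ}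
    (hd : a * d - b * c = 1) : F a b c d = 0 := by
  have key : ∀ M ∈ Subgroup.closure {ModularGroup.S, ModularGroup.T},
      F (M 0 0) (M 0 1) (M 1 0) (M 1 1) = 0 := by
    intro M hM
    induction hM using Subgroup.closure_induction with
    | mem M hM =>
      rcases hM with rfl | rfl
      · have := hF.inv (a := 0) (b := 1) (c := -1) (d := 0) (by ring)
        rw [hF.weyl, h] at this
        simpa [ModularGroup.S] using this
      · simpa [ModularGroup.T] using (hF.upper_eq 1).trans h
    | one => simpa using hF.one
    | mul M N _ _ hM hN =>
      have h1 := M.det_coe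
      have h2 := N.det_coe
      rw [Matrix.det_fin_two] at h1 h2
      have := hF.mul h1 h2
      rw [hM, hN, add_zero] at this
      simpa [Matrix.mul_apply, Fin.sum_univ_two] using this
    | inv M _ hM =>
      have h1 := M.det_coe
      rw [Matrix.det_fin_two] at h1
      have := hF.inv h1
      rw [hM, neg_zero] at this
      rw [Matrix.SpecialLinearGroup.SL2_inv_expl]
      simpa using this
  have := key ⟨!![a, b; c, d], by rw [Matrix.det_fin_two_of, hd]⟩
    (by rw [SpecialLinearGroup.SL2Z_generators]; trivial)
  simpa using this

theorem int_congr {n : ℕ} (hchi : IsHom (chi (R := ZMod n))) (hF : IsHom F)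
    (hn : n • hF.upper 1 = 0)
    {a b c d : ℤ} (hd : a * d - b * c = 1) (ha : (n : ℤ) ∣ a - 1) (hb : (n : ℤ) ∣ b)
      (hc : (n : ℤ) ∣ c)
    (hd' : (n : ℤ) ∣ d - 1) : F a b c d = 0 := by
  have hn' : (zmultiplesHom C (hF.upper 1)) n = 0 := by
    simpa using hn
  have h1 := (hF.comp_ringHom (Int.castRingHom A)).sub
    ((hchi.comp_addHom (ZMod.lift n ⟨zmultiplesHom C (hF.upper 1), hn'⟩)).comp_ringHom
      (Int.castRingHom (ZMod n)))
  have h2 := h1.eq_zero_of_int (by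
    have e1 : chi (1 : ZMod n) 1 0 1 = 1 := by simp [chi]
    have e2 := ZMod.lift_coe n ⟨zmultiplesHom C (hF.upper 1), hn'⟩ 1
    rw [Int.cast_one] at e2
    rw [← h1.upper_eq]
    simp only [eq_intCast, Int.cast_one, Int.cast_zero, e1, e2]
    simp [hF.upper_eq]) hd
  have z1 := (ZMod.intCast_zmod_eq_zero_iff_dvd _ n).mpr ha
  have z2 := (ZMod.intCast_zmod_eq_zero_iff_dvd _ n).mpr hb
  have z3 := (ZMod.intCast_zmod_eq_zero_iff_dvd _ n).mpr hc
  have z4 := (ZMod.intCast_zmod_eq_zero_iff_dvd _ n).mpr hd'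
  push_cast at z1 z4
  have e2 : chi (a : ZMod n) b c d = 0 := by
    rw [sub_eq_zero.mp z1, z2, z3, sub_eq_zero.mp z4]
    simp [chi]
  simp only [eq_intCast, e2, map_zero, sub_zero] at h2
  exact h2

end IsHom

end SL2Ab

namespace SL2Ab

open QuadraticAlgebra Filter

local notation "𝐍" => QuadraticAlgebra.norm (R := ℤ)

/-- All elements whose order divides an integer prime to `l` vanish. -/
def TorsionAt (l : ℕ) (C : Type*) [AddCommGroup C] : Prop :=
  ∀ n : ℕ, n.Coprime l → ∀ c : C, n • c = 0 → c = 0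

theorem TorsionAt.zsmul {l : ℕ} {C : Type*} [AddCommGroup C] (hC : TorsionAt l C) {n : ℤ}
    (hn : IsCoprime n l) {c : C} (h : n • c = 0) : c = 0 := by
  refine hC n.natAbs ?_ c ?_
  · simpa [Int.isCoprime_iff_gcd_eq_one, Int.gcd] using hn
  · rcases Int.natAbs_eq n with h' | h'
    · rw [h', natCast_zsmul] at h; exact h
    · rw [h', neg_smul, natCast_zsmul, neg_eq_zero] at h; exact h

namespace Ctx

variable {a b : ℤ} {A : Type*} [CommRing A] {ι : Quad a b →+* A} {π : Quad a b} (hc : Ctx ι π)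
  [IsDomain A] {C : Type*} [AddCommGroup C] {F : A → A → A → A → C} (hF : IsHom F)

include hc hF

/-- When elementary matrices are killed, the bottom row may be changed to a primitive element of the
quadratic order and an integer in a prescribed class. -/
theorem exists_bottom (h0 : ∀ t, hF.upper t = 0) {B : ℤ} (hB : B ≠ 0) {p q s t : A}
    (hd : p * t - q * s = 1) :
    ∃ (c : Quad a b) (i : ℤ), c ≠ 0 ∧ IsCoprime (𝐍 c) B ∧ IsCoprime i (𝐍 c) ∧ ∀ r : ℤ,
      r ≡ i [ZMOD 𝐍 c] →
      ∃ x y, x * r - y * ι c = 1 ∧ F p q s t = F x y (ι c) r := by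
  obtain ⟨q₁, t₁, ht₁, hd₁, hF₁⟩ : ∃ q₁ t₁, t₁ ≠ 0 ∧ p * t₁ - q₁ * s = 1 ∧
    F p q s t = F p q₁ s t₁ := by
    by_cases ht : t = 0
    · subst ht
      refine ⟨q + 1 * p, 0 + 1 * s, ?_, by linear_combination hd, ?_⟩
      · rintro h
        rw [zero_add, one_mul] at h
        rw [h] at hd
        simp at hd
      · rw [hF.mul_upper 1 hd rfl rfl, h0, add_zero]
    · exact ⟨q, t, ht, hd, rfl⟩
  obtain ⟨m, c, hmc, hprim, hcop⟩ := hc.exists_primitive (c := s) (d := t₁)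
    ⟨-q₁, p, by linear_combination hd₁⟩ ht₁ (mul_ne_zero hB hc.norm_pi_ne_zero)
  have hc0 : c ≠ 0 := by
    rintro rfl
    have : IsCoprime (0 : ℤ) 0 := hprim
    exact not_isUnit_zero (isCoprime_zero_left.mp this)
  obtain ⟨i, hi⟩ := hc.exists_int hprim t₁
  have hdet : (p + m * q₁) * t₁ - q₁ * ι c = 1 := by
    rw [← hmc]; linear_combination hd₁
  have hF₂ : F p q₁ s t₁ = F (p + m * q₁) q₁ (ι c) t₁ := by
    rw [hF.mul_lower m hd₁ rfl hmc.symm, h0, sub_zero]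
  refine ⟨c, i, hc0, IsCoprime.of_mul_right_left hcop,
    hc.isCoprime_norm hc0 (IsCoprime.of_mul_right_right hcop) ?_, fun r hr => ?_⟩
  · obtain ⟨k, hk⟩ := hi
    exact ⟨p + m * q₁, -q₁ + (p + m * q₁) * k, by linear_combination hdet - (p + m * q₁) * hk⟩
  · obtain ⟨k, hk⟩ := hi
    obtain ⟨k', hk'⟩ : ι c ∣ ((r - i : ℤ) : A) := by
      have h1 := map_dvd ι (Quad.dvd_norm c)
      rw [map_intCast] at h1
      exact h1.trans (intCast_dvd_of_dvd hr.symm.dvd)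
    push_cast at hk'
    refine ⟨p + m * q₁, q₁ + (k' - k) * (p + m * q₁),
      by linear_combination hdet + (p + m * q₁) * (hk' - hk), ?_⟩
    rw [hF₁, hF₂, hF.mul_upper (k' - k) hdet rfl (by linear_combination hk' - hk), h0, add_zero]

variable {l : ℕ} (hl : l.Prime) (hC : TorsionAt l C)

include hl hC

theorem good_one (h0 : ∀ t, hF.upper t = 0) :
    ∀ᶠ r : ℕ in atTop, Inert (b ^ 2 + 4 * a) r → ((r + 1) / 2).Coprime l → Good F 1 1 r := by
  filter_upwards [hc.good hF (q := 1) (m := 1) one_ne_zero (fun t => h0 _) dvd_rfl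
    (fun p q s t hd _ _ _ _ => IsHom.int_congr (n := 1)
      ⟨fun _ _ => Subsingleton.elim (α := ZMod 1) _ _⟩ hF (by simp [h0]) hd
      (by simp) (by simp) (by simp) (by simp)) hl hC] with r hr h1 h2
  exact hr h1 (one_dvd _) h2

theorem eq_zero_of_odd (hl2 : l ≠ 2) (h0 : ∀ t, hF.upper t = 0) {M g : ℤ} (hM : M ≠ 0)
    (hg : IsCoprime g M)
    (hI : ∀ r : ℕ, r.Prime → r ≡ g [ZMOD M] → Inert (b ^ 2 + 4 * a) r ∧ ¬ l ∣ r + 1)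
    {p q s t : A} (hd : p * t - q * s = 1) : F p q s t = 0 := by
  obtain ⟨c, i, hc0, hcB, hi, hr⟩ := hc.exists_bottom hF h0 hM hd
  obtain ⟨N, hN⟩ := eventually_atTop.mp (hc.good_one hF hl hC h0)
  obtain ⟨r, hrN, hrp, h1, h2⟩ := exists_prime_of_crt N (Quad.norm_ne_zero hc.neg hc0) hM hcB hi hg
  obtain ⟨x, y, hxy, hFxy⟩ := hr r h1
  have h3 := hI r hrp h2
  have hG := hN r hrN.le h3.1 (((Nat.Prime.coprime_iff_not_dvd hl).mpr fun h4 => h3.2 <|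
    (h4.mul_left 2).trans (dvd_of_eq (Nat.two_mul_div_two_of_even
      (hrp.odd_of_ne_two h3.1.ne_two).add_one))).symm)
  rw [hFxy]
  simpa using hG.eq_zero_of_odd (hC 2 ((Nat.coprime_primes Nat.prime_two hl).mpr hl2.symm)) (a := x)
    (b := y) (c := ι c)
    (by simpa using hxy)

omit hl in
theorem eq_zero_of_two (hl2 : l = 2) (h0 : ∀ t, hF.upper t = 0) {M g : ℤ} (hM : M ≠ 0) (hM2 : Odd M)
    (hg : IsCoprime g M) (hI : ∀ r : ℕ, r.Prime → r ≡ 5 [ZMOD 8] → r ≡ g [ZMOD M] →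
      Inert (b ^ 2 + 4 * a) r)
    {α m : Quad a b} {k : ℤ} {N : ℕ} (hN : 𝐍 α = N) (hN2 : Odd N) (hNM : IsCoprime (N : ℤ) M)
    (hαk : α + m * (k : Quad a b) = 1) (hk : jacobiSym k N = -1)
    {p q s t : A} (hd : p * t - q * s = 1) : F p q s t = 0 := by
  subst hl2
  have h8 : ∀ {x : ℤ}, Odd x → IsCoprime (8 : ℤ) x := fun hx => by
    have : IsCoprime (2 : ℤ) _ := Int.isCoprime_two_left.mpr hx
    simpa using this.pow_left (m := 3)
  have hN0 : N ≠ 0 := by rintro rfl; simp at hN2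
  have hkN : IsCoprime k (N : ℤ) := by
    have : NeZero N := ⟨hN0⟩
    have := (not_congr (jacobiSym.eq_zero_iff_not_coprime (a := k) (b := N))).mp
      (by rw [hk]; norm_num)
    rw [Int.isCoprime_iff_gcd_eq_one]
    exact not_not.mp this
  have hN0' : (N : ℤ) ≠ 0 := by exact_mod_cast hN0
  have hN2' : Odd (N : ℤ) := by exact_mod_cast hN2
  obtain ⟨c, i, hc0, hcB, hi, hr⟩ := hc.exists_bottom hF h0 (B := 8 * M * N)
    (mul_ne_zero (mul_ne_zero (by norm_num) hM) hN0') hd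
  obtain ⟨B, hB⟩ := eventually_atTop.mp (hc.good_one hF Nat.prime_two hC h0)
  have hc0' := Quad.norm_ne_zero hc.neg hc0
  obtain ⟨z, hz1, hzp, hz2, hz3, hz4⟩ := exists_prime_of_crt₃ 0 (l := 8) (by norm_num) hM hN0'
    (h8 hM2) (h8 hN2') hNM.symm (h8 (x := 5) (by decide)).symm hg hkN
  obtain ⟨r, hrB, hrp, h1, h2⟩ := exists_prime_of_crt B hc0'
    (mul_ne_zero (mul_ne_zero (by norm_num) hM) hN0') hcB hi
    (((isCoprime_of_modEq hz2 (h8 (x := 5) (by decide)).symm).mul_right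
      (isCoprime_of_modEq hz3 hg)).mul_right
      (isCoprime_of_modEq hz4 hkN))
  have r8 : (r : ℤ) ≡ 5 [ZMOD 8] := (h2.of_mul_right _ |>.of_mul_right _).trans hz2
  have rM : (r : ℤ) ≡ g [ZMOD M] := (h2.of_mul_right _ |>.of_mul_left _).trans hz3
  have rN : (r : ℤ) ≡ k [ZMOD N] := (h2.of_mul_left _).trans hz4
  have hrI := hI r hrp r8 rM
  have r8' : r % 8 = 5 := by
    have : (r : ℤ) % 8 = 5 := r8
    omega
  have hG := hB r hrB.le hrI (Nat.coprime_two_right.mpr (Nat.odd_iff.mpr (by omega)))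
  obtain ⟨x, y, hxy, hFxy⟩ := hr r h1
  rw [hFxy]
  have hxy' : x * r - (1 : ℤ) * y * ((1 : ℤ) * ι c) = 1 := by simpa using hxy
  suffices F x ((1 : ℤ) * y) ((1 : ℤ) * ι c) r = 0 by simpa using this
  have hs : jacobiSym (𝐍 α) r = -1 := by
    rw [hN, ← jacobiSym.quadratic_reciprocity_one_mod_four (by omega) hN2, jacobiSym.mod_left' rN,
      hk]
  have hαr : IsCoprime (ι α) (r : A) := by
    have h3 : ¬ (r : ℤ) ∣ 𝐍 α := Inert.not_dvd_of_sym hrp (by rw [hs]; norm_num)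
    have h4 := (isCoprime_intCast (A := A) (isCoprime_natPrime hrp h3)).symm
    have h5 := map_dvd ι (Quad.dvd_norm α)
    rw [map_intCast] at h5
    simpa using IsCoprime.of_isCoprime_of_dvd_left h4 h5
  obtain ⟨u, v, huv⟩ := hαr
  have hdet : v * r - (-u) * ι α = 1 := by linear_combination huv
  have hdet' : v * r - (1 : ℤ) * (-u) * ((1 : ℤ) * ι α) = 1 := by simpa using hdet
  have hα0 : F v ((1 : ℤ) * (-u)) ((1 : ℤ) * ι α) r = 0 := by
    obtain ⟨j, hj⟩ : ι α ∣ ((k - r : ℤ) : A) := by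
      have h5 := map_dvd ι (Quad.dvd_norm α)
      rw [map_intCast, hN] at h5
      exact h5.trans (intCast_dvd_of_dvd rN.dvd)
    push_cast at hj
    have hα1 : ι α + ι m * k = 1 := by
      have := congrArg ι hαk
      simpa using this
    have e1 := hF.mul_upper (b' := -u + j * v) (d' := k) j hdet rfl (by linear_combination hj)
    have hdet1 : v * k - (-u + j * v) * ι α = 1 := by linear_combination hdet + v * hj
    have e2 := hF.mul_lower (a' := v + ι m * (-u + j * v)) (c' := 1) (ι m) hdet1 rfl
      (by linear_combination -hα1)
    have hdet2 : (v + ι m * (-u + j * v)) * k - (-u + j * v) * 1 = 1 := by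
      linear_combination hdet1 + (-u + j * v) * hα1
    have e3 := hF.mul_upper (b' := -1) (d' := 0) (-k) hdet2
      (by linear_combination hdet2) (by ring)
    have e4 := hF.eq_of_bottom (a := 0) (b := -1) (c := 1) (d := 0) (a' := v + ι m * (-u + j * v))
      (b' := -1) (by ring) (by ring)
    have e5 := hF.inv (a := 0) (b := 1) (c := -1) (d := 0) (by ring)
    rw [neg_neg, hF.weyl] at e5
    simp only [h0, add_zero, sub_zero, neg_zero, zero_add, smul_zero] at e1 e2 e3 e4 e5
    rw [Int.cast_one, one_mul, one_mul, ← e1, ← e2, ← e3, e4, e5]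
  have hcr : jacobiSym (𝐍 c) r = 1 ∨ jacobiSym (𝐍 c) r = -1 := by
    refine Inert.sym_ne_zero hrp fun hdvd => ?_
    exact not_dvd_of_isCoprime (isCoprime_of_modEq h1 hi) hrp dvd_rfl hdvd
  rcases hcr with h3 | h3
  · exact hG.eq_zero_of_norm hrI hxy' h3
  · rw [hG.eq_of_norm hrI hxy' hdet' (by rw [h3, hs]) (by rw [h3]; norm_num), hα0]

end Ctx

end SL2Ab

namespace SL2Ab

theorem exists_residue_mul {M M' g g' : ℤ} (hM : M ≠ 0) (hM' : M' ≠ 0) (h : IsCoprime M M')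
    (hg : IsCoprime g M)
    (hg' : IsCoprime g' M') :
    ∃ z, IsCoprime z (M * M') ∧ ∀ r : ℤ, r ≡ z [ZMOD M * M'] → r ≡ g [ZMOD M] ∧
      r ≡ g' [ZMOD M'] := by
  obtain ⟨z, -, -, h1, h2⟩ := exists_prime_of_crt 0 hM hM' h hg hg'
  exact ⟨z, (isCoprime_of_modEq h1 hg).mul_right (isCoprime_of_modEq h2 hg'), fun r hr =>
    ⟨(hr.of_mul_right _).trans h1, (hr.of_mul_left _).trans h2⟩⟩

theorem exists_nonresidue {p : ℕ} (hp : p.Prime) (hp2 : p ≠ 2) : ∃ n : ℤ, jacobiSym n p = -1 := by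
  have := Fact.mk hp
  obtain ⟨x, hx⟩ := quadraticChar_exists_neg_one (F := ZMod p) (by rwa [ZMod.ringChar_zmod_n])
  obtain ⟨n, rfl⟩ := ZMod.intCast_surjective x
  refine ⟨n, ?_⟩
  rwa [← jacobiSym.legendreSym.to_jacobiSym, legendreSym]

theorem isCoprime_of_sym {n : ℤ} {e : ℕ} (he : e ≠ 0) (h : jacobiSym n e ≠ 0) :
    IsCoprime n (e : ℤ) := by
  have : NeZero e := ⟨he⟩
  have := (not_congr (jacobiSym.eq_zero_iff_not_coprime (a := n) (b := e))).mp h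
  rw [Int.isCoprime_iff_gcd_eq_one]
  exact not_not.mp this

theorem exists_sym_eq_neg_one {e : ℕ} (he : Squarefree e) (ho : Odd e) (h1 : e ≠ 1) :
    ∃ g : ℤ, IsCoprime g e ∧ jacobiSym g e = -1 := by
  obtain ⟨p, hp, f, rfl⟩ := Nat.exists_prime_and_dvd h1
  have hp2 : p ≠ 2 := by
    rintro rfl
    exact absurd ho (by simp)
  have hf0 : f ≠ 0 := by rintro rfl; simp at he
  obtain ⟨n, hn⟩ := exists_nonresidue hp hp2
  have hcop : IsCoprime (p : ℤ) f := Nat.isCoprime_iff_coprime.mpr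
    (Nat.coprime_of_squarefree_mul he)
  obtain ⟨g, hg, h⟩ := exists_residue_mul (by exact_mod_cast hp.ne_zero)
    (by exact_mod_cast hf0) hcop
    (isCoprime_of_sym hp.ne_zero (by rw [hn]; norm_num)) (isCoprime_one_left (x := (f : ℤ)))
  obtain ⟨h2, h3⟩ := h g rfl
  refine ⟨g, by push_cast; exact hg, ?_⟩
  have : NeZero p := ⟨hp.ne_zero⟩
  have : NeZero f := ⟨hf0⟩
  rw [jacobiSym.mul_right, jacobiSym.mod_left' h2, hn, jacobiSym.mod_left' h3, jacobiSym.one_left]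
  norm_num

theorem sym_neg_mul {r : ℕ} (hr : r % 4 = 1) (d : ℕ) : jacobiSym (-d) r = jacobiSym d r := by
  have hodd : Odd r := Nat.odd_iff.mpr (by omega)
  rw [jacobiSym.neg _ hodd, ZMod.χ₄_nat_one_mod_four hr, one_mul]

theorem sym_two {r : ℕ} (hr : r % 8 = 5) : jacobiSym 2 r = -1 := by
  rw [jacobiSym.at_two (Nat.odd_iff.mpr (by omega)), ZMod.χ₈_nat_eq_if_mod_eight]
  simp [hr, show r % 2 = 1 by omega]

theorem sym_two' {r : ℕ} (hr : r % 8 = 1) : jacobiSym 2 r = 1 := by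
  rw [jacobiSym.at_two (Nat.odd_iff.mpr (by omega)), ZMod.χ₈_nat_eq_if_mod_eight]
  simp [hr, show r % 2 = 1 by omega]

/-- A residue class modulo an odd divisor of `d`, prime to `3`, forcing `-d` to be a nonresidue. -/
theorem exists_inert_class₃ {d : ℕ} (hd : Squarefree d) (h1 : d ≠ 1) (h3 : d ≠ 3) :
    ∃ M g : ℤ, M ≠ 0 ∧ Odd M ∧ ¬ 3 ∣ M ∧ IsCoprime g M ∧ M ∣ d ∧ ∀ r : ℕ, r ≡ 5 [ZMOD 8] →
      r ≡ 1 [ZMOD 3] →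
      r ≡ g [ZMOD M] → jacobiSym (-d) r = -1 := by
  obtain ⟨e, η, rfl, hη, he3⟩ : ∃ e η : ℕ, d = e * η ∧ (η = 1 ∨ η = 3) ∧ ¬ 3 ∣ e := by
    by_cases h : 3 ∣ d
    · obtain ⟨e, rfl⟩ := h
      refine ⟨e, 3, mul_comm _ _, Or.inr rfl, fun h => ?_⟩
      obtain ⟨k, rfl⟩ := h
      exact absurd (hd 3 ⟨k, by ring⟩) (by decide)
    · exact ⟨d, 1, by simp, Or.inl rfl, h⟩
  have hη3 : ∀ r : ℕ, (r : ℤ) ≡ 5 [ZMOD 8] → (r : ℤ) ≡ 1 [ZMOD 3] → jacobiSym η r = 1 := by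
    intro r h8 hr3
    rcases hη with rfl | rfl
    · exact_mod_cast jacobiSym.one_left r
    · have : (r : ℤ) % 8 = 5 := h8
      rw [← jacobiSym.quadratic_reciprocity_one_mod_four (by omega) (by decide),
        jacobiSym.mod_left' hr3, jacobiSym.one_left]
  have he0 : e ≠ 0 := by rintro rfl; simp at hd
  have hes : Squarefree e := hd.squarefree_of_dvd (Dvd.intro _ rfl)
  rcases Nat.even_or_odd e with heven | hodd
  · obtain ⟨f, rfl⟩ := heven.two_dvd
    have hf : Odd f := by
      by_contra h
      obtain ⟨k, rfl⟩ := (Nat.not_odd_iff_even.mp h).two_dvd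
      exact absurd (hes 2 ⟨k, by ring⟩) (by decide)
    refine ⟨f, 1, by exact_mod_cast fun h => he0 (by simp [h]), by exact_mod_cast hf,
      fun h => he3 (by exact_mod_cast h.mul_left 2), isCoprime_one_left,
        ⟨2 * η, by push_cast; ring⟩, fun r h8 h3 hf1 => ?_⟩
    have h8' : (r : ℤ) % 8 = 5 := h8
    rw [sym_neg_mul (by omega)]
    push_cast
    rw [jacobiSym.mul_left, jacobiSym.mul_left, hη3 r h8 h3,
      ← jacobiSym.quadratic_reciprocity_one_mod_four (a := r) (b := f) (by omega) hf,
        jacobiSym.mod_left' hf1,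
      jacobiSym.one_left, sym_two (by omega)]
    norm_num
  · obtain ⟨g, hg, hge⟩ := exists_sym_eq_neg_one hes hodd
      (by rintro rfl; rcases hη with rfl | rfl <;> simp at h1 h3)
    refine ⟨e, g, by exact_mod_cast he0, by exact_mod_cast hodd, by exact_mod_cast he3, hg,
      ⟨η, by push_cast; ring⟩, fun r h8 h3 hf1 => ?_⟩
    have h8' : (r : ℤ) % 8 = 5 := h8
    rw [sym_neg_mul (by omega)]
    push_cast
    rw [jacobiSym.mul_left, hη3 r h8 h3,
      ← jacobiSym.quadratic_reciprocity_one_mod_four (a := r) (b := e) (by omega) hodd,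
        jacobiSym.mod_left' hf1, hge]
    norm_num

/-- A residue class modulo an odd divisor of `d` forcing `-d` to be a nonresidue. -/
theorem exists_inert_class {d : ℕ} (hd : Squarefree d) (h1 : d ≠ 1) :
    ∃ M g : ℤ, M ≠ 0 ∧ Odd M ∧ IsCoprime g M ∧ M ∣ d ∧ ∀ r : ℕ, r ≡ 5 [ZMOD 8] →
      r ≡ g [ZMOD M] → jacobiSym (-d) r = -1 := by
  have he0 : d ≠ 0 := by rintro rfl; simp at hd
  rcases Nat.even_or_odd d with heven | hodd
  · obtain ⟨f, rfl⟩ := heven.two_dvd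
    have hf : Odd f := by
      by_contra h
      obtain ⟨k, rfl⟩ := (Nat.not_odd_iff_even.mp h).two_dvd
      exact absurd (hd 2 ⟨k, by ring⟩) (by decide)
    refine ⟨f, 1, by exact_mod_cast fun h => he0 (by simp [h]), by exact_mod_cast hf,
      isCoprime_one_left, ⟨2, by push_cast; ring⟩, fun r h8 hf1 => ?_⟩
    have h8' : (r : ℤ) % 8 = 5 := h8
    rw [sym_neg_mul (by omega)]
    push_cast
    rw [jacobiSym.mul_left,
      ← jacobiSym.quadratic_reciprocity_one_mod_four (a := r) (b := f) (by omega) hf,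
        jacobiSym.mod_left' hf1,
      jacobiSym.one_left, sym_two (by omega)]
    norm_num
  · obtain ⟨g, hg, hge⟩ := exists_sym_eq_neg_one hd hodd h1
    refine ⟨d, g, by exact_mod_cast he0, by exact_mod_cast hodd, hg, dvd_rfl, fun r h8 hf1 => ?_⟩
    have h8' : (r : ℤ) % 8 = 5 := h8
    rw [sym_neg_mul (by omega),
      ← jacobiSym.quadratic_reciprocity_one_mod_four (a := r) (b := d) (by omega) hodd,
        jacobiSym.mod_left' hf1, hge]

theorem isCoprime_eight {x : ℤ} (hx : Odd x) : IsCoprime (8 : ℤ) x := by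
  have : IsCoprime (2 : ℤ) _ := Int.isCoprime_two_left.mpr hx
  simpa using this.pow_left (m := 3)

theorem exists_nonresidue_add_one {l : ℕ} (hl : l.Prime) (hl5 : 5 ≤ l) :
    ∃ n : ℤ, jacobiSym n l = -1 ∧ ¬ (l : ℤ) ∣ n + 1 := by
  have hl2 : l ≠ 2 := by omega
  obtain ⟨n, hn⟩ := exists_nonresidue hl hl2
  by_cases h : (l : ℤ) ∣ n + 1
  · have h1 : jacobiSym (-1) l = -1 :=
      (jacobiSym.mod_left' (Int.modEq_iff_dvd.mpr (by simpa using h))).trans hn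
    refine ⟨2 ^ 2 * (-1), ?_, fun h2 => ?_⟩
    · rw [jacobiSym.mul_left, jacobiSym.sq_one', h1, one_mul]
      have := (Nat.coprime_primes Nat.prime_two hl).mpr hl2.symm
      simpa [Int.gcd] using this
    · have h3 : l ∣ 3 := by
        have := h2.neg_right
        norm_num at this
        exact_mod_cast this
      have := Nat.le_of_dvd (by norm_num) h3
      omega
  · exact ⟨n, hn, h⟩

/-- A residue class of auxiliary primes adapted to an odd prime `l`. -/
theorem exists_odd_class {d : ℕ} (hd : Squarefree d) (h1 : d ≠ 1) (h3 : d ≠ 3) {l : ℕ}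
    (hl : l.Prime)
    (hl2 : l ≠ 2) : ∃ M g : ℤ, M ≠ 0 ∧ IsCoprime g M ∧ ∀ r : ℕ, r ≡ g [ZMOD M] →
      jacobiSym (-d) r = -1 ∧ ¬ l ∣ r + 1 ∧ (l = 3 → ¬ (9 : ℤ) ∣ r ^ 2 - 1) ∧
        (l ≠ 3 → ¬ (l : ℤ) ∣ r ^ 2 - 1) := by
  have hd0 : d ≠ 0 := by rintro rfl; simp at hd
  have hlp := Nat.prime_iff_prime_int.mp hl
  have hlodd := hl.odd_of_ne_two hl2
  have hlodd' : Odd (l : ℤ) := by exact_mod_cast hlodd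
  by_cases hl3 : l = 3
  · subst hl3
    obtain ⟨M, g, hM, hMo, hM3, hg, -, hr⟩ := exists_inert_class₃ hd h1 h3
    have c3 : IsCoprime (9 : ℤ) M := by
      have := (isCoprime_natPrime Nat.prime_three (x := M) (by exact_mod_cast hM3)).pow_left
        (m := 2)
      simpa using this
    obtain ⟨z, hz, h⟩ := exists_residue_mul (by norm_num) hM c3 (g := 4) ⟨-2, 1, by norm_num⟩ hg
    obtain ⟨w, hw, h'⟩ := exists_residue_mul (M := 8) (g := 5) (by norm_num)
      (mul_ne_zero (by norm_num) hM)
      ((isCoprime_eight (by decide)).mul_right (isCoprime_eight hMo))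
        (isCoprime_eight (by decide)).symm hz
    refine ⟨_, w, mul_ne_zero (by norm_num) (mul_ne_zero (by norm_num) hM), hw, fun r hrw => ?_⟩
    obtain ⟨e1, e2⟩ := h' _ hrw
    obtain ⟨e3, e4⟩ := h _ e2
    have e3' : (r : ℤ) % 9 = 4 := e3
    refine ⟨hr r e1 (show (r : ℤ) % 3 = 1 % 3 by omega) e4, ?_, fun _ => ?_, fun h => absurd rfl h⟩
    · omega
    · have : ((r : ℤ) ^ 2 - 1) % 9 = 6 := by
        rw [Int.sub_emod, pow_two, Int.mul_emod, e3']; rfl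
      omega
  have hl5 : 5 ≤ l := by
    have := hl.two_le
    have : l ≠ 4 := by rintro rfl; exact absurd hl (by decide)
    omega
  have key : ∀ {r ν : ℤ}, r ≡ ν [ZMOD l] → ¬ (l : ℤ) ∣ ν + 1 → ¬ (l : ℤ) ∣ ν - 1 →
      ¬ (l : ℤ) ∣ r + 1 ∧ ¬ (l : ℤ) ∣ r ^ 2 - 1 := by
    intro r ν h h4 h5
    have h6 : ¬ (l : ℤ) ∣ r + 1 := fun h6 => h4 (by
      have := (h.dvd).add h6
      rwa [show ν - r + (r + 1) = ν + 1 by ring] at this)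
    refine ⟨h6, fun h7 => ?_⟩
    rw [show r ^ 2 - 1 = (r + 1) * (r - 1) by ring] at h7
    rcases hlp.dvd_or_dvd h7 with h7 | h7
    · exact h6 h7
    · have := (h.dvd).add h7
      rw [show ν - r + (r - 1) = ν - 1 by ring] at this
      exact h5 this
  by_cases hld : l ∣ d
  · obtain ⟨f, rfl⟩ := hld
    obtain ⟨ν, hν, hν1⟩ := exists_nonresidue_add_one hl hl5
    have hν2 : ¬ (l : ℤ) ∣ ν - 1 := fun h => by
      rw [← jacobiSym.mod_left' (a₁ := 1) (Int.modEq_iff_dvd.mpr h), jacobiSym.one_left] at hν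
      norm_num at hν
    obtain ⟨e, ε, rfl, hε, heo⟩ : ∃ e ε : ℕ, f = e * ε ∧ (ε = 1 ∨ ε = 2) ∧ Odd e := by
      rcases Nat.even_or_odd f with h | h
      · obtain ⟨e, rfl⟩ := h.two_dvd
        refine ⟨e, 2, mul_comm _ _, Or.inr rfl, ?_⟩
        by_contra h
        obtain ⟨k, rfl⟩ := (Nat.not_odd_iff_even.mp h).two_dvd
        exact absurd (hd 2 ⟨l * k, by ring⟩) (by decide)
      · exact ⟨f, 1, by simp, Or.inl rfl, h⟩
    have he0 : e ≠ 0 := by rintro rfl; simp at hd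
    have he0' : (e : ℤ) ≠ 0 := by exact_mod_cast he0
    have hl0' : (l : ℤ) ≠ 0 := by exact_mod_cast hl.ne_zero
    have hle : IsCoprime (l : ℤ) e := by
      rw [← mul_assoc] at hd
      exact Nat.isCoprime_iff_coprime.mpr (Nat.coprime_of_squarefree_mul
        (hd.squarefree_of_dvd (Dvd.intro _ rfl)))
    obtain ⟨z, hz, h⟩ := exists_residue_mul hl0' he0' hle
      (isCoprime_of_sym hl.ne_zero (by rw [hν]; norm_num))
      (isCoprime_one_left (x := (e : ℤ)))
    obtain ⟨w, hw, h'⟩ := exists_residue_mul (M := 8) (g := 1) (by norm_num) (mul_ne_zero hl0' he0')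
      (isCoprime_eight (hlodd'.mul (by exact_mod_cast heo))) isCoprime_one_left hz
    refine ⟨_, w, mul_ne_zero (by norm_num) (mul_ne_zero hl0' he0'), hw, fun r hrw => ?_⟩
    obtain ⟨e1, e2⟩ := h' _ hrw
    obtain ⟨e3, e4⟩ := h _ e2
    have e1' : (r : ℤ) % 8 = 1 := e1
    obtain ⟨e5, e6⟩ := key e3 hν1 hν2
    refine ⟨?_, by exact_mod_cast e5, fun h => absurd h hl3, fun _ => e6⟩
    have hε' : jacobiSym ε r = 1 := by
      rcases hε with rfl | rfl
      · exact_mod_cast jacobiSym.one_left r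
      · exact_mod_cast sym_two' (by omega)
    rw [sym_neg_mul (by omega)]
    push_cast
    rw [jacobiSym.mul_left, jacobiSym.mul_left, hε',
      ← jacobiSym.quadratic_reciprocity_one_mod_four (a := r) (b := e) (by omega) heo,
      ← jacobiSym.quadratic_reciprocity_one_mod_four (a := r) (b := l) (by omega) hlodd,
        jacobiSym.mod_left' e3, hν,
      jacobiSym.mod_left' e4, jacobiSym.one_left]
    norm_num
  · obtain ⟨M, g, hM, hMo, hg, hMd, hr⟩ := exists_inert_class hd h1
    have hl0' : (l : ℤ) ≠ 0 := by exact_mod_cast hl.ne_zero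
    have hlM : IsCoprime (l : ℤ) M := isCoprime_natPrime hl fun h =>
      hld (by exact_mod_cast h.trans hMd)
    obtain ⟨z, hz, h⟩ := exists_residue_mul hl0' hM hlM (g := 2)
      (Int.isCoprime_two_left.mpr hlodd') hg
    obtain ⟨w, hw, h'⟩ := exists_residue_mul (M := 8) (g := 5) (by norm_num) (mul_ne_zero hl0' hM)
      (isCoprime_eight (hlodd'.mul hMo)) (isCoprime_eight (by decide)).symm hz
    refine ⟨_, w, mul_ne_zero (by norm_num) (mul_ne_zero hl0' hM), hw, fun r hrw => ?_⟩
    obtain ⟨e1, e2⟩ := h' _ hrw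
    obtain ⟨e3, e4⟩ := h _ e2
    obtain ⟨e5, e6⟩ := key e3 (fun h => by
        have := Int.le_of_dvd (by norm_num) h
        omega) (fun h => by
        have := Int.le_of_dvd (by norm_num) h
        omega)
    exact ⟨hr r e1 e4, by exact_mod_cast e5, fun h => absurd h hl3, fun _ => e6⟩

end SL2Ab

namespace SL2Ab

open QuadraticAlgebra Filter

local notation "𝐍" => QuadraticAlgebra.norm (R := ℤ)

/-- `Quad a b` is the ring of integers of `ℚ(√-d)`. -/
def IsMaximal (a b : ℤ) (d : ℕ) : Prop :=
  (b = 0 ∧ a = -d ∧ d % 4 ≠ 3) ∨ (b = 1 ∧ 4 * a + 1 = -d)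

theorem IsMaximal.inert {a b : ℤ} {d r : ℕ} (h : IsMaximal a b d) (hr : r.Prime)
    (hs : jacobiSym (-d) r = -1) : Inert (b ^ 2 + 4 * a) r := by
  refine ⟨hr, ?_⟩
  have h2 : r ≠ 2 := Inert.ne_two ⟨hr, hs⟩
  rcases h with ⟨rfl, rfl, -⟩ | ⟨rfl, h⟩
  · have e : (0 : ℤ) ^ 2 + 4 * -d = 2 ^ 2 * -d := by ring
    rw [e, jacobiSym.mul_left, jacobiSym.sq_one', one_mul, hs]
    have := (Nat.coprime_primes Nat.prime_two hr).mpr h2.symm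
    simpa [Int.gcd] using this
  · rw [show (1 : ℤ) ^ 2 + 4 * a = -d by linarith, hs]

theorem IsHom.upper_zsmul {A C : Type*} [CommRing A] [AddCommGroup C] {F : A → A → A → A → C}
    (hF : IsHom F)
    (n : ℤ) (x : A) : hF.upper (n * x) = n • hF.upper x := by
  rw [← map_zsmul, zsmul_eq_mul]

namespace Ctx

variable {a b : ℤ} {A : Type*} [CommRing A] {ι : Quad a b →+* A} {π : Quad a b} (hc : Ctx ι π)
  [IsDomain A] {C : Type*} [AddCommGroup C] {F : A → A → A → A → C} (hF : IsHom F)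
  {l : ℕ} (hC : TorsionAt l C)

include hc hF hC

theorem upper_level {M g n : ℤ} (hM : M ≠ 0) (hg : IsCoprime g M)
    (hI : ∀ r : ℕ, r.Prime → r ≡ g [ZMOD M] → Inert (b ^ 2 + 4 * a) r ∧
      ∃ k j : ℤ, IsCoprime k l ∧ (r ^ 2 - 1) * j = k * n) (t : A) : hF.upper (n * t) = 0 := by
  obtain ⟨q, hq, h0⟩ := hF.exists_level hc
  obtain ⟨B, hB⟩ := eventually_atTop.mp (hc.upper_sq hF hq h0)
  obtain ⟨r, hrB, hr, h1, -⟩ := exists_prime_of_crt B hM one_ne_zero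
    (isCoprime_one_right (x := M)) hg (isCoprime_one_right (x := 1))
  obtain ⟨h2, k, j, hk, hj⟩ := hI r hr h1
  refine hC.zsmul hk ?_
  have h3 := hB r hrB.le h2 (j * t)
  rw [← hF.upper_zsmul, ← mul_assoc, ← Int.cast_mul, ← hj]
  rw [← h3]
  push_cast
  ring_nf

theorem upper_eq_zero_of_five_le {d : ℕ} (hd : Squarefree d) (h1 : d ≠ 1) (h3 : d ≠ 3)
    (hm : IsMaximal a b d)
    (hl : l.Prime) (hl5 : 5 ≤ l) (t : A) : hF.upper t = 0 := by
  obtain ⟨M, g, hM, hg, h⟩ := exists_odd_class hd h1 h3 hl (by omega)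
  have := hc.upper_level hF hC hM hg (n := 1) (fun r hr hrg => ?_) t
  · simpa using this
  · obtain ⟨e1, -, -, e2⟩ := h r hrg
    exact ⟨hm.inert hr e1, r ^ 2 - 1, 1, (isCoprime_natPrime hl (e2 (by omega))).symm, by ring⟩

theorem upper_three_mul {d : ℕ} (hd : Squarefree d) (h1 : d ≠ 1) (h3 : d ≠ 3) (hm : IsMaximal a b d)
    (hl3 : l = 3) (t : A) : hF.upper (3 * t) = 0 := by
  subst hl3
  obtain ⟨M, g, hM, hg, h⟩ := exists_odd_class hd h1 h3 Nat.prime_three (by omega)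
  have := hc.upper_level hF hC hM hg (n := 3) (fun r hr hrg => ?_) t
  · simpa using this
  · obtain ⟨e1, -, e2, -⟩ := h r hrg
    refine ⟨hm.inert hr e1, ?_⟩
    by_cases h4 : (3 : ℤ) ∣ r ^ 2 - 1
    · obtain ⟨k, hk⟩ := h4
      refine ⟨k, 1, (isCoprime_natPrime Nat.prime_three fun h5 => e2 rfl ?_).symm, by rw [hk]; ring⟩
      rw [hk]
      exact mul_dvd_mul_left 3 h5
    · exact ⟨r ^ 2 - 1, 3, (isCoprime_natPrime Nat.prime_three h4).symm, by ring⟩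

theorem upper_eight_mul {d : ℕ} (hd : Squarefree d) (h1 : d ≠ 1) (hm : IsMaximal a b d)
    (hl2 : l = 2) (t : A) : hF.upper (8 * t) = 0 := by
  subst hl2
  obtain ⟨M, g, hM, hMo, hg, -, h⟩ := exists_inert_class hd h1
  obtain ⟨w, hw, h'⟩ := exists_residue_mul (M := 8) (g := 5) (by norm_num) hM
    (isCoprime_eight hMo) (isCoprime_eight (by decide)).symm hg
  have := hc.upper_level hF hC (mul_ne_zero (by norm_num) hM) hw (n := 8) (fun r hr hrg => ?_) t
  · simpa using this
  · obtain ⟨e1, e2⟩ := h' r hrg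
    refine ⟨hm.inert hr (h r e1 e2), ?_⟩
    obtain ⟨k, hk⟩ := e1.symm.dvd
    refine ⟨8 * k ^ 2 + 10 * k + 3, 1, ?_, by rw [sub_eq_iff_eq_add.mp hk]; ring⟩
    exact (isCoprime_natPrime Nat.prime_two (by omega)).symm

omit hc [IsDomain A] in
theorem upper_one_zsmul_three (hl3 : l = 3) : 3 • hF.upper 1 = 0 := by
  subst hl3
  refine hC 4 (by norm_num) _ ?_
  rw [smul_smul]
  exact hF.twelve_nsmul

omit hc [IsDomain A] in
theorem upper_one_zsmul_four (hl2 : l = 2) : 4 • hF.upper 1 = 0 := by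
  subst hl2
  refine hC 3 (by norm_num) _ ?_
  rw [smul_smul]
  exact hF.twelve_nsmul

theorem good_three (hl3 : l = 3) (h0 : ∀ t, hF.upper (3 * t) = 0) :
    ∀ᶠ r : ℕ in atTop, Inert (b ^ 2 + 4 * a) r → r ≡ 1 [ZMOD 3] → Good F 3 3 r := by
  filter_upwards [hc.good hF (q := 3) (m := 3) (by norm_num) (by simpa using h0) dvd_rfl
    (fun p q s t hd h1 h2 h3 h4 => IsHom.int_congr (n := 3) isHom_chi_three hF
      (upper_one_zsmul_three hF hC hl3)
      hd h1 h2 h3 h4) (l := 3) Nat.prime_three (hl3 ▸ hC)] with r hr h1 h2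
  have e1 : (r : ℤ) % 3 = 1 := h2
  have e2 := Nat.odd_iff.mp (h1.prime.odd_of_ne_two h1.ne_two)
  refine hr h1 h2.symm.dvd ((Nat.coprime_comm.mp
    ((Nat.Prime.coprime_iff_not_dvd Nat.prime_three).mpr ?_)))
  omega

theorem good_eight (hl2 : l = 2) (h0 : ∀ t, hF.upper (8 * t) = 0) :
    ∀ᶠ r : ℕ in atTop, Inert (b ^ 2 + 4 * a) r → r ≡ 1 [ZMOD 4] → Good F 8 4 r := by
  filter_upwards [hc.good hF (q := 8) (m := 4) (by norm_num) (by simpa using h0) (by norm_num)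
    (fun p q s t hd h1 h2 h3 h4 => IsHom.int_congr (n := 4) isHom_chi_four hF
      (upper_one_zsmul_four hF hC hl2)
      hd h1 h2 h3 h4) (l := 2) Nat.prime_two (hl2 ▸ hC)] with r hr h1 h2
  have e1 : (r : ℤ) % 4 = 1 := h2
  refine hr h1 h2.symm.dvd ((Nat.coprime_comm.mp
    ((Nat.Prime.coprime_iff_not_dvd Nat.prime_two).mpr ?_)))
  omega

omit hc hC [IsDomain A] in
theorem upper_relation {q g g' : ℤ} (hg : q * g' = g ^ 2) (h0 : ∀ t, hF.upper (q * t) = 0)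
    {α c : Quad a b}
    (hcop : IsCoprime α (g * c)) {N N₁ τ r k : ℤ} (hN : 𝐍 α = N) (hN₁ : 𝐍 c = N₁)
      (hτ : τ = g * N * N₁)
    (hr : r = 1 + τ + τ ^ 2 + τ ^ 3 + k * (q * g ^ 2 * N * N₁ ^ 2)) :
    ∃ x y, x * r - q * y * (q * ι (-(g' * N₁ * c * star α))) = 1 ∧
      F x (q * y) (q * ι (-(g' * N₁ * c * star α))) r = hF.upper
        (ι ((1 - (1 + τ) * α ^ 2) * (star α * star c))) := by
  have hα : ι α * ι (star α) = N := by rw [← map_mul, Quad.mul_star_self, hN, map_intCast]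
  have hc : ι c * ι (star c) = N₁ := by rw [← map_mul, Quad.mul_star_self, hN₁, map_intCast]
  have hτ' : (τ : A) = ι α * (g * ι c) * (ι (star α) * ι (star c)) := by
    rw [hτ]; push_cast; linear_combination (-g * (N₁ : A)) * hα - g * ι α * ι (star α) * hc
  have hr' : (r : A) = 1 + τ + τ ^ 2 + τ ^ 3 + k * (q * g ^ 2 * N * N₁ ^ 2) := by
    rw [hr]; push_cast; ring
  have hg' : (q * g' : A) = g ^ 2 := by exact_mod_cast congrArg (Int.cast : ℤ → A) hg
  have e1 := hF.parabolic (j := ι α) (c := g * ι c) (ι (star α) * ι (star c))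
    (by simpa using hcop.map ι)
  simp only [← hτ'] at e1
  have hdet : (1 - (τ : A)) * (1 + τ) - ι α ^ 2 * (ι (star α) * ι (star c)) *
    (-((g * ι c) ^ 2 * (ι (star α) * ι (star c)))) = 1 := by
    linear_combination (ι α * (g * ι c) * (ι (star α) * ι (star c)) + τ) * (-hτ')
  set z := -(g' * N₁ * ι c * ι (star α)) with hz
  have hqz : q * z = -((g * ι c) ^ 2 * (ι (star α) * ι (star c))) := by
    rw [hz]
    linear_combination -N₁ * ι c * ι (star α) * hg' + g ^ 2 * ι c * ι (star α) * hc
  rw [← hqz] at e1 hdet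
  set j := - (ι α ^ 2 * (ι (star α) * ι (star c)) * (1 + τ)) with hj
  have hqb : q * (g' * ι c ^ 2 * ι α ^ 4 * (ι (star α) * ι (star c)) ^ 3) = ι α ^ 2 *
    (ι (star α) * ι (star c)) + j * (1 - τ) := by
    rw [hj]
    linear_combination ι c ^ 2 * ι α ^ 4 * (ι (star α) * ι (star c)) ^ 3 * hg' -
      ι α ^ 2 * (ι (star α) * ι (star c)) * (ι α * (g * ι c) * (ι (star α) * ι (star c)) + τ) * hτ'
  have hd1 : (1 + τ + τ ^ 2 + τ ^ 3 : A) = 1 + τ + j * (q * z) := by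
    rw [hj, hqz]
    linear_combination (1 + τ) * (ι α * (g * ι c) * (ι (star α) * ι (star c)) + τ) * hτ'
  have hdet1 : (1 - (τ : A)) * (1 + τ + τ ^ 2 + τ ^ 3) - q *
    (g' * ι c ^ 2 * ι α ^ 4 * (ι (star α) * ι (star c)) ^ 3) * (q * z) = 1 := by
    rw [hqb, hd1]; linear_combination hdet
  have e2 := hF.mul_upper (b' := q * (g' * ι c ^ 2 * ι α ^ 4 * (ι (star α) * ι (star c)) ^ 3))
    (d' := 1 + τ + τ ^ 2 + τ ^ 3) j hdet
    hqb hd1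
  set j' := -(k * ι α * ι (star c)) with hj'
  have hd2 : (r : A) = 1 + τ + τ ^ 2 + τ ^ 3 + q * j' * (q * z) := by
    rw [hr', hqz, hj']
    linear_combination (-k * q * g ^ 2 * N₁ ^ 2) * hα -
      k * q * g ^ 2 * ι α * ι (star α) * (ι c * ι (star c) + N₁) * hc
  have e3 := hF.mul_upper (b' := q * (g' * ι c ^ 2 * ι α ^ 4 * (ι (star α) * ι (star c)) ^ 3 + j' *
    (1 - τ))) (d' := r) (q * j') hdet1
    (by ring) hd2
  have hz' : ι (-(g' * N₁ * c * star α)) = z := by rw [hz]; simp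
  rw [hz']
  refine ⟨1 - τ, g' * ι c ^ 2 * ι α ^ 4 * (ι (star α) * ι (star c)) ^ 3 + j' * (1 - τ), ?_, ?_⟩
  · rw [hd2]; linear_combination hdet1
  · rw [e3, e2, e1, h0, add_zero, ← map_add, hj]
    congr 1
    simp
    ring

end Ctx

theorem isCoprime_geom (τ : ℤ) {m : ℤ} {n : ℕ} (h : m ∣ τ ^ n) :
    IsCoprime (1 + τ + τ ^ 2 + τ ^ 3) m := by
  have : IsCoprime (1 + τ + τ ^ 2 + τ ^ 3) τ := ⟨1, -(1 + τ + τ ^ 2), by ring⟩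
  exact IsCoprime.of_isCoprime_of_dvd_right this.pow_right h

theorem Quad.isCoprime_star {a b : ℤ} {α : Quad a b} (h : IsCoprime (𝐍 α) (α + star α).re) :
    IsCoprime α (star α) := by
  have h1 : ((((α + star α).re : ℤ)) : Quad a b) = α + star α := by
    ext <;> simp
  have h2 := (h.map (Int.castRingHom (Quad a b)))
  simp only [eq_intCast] at h2
  rw [h1, ← Quad.mul_star_self] at h2
  obtain ⟨u, v, huv⟩ := h2
  exact ⟨u * star α + v, v, by linear_combination huv⟩

namespace Ctx

variable {a b : ℤ} {A : Type*} [CommRing A] {ι : Quad a b →+* A} {π : Quad a b} (hc : Ctx ι π)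
  [IsDomain A] {C : Type*} [AddCommGroup C] {F : A → A → A → A → C} (hF : IsHom F)
  {l : ℕ} (hC : TorsionAt l C)

include hc hF hC

theorem upper_relation_three (hl3 : l = 3) (h0 : ∀ t, hF.upper (3 * t) = 0) {M g : ℤ} (hM : M ≠ 0)
    (hMo : Odd M) (hM3 : ¬ 3 ∣ M) (hg : IsCoprime g M)
    (hI : ∀ r : ℕ, r.Prime → r ≡ 5 [ZMOD 8] → r ≡ 1 [ZMOD 3] → r ≡ g [ZMOD M] →
      Inert (b ^ 2 + 4 * a) r)
    {α c : Quad a b} (hcop : IsCoprime α (3 * c)) {N N₁ : ℤ} (hN : 𝐍 α = N) (hN₁ : 𝐍 c = N₁)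
    (hN0 : N ≠ 0) (hN₁0 : N₁ ≠ 0) (ho : Odd N) (ho₁ : Odd N₁) (hNM : IsCoprime N M)
      (hN₁M : IsCoprime N₁ M) :
    hF.upper (ι ((1 - (1 + ((3 * N * N₁ : ℤ) : Quad a b)) * α ^ 2) * (star α * star c))) = 0 := by
  obtain ⟨B, hB⟩ := eventually_atTop.mp (hc.good_three hF hC hl3 h0)
  obtain ⟨w, hw, h'⟩ := exists_residue_mul (M := 8) (g := 5) (by norm_num) hM
    (isCoprime_eight hMo) (isCoprime_eight (by decide)).symm hg
  have c3 : IsCoprime (3 : ℤ) M := isCoprime_natPrime Nat.prime_three (by exact_mod_cast hM3)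
  have cop : IsCoprime (8 * M) (3 * 3 ^ 2 * N * N₁ ^ 2) := by
    have o27 : Odd (3 * 3 ^ 2 * N * N₁ ^ 2) :=
      ((by decide : Odd (3 * 3 ^ 2 : ℤ)).mul ho).mul ho₁.pow
    refine IsCoprime.mul_left (isCoprime_eight o27) ?_
    have c27 : IsCoprime M (3 * 3 ^ 2) := by
      have := c3.symm.pow_right (n := 3)
      norm_num at this ⊢
      exact this
    exact (c27.mul_right hNM.symm).mul_right hN₁M.symm.pow_right
  obtain ⟨r, hrB, hr, h1, h2⟩ := exists_prime_of_crt B (mul_ne_zero (by norm_num) hM)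
    (mul_ne_zero (mul_ne_zero (by norm_num) hN0) (pow_ne_zero 2 hN₁0)) cop hw
    (isCoprime_geom (3 * N * N₁) (m := 3 * 3 ^ 2 * N * N₁ ^ 2) (n := 3) ⟨N ^ 2 * N₁, by ring⟩)
  obtain ⟨e1, e2⟩ := h' r h1
  have e3 : (r : ℤ) ≡ 1 [ZMOD 3] := by
    refine (h2.of_dvd (m := 3) ⟨3 ^ 2 * N * N₁ ^ 2, by ring⟩).trans ?_
    exact (Int.modEq_iff_dvd.mpr ⟨N * N₁ * (1 + 3 * N * N₁ + (3 * N * N₁) ^ 2), by ring⟩ :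
      (1 : ℤ) ≡ _ [ZMOD 3]).symm
  obtain ⟨k, hk⟩ := h2.symm.dvd
  have hrI := hI r hr e1 e3 e2
  obtain ⟨x, y, hd, he⟩ := upper_relation hF (q := 3) (g := 3) (g' := 3) (by norm_num)
    (by simpa using h0)
    (by exact_mod_cast hcop) hN hN₁ rfl (r := r) (k := k) (by linear_combination hk)
  rw [← he]
  rw [Int.cast_natCast] at hd ⊢
  exact (hB r hrB.le hrI e3).eq_zero_of_odd (hC 2 (by subst hl3; norm_num)) hd

theorem upper_relation_two (hl2 : l = 2) (h0 : ∀ t, hF.upper (8 * t) = 0) {M g : ℤ} (hM : M ≠ 0)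
    (hMo : Odd M) (hg : IsCoprime g M)
    (hI : ∀ r : ℕ, r.Prime → r ≡ 5 [ZMOD 8] → r ≡ g [ZMOD M] → Inert (b ^ 2 + 4 * a) r)
    {α c : Quad a b} (hcop : IsCoprime α (4 * c)) {N N₁ : ℕ} (hN : 𝐍 α = N) (hN₁ : 𝐍 c = N₁)
    (hs : N₁ = 1 ∨ N₁ = N) (ho : Odd N) (hNM : IsCoprime (N : ℤ) M) :
    hF.upper (ι ((1 - (1 + ((4 * N * N₁ : ℤ) : Quad a b)) * α ^ 2) * (star α * star c))) = 0 := by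
  obtain ⟨B, hB⟩ := eventually_atTop.mp (hc.good_eight hF hC hl2 h0)
  have ho₁ : Odd N₁ := by rcases hs with rfl | rfl <;> [decide; exact ho]
  have hN₁M : IsCoprime (N₁ : ℤ) M := by
    rcases hs with rfl | rfl <;> [simpa using isCoprime_one_left; exact hNM]
  have hN0 : (N : ℤ) ≠ 0 := by rintro h; simp [Int.natCast_eq_zero.mp h] at ho
  have hN₁0 : (N₁ : ℤ) ≠ 0 := by rintro h; simp [Int.natCast_eq_zero.mp h] at ho₁
  have cop : IsCoprime M (8 * 4 ^ 2 * N * N₁ ^ 2) := by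
    have c8 : IsCoprime M (8 * 4 ^ 2) := by
      have : IsCoprime (2 : ℤ) _ := Int.isCoprime_two_left.mpr hMo
      have := this.symm.pow_right (n := 7)
      norm_num at this ⊢
      exact this
    exact (c8.mul_right hNM.symm).mul_right hN₁M.symm.pow_right
  obtain ⟨r, hrB, hr, h1, h2⟩ := exists_prime_of_crt B hM
    (mul_ne_zero (mul_ne_zero (by norm_num) hN0) (pow_ne_zero 2 hN₁0)) cop hg
    (isCoprime_geom (4 * N * N₁) (m := 8 * 4 ^ 2 * N * N₁ ^ 2) (n := 4)
      ⟨2 * N ^ 3 * N₁ ^ 2, by ring⟩)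
  have e3 : (r : ℤ) ≡ 5 [ZMOD 8] := by
    refine (h2.of_dvd (m := 8) ⟨4 ^ 2 * N * N₁ ^ 2, by ring⟩).trans ?_
    obtain ⟨k, hk⟩ : Odd (N * N₁ : ℤ) := by exact_mod_cast ho.mul ho₁
    have : (4 * N * N₁ : ℤ) = 4 + 8 * k := by linear_combination 4 * hk
    rw [this]
    exact (Int.modEq_iff_dvd.mpr ⟨k + 2 * (1 + 2 * k) ^ 2 + 8 * (1 + 2 * k) ^ 3, by ring⟩ :
      (5 : ℤ) ≡ _ [ZMOD 8]).symm
  have e1 : (r : ℤ) ≡ 1 [ZMOD N] := by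
    refine (h2.of_dvd (m := N) ⟨8 * 4 ^ 2 * N₁ ^ 2, by ring⟩).trans ?_
    exact (Int.modEq_iff_dvd.mpr ⟨4 * N₁ * (1 + 4 * N * N₁ + (4 * N * N₁) ^ 2), by ring⟩ :
      (1 : ℤ) ≡ _ [ZMOD N]).symm
  obtain ⟨k, hk⟩ := h2.symm.dvd
  have hrI := hI r hr e3 h1
  have h8 : (r : ℤ) % 8 = 5 := e3
  obtain ⟨x, y, hd, he⟩ := upper_relation hF (q := 8) (g := 4) (g' := 2) (by norm_num)
    (by simpa using h0)
    (by exact_mod_cast hcop) hN hN₁ rfl (r := r) (k := k) (by linear_combination hk)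
  rw [← he]
  rw [Int.cast_natCast r] at hd ⊢
  refine (hB r hrB.le hrI (show (r : ℤ) % 4 = 1 % 4 by omega)).eq_zero_of_norm hrI hd ?_
  have hNr : jacobiSym N r = 1 := by
    rw [← jacobiSym.quadratic_reciprocity_one_mod_four (by omega) ho, jacobiSym.mod_left' e1,
      jacobiSym.one_left]
  have hN₁r : jacobiSym N₁ r = 1 := by
    rcases hs with rfl | rfl <;> [simp; exact hNr]
  have h2r : jacobiSym (2 ^ 2) r = 1 := jacobiSym.sq_one' (by
    have := (Nat.coprime_primes Nat.prime_two hr).mpr (by omega)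
    simpa [Int.gcd] using this)
  have hz : 𝐍 (-(((2 : ℤ) : Quad a b) * ((N₁ : ℤ) : Quad a b) * c * star α)) =
    2 ^ 2 * N₁ * N₁ * N₁ * N := by
    rw [QuadraticAlgebra.norm_neg, map_mul, map_mul, map_mul, QuadraticAlgebra.norm_star, hN, hN₁,
      QuadraticAlgebra.norm_intCast, QuadraticAlgebra.norm_intCast, Int.cast_id, Int.cast_id]
    ring
  rw [hz]
  simp only [jacobiSym.mul_left, hNr, hN₁r, h2r, mul_one]

omit [IsDomain A] in
/-- The consequence for elementary matrices of a pair of relations. -/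
theorem upper_eta [Nontrivial A] {q g : ℤ} (hq : q ≠ 0) (h0 : ∀ t, hF.upper (q * t) = 0)
    {α : Quad a b} {N : ℤ} (hN : 𝐍 α = N)
    (hNl : IsCoprime N l) (hy : IsCoprime α.im l) (hqg : q ∣ g * N - g) (hqg' : q ∣ g * N * N - g)
    (h1 : hF.upper (ι ((1 - (1 + ((g * N : ℤ) : Quad a b)) * α ^ 2) * star α)) = 0)
    (h2 : hF.upper (ι ((1 - (1 + ((g * N * N : ℤ) : Quad a b)) * α ^ 2) * (star α * α))) = 0)
      (t : A) :
    hF.upper (ι (1 - (1 + (g : Quad a b)) * α ^ 2) * t) = 0 := by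
  obtain ⟨k, hk⟩ := hqg
  obtain ⟨k', hk'⟩ := hqg'
  set η := 1 - (1 + (g : Quad a b)) * α ^ 2 with hη
  have hk1 : ((g : ℤ) : Quad a b) * ((N : ℤ) : Quad a b) - (g : Quad a b) = (q : Quad a b) *
    (k : Quad a b) := by
    exact_mod_cast congrArg (Int.cast : ℤ → Quad a b) hk
  have hk1' : ((g : ℤ) : Quad a b) * ((N : ℤ) : Quad a b) * ((N : ℤ) : Quad a b) - (g : Quad a b) =
    (q : Quad a b) * (k' : Quad a b) := by
    exact_mod_cast congrArg (Int.cast : ℤ → Quad a b) hk'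
  have e1 : hF.upper (ι (η * star α)) = 0 := by
    rw [← h1]
    have : ι (η * star α) = ι ((1 - (1 + ((g * N : ℤ) : Quad a b)) * α ^ 2) * star α) + (q : A) * ι
      (k * α ^ 2 * star α) := by
      rw [← map_intCast ι, ← map_mul, ← map_add, hη]
      congr 1
      push_cast
      linear_combination (α ^ 2 * star α) * hk1
    rw [this, map_add, h0, add_zero]
  have e2 : hF.upper (ι η) = 0 := by
    refine hC.zsmul hNl ?_
    rw [← hF.upper_zsmul, ← map_intCast ι, ← map_mul, ← h2]
    have : ι (((N : ℤ) : Quad a b) * η) = ι ((1 - (1 + ((g * N * N : ℤ) : Quad a b)) * α ^ 2) *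
      (star α * α)) +
        (q : A) * ι (k' * α ^ 2 * ((N : ℤ) : Quad a b)) := by
      rw [← map_intCast ι, ← map_mul, ← map_add, hη]
      congr 1
      have h3 := Quad.mul_star_self α
      rw [hN] at h3
      push_cast
      linear_combination (α ^ 2 * ((N : ℤ) : Quad a b)) * hk1' -
        (1 - (1 + ((g : ℤ) : Quad a b) * ((N : ℤ) : Quad a b) * ((N : ℤ) : Quad a b)) * α ^ 2) * h3
    rw [this, map_add, h0, add_zero]
  have e3 : hF.upper (ι (η * ⟨0, 1⟩)) = 0 := by
    refine hC.zsmul hy ?_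
    have : (α.im : A) * ι (η * ⟨0, 1⟩) = (((star α).re : ℤ) : A) * ι η - ι (η * star α) := by
      rw [← map_intCast ι, ← map_intCast ι, ← map_mul, ← map_mul, ← map_sub]
      congr 1
      have h3 := Quad.eq_add_mul (star α)
      have h4 : (star α).im = - α.im := by simp
      rw [h4, Int.cast_neg] at h3
      linear_combination η * h3
    rw [← hF.upper_zsmul, this, map_sub, hF.upper_zsmul, e1, e2, smul_zero, sub_zero]
  obtain ⟨y, s, hs⟩ := hc.exists_rep hq t
  have : ι η * t = (y.re : A) * ι η + (y.im : A) * ι (η * ⟨0, 1⟩) + q * (ι η * s) := by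
    rw [eq_add_of_sub_eq hs]
    conv_lhs => rw [Quad.eq_add_mul y]
    simp only [map_add, map_mul, map_intCast]
    ring
  rw [this, map_add, map_add, hF.upper_zsmul, hF.upper_zsmul, h0, e2, e3, smul_zero, smul_zero,
    add_zero, add_zero]

end Ctx

namespace Quad

theorem isCoprime_of_norm {a b : ℤ} {α : Quad a b} {n : ℤ} (h : IsCoprime (𝐍 α) n) :
    IsCoprime α (n : Quad a b) := by
  have h2 := h.map (Int.castRingHom (Quad a b))
  simp only [eq_intCast] at h2
  exact IsCoprime.of_isCoprime_of_dvd_left h2 (dvd_norm α)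

/-- The square root `√-d` of a negative integer in the maximal order. -/
def root {a : ℤ} (b : ℤ) : Quad a b := ⟨-b, b + 1⟩

theorem root_sq {a b : ℤ} {d : ℕ} (h : IsMaximal a b d) :
    (root b : Quad a b) ^ 2 = ((-d : ℤ) : Quad a b) := by
  rw [pow_two]
  rcases h with ⟨rfl, rfl, -⟩ | ⟨rfl, h⟩
  · ext <;> simp [root]
  · rw [← h]
    ext <;> simp [root]
    ring

theorem norm_add_root {a b : ℤ} {d : ℕ} (h : IsMaximal a b d) (m : ℤ) :
    𝐍 ((m : Quad a b) + root b) = m ^ 2 + d := by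
  rcases h with ⟨rfl, rfl, -⟩ | ⟨rfl, h⟩
  · simp [root, QuadraticAlgebra.norm_def]
    ring
  · rw [← neg_eq_iff_eq_neg.mpr h]
    simp [root, QuadraticAlgebra.norm_def]
    ring

theorem trace_add_root {a b : ℤ} {d : ℕ} (h : IsMaximal a b d) (m : ℤ) :
    (((m : Quad a b) + root b) + star ((m : Quad a b) + root b)).re = 2 * m := by
  rcases h with ⟨rfl, rfl, -⟩ | ⟨rfl, h⟩
  · simp [root]
    ring
  · simp [root]
    ring

theorem isCoprime_add_root {d : ℕ} {m : ℤ} (h : IsCoprime (m ^ 2 + d) d) (ho : Odd (m ^ 2 + d)) :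
    IsCoprime (m ^ 2 + d) (2 * m) := by
  refine IsCoprime.mul_right (Int.isCoprime_two_left.mpr ho).symm ?_
  obtain ⟨u, v, huv⟩ := h
  have : IsCoprime (m ^ 2) (d : ℤ) := ⟨u, u + v, by linear_combination huv⟩
  obtain ⟨x, y, hxy⟩ := (IsCoprime.pow_left_iff two_pos).mp this
  exact ⟨y, x - y * m, by linear_combination hxy⟩

end Quad

namespace Ctx

variable {a b : ℤ} {A : Type*} [CommRing A] {ι : Quad a b →+* A} {π : Quad a b} (hc : Ctx ι π)
  [IsDomain A] {C : Type*} [AddCommGroup C] {F : A → A → A → A → C} (hF : IsHom F)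
  {l : ℕ} (hC : TorsionAt l C)

include hc hF hC

theorem upper_three_eta {d : ℕ} (hd : Squarefree d) (h1 : d ≠ 1) (h3 : d ≠ 3) (hm : IsMaximal a b d)
    (hl3 : l = 3) {α : Quad a b} {N : ℤ} (hN : 𝐍 α = N) (ho : Odd N) (hN3 : IsCoprime N 3)
      (hNd : IsCoprime N d)
    (htr : IsCoprime N (α + star α).re) (him : IsCoprime α.im 3) (t : A) :
    hF.upper (ι (1 - (1 + ((3 : ℤ) : Quad a b)) * α ^ 2) * t) = 0 := by
  have h0 := hc.upper_three_mul hF hC hd h1 h3 hm hl3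
  have hN0 : N ≠ 0 := by rintro rfl; simp at ho
  obtain ⟨M, g, hM, hMo, hM3, hg, hMd, hI⟩ := exists_inert_class₃ hd h1 h3
  have hI' := fun r hr e1 e2 e3 => hm.inert (r := r) hr (hI r e1 e2 e3)
  have hNM := IsCoprime.of_isCoprime_of_dvd_right hNd hMd
  have c3 : IsCoprime α 3 := by
    exact_mod_cast Quad.isCoprime_of_norm (n := 3) (by rw [hN]; exact hN3)
  have cs := Quad.isCoprime_star (α := α) (hN.symm ▸ htr)
  refine hc.upper_eta hF hC (q := 3) (by norm_num) (by simpa using h0) hN (by simpa [hl3] using hN3)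
    (by simpa [hl3] using him) ⟨N - 1, by ring⟩ ⟨N * N - 1, by ring⟩ ?_ ?_ t
  · simpa using hc.upper_relation_three hF hC hl3 h0 hM hMo hM3 hg hI' (α := α) (c := 1)
      (by simpa using c3)
      hN (map_one _) hN0 one_ne_zero ho odd_one hNM isCoprime_one_left
  · simpa using hc.upper_relation_three hF hC hl3 h0 hM hMo hM3 hg hI' (α := α) (c := star α)
      (c3.mul_right cs)
      hN ((QuadraticAlgebra.norm_star α).trans hN) hN0 hN0 ho ho hNM hNM

theorem upper_two_eta {d : ℕ} (hd : Squarefree d) (h1 : d ≠ 1) (hm : IsMaximal a b d)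
    (hl2 : l = 2) {α : Quad a b} {N : ℕ} (hN : 𝐍 α = N) (ho : Odd N) (hNd : IsCoprime (N : ℤ) d)
    (htr : IsCoprime (N : ℤ) (α + star α).re) (him : Odd α.im) (t : A) :
    hF.upper (ι (1 - (1 + ((4 : ℤ) : Quad a b)) * α ^ 2) * t) = 0 := by
  have h0 := hc.upper_eight_mul hF hC hd h1 hm hl2
  have ho' : Odd (N : ℤ) := by exact_mod_cast ho
  have hN2 : IsCoprime (N : ℤ) 2 := (Int.isCoprime_two_left.mpr ho').symm
  obtain ⟨M, g, hM, hMo, hg, hMd, hI⟩ := exists_inert_class hd h1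
  have hI' := fun r hr e1 e2 => hm.inert (r := r) hr (hI r e1 e2)
  have hNM := IsCoprime.of_isCoprime_of_dvd_right hNd hMd
  have c4 : IsCoprime α 4 := by
    have : IsCoprime (N : ℤ) 4 := by simpa using hN2.pow_right (n := 2)
    exact_mod_cast Quad.isCoprime_of_norm (n := 4) (by rw [hN]; exact this)
  have cs := Quad.isCoprime_star (α := α) (hN.symm ▸ htr)
  obtain ⟨k, hk⟩ := ho'
  refine hc.upper_eta hF hC (q := 8) (by norm_num) (by simpa using h0) hN (by simpa [hl2] using hN2)
    (by simpa [hl2] using (Int.isCoprime_two_left.mpr him).symm) ⟨k, by rw [hk]; ring⟩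
    ⟨2 * k * (k + 1), by rw [hk]; ring⟩ ?_ ?_ t
  · simpa using hc.upper_relation_two hF hC hl2 h0 hM hMo hg hI' (α := α) (c := 1) (N := N)
      (N₁ := 1) (by simpa using c4)
      hN (map_one _) (Or.inl rfl) ho hNM
  · simpa using hc.upper_relation_two hF hC hl2 h0 hM hMo hg hI' (α := α) (c := star α) (N := N)
      (N₁ := N) (c4.mul_right cs)
      hN ((QuadraticAlgebra.norm_star α).trans hN) (Or.inr rfl) ho hNM

theorem upper_three_inert {d : ℕ} (hd : Squarefree d) (h1 : d ≠ 1) (hm : IsMaximal a b d)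
    (hl3 : l = 3) (hd3 : d % 3 = 1) (t : A) : hF.upper t = 0 := by
  have h3 : d ≠ 3 := by rintro rfl; simp at hd3
  obtain ⟨m, hmo, hm3⟩ : ∃ m : ℤ, Odd (m ^ 2 + d) ∧ (m = 3 ∨ m = 6) := by
    rcases Nat.even_or_odd' d with ⟨k, rfl | rfl⟩
    · exact ⟨3, by rw [Int.odd_iff]; omega, Or.inl rfl⟩
    · exact ⟨6, by rw [Int.odd_iff]; omega, Or.inr rfl⟩
  have cd3 : IsCoprime (3 : ℤ) d := isCoprime_natPrime Nat.prime_three (by omega)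
  have hmd : IsCoprime (m ^ 2 + d) (d : ℤ) := by
    suffices IsCoprime m d by
      obtain ⟨u, v, huv⟩ := this.pow_left (m := 2)
      exact ⟨u, v - u, by linear_combination huv⟩
    rcases hm3 with rfl | rfl
    · exact cd3
    · have : Odd (d : ℤ) := by rw [Int.odd_iff] at hmo ⊢; omega
      have := (Int.isCoprime_two_left.mpr this).mul_left cd3
      simpa using this
  obtain ⟨k, rfl⟩ : ∃ k, m = 3 * k := by
    rcases hm3 with rfl | rfl <;> [exact ⟨1, rfl⟩; exact ⟨2, rfl⟩]
  have e := hc.upper_three_eta hF hC hd h1 h3 hm hl3 (Quad.norm_add_root hm (3 * k)) hmo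
    (isCoprime_natPrime Nat.prime_three (by push_cast; intro h; have := (Int.dvd_add_right (⟨3 * k ^ 2, by ring⟩ : (3 : ℤ) ∣ (3 * k) ^ 2)).mp h; omega)).symm hmd
    ((Quad.trace_add_root hm (3 * k)).symm ▸ Quad.isCoprime_add_root hmd hmo)
    (by rcases hm with ⟨rfl, -⟩ | ⟨rfl, -⟩ <;> simp [Quad.root] <;> decide)
  have h0 := hc.upper_three_mul hF hC hd h1 h3 hm hl3
  obtain ⟨j, hj⟩ : ∃ j : ℤ, (d : ℤ) = 1 + 3 * j := ⟨d / 3, by omega⟩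
  have e' := e (-t)
  have : ι (1 - (1 + ((3 : ℤ) : Quad a b)) * (((3 * k : ℤ) : Quad a b) + Quad.root b) ^ 2) * (-t) =
      t + 3 * ((-2 - 4 * j + 4 * (3 * k ^ 2 + 2 * k * ι (Quad.root b))) * t) := by
    have h4 := Quad.root_sq hm
    have h5 : ((1 : Quad a b) - (1 + ((3 : ℤ) : Quad a b)) *
      (((3 * k : ℤ) : Quad a b) + Quad.root b) ^ 2) =
      -(1 + 3 * (-2 - 4 * (j : Quad a b) + 4 *
        (3 * (k : Quad a b) ^ 2 + 2 * (k : Quad a b) * Quad.root b))) := by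
      rw [hj] at h4
      push_cast at h4 ⊢
      linear_combination -4 * h4
    rw [h5]
    simp only [map_add, map_sub, map_mul, map_neg, map_intCast, map_one, map_ofNat, map_pow]
    ring
  rw [this, map_add, h0, add_zero] at e'
  exact e'

theorem upper_three_ramified {d : ℕ} (hd : Squarefree d) (h3 : d ≠ 3) (hm : IsMaximal a b d)
    (hl3 : l = 3) (hd3 : d % 3 = 0) (t : A) : hF.upper (ι (Quad.root b) * t) = 0 := by
  have h1 : d ≠ 1 := by rintro rfl; simp at hd3
  obtain ⟨m, hmo, hm3⟩ : ∃ m : ℤ, Odd (m ^ 2 + d) ∧ (m = 2 ∨ m = 1) := by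
    rcases Nat.even_or_odd' d with ⟨k, rfl | rfl⟩
    · exact ⟨1, by rw [Int.odd_iff]; omega, Or.inr rfl⟩
    · exact ⟨2, by rw [Int.odd_iff]; omega, Or.inl rfl⟩
  have hmd : IsCoprime (m ^ 2 + d) (d : ℤ) := by
    suffices IsCoprime m d by
      obtain ⟨u, v, huv⟩ := this.pow_left (m := 2)
      exact ⟨u, v - u, by linear_combination huv⟩
    rcases hm3 with rfl | rfl
    · have : Odd (d : ℤ) := by rw [Int.odd_iff] at hmo ⊢; omega
      exact Int.isCoprime_two_left.mpr this
    · exact isCoprime_one_left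
  have e := hc.upper_three_eta hF hC hd h1 h3 hm hl3 (Quad.norm_add_root hm m) hmo
    (isCoprime_natPrime Nat.prime_three (by rcases hm3 with rfl | rfl <;> omega)).symm hmd
    ((Quad.trace_add_root hm m).symm ▸ Quad.isCoprime_add_root hmd hmo)
    (by rcases hm with ⟨rfl, -⟩ | ⟨rfl, -⟩ <;> simp [Quad.root] <;> decide)
  have h0 := hc.upper_three_mul hF hC hd h1 h3 hm hl3
  obtain ⟨j, hj⟩ : ∃ j : ℤ, (d : ℤ) = 3 * j := ⟨d / 3, by omega⟩
  obtain ⟨i, hi⟩ : ∃ i : ℤ, m ^ 2 = 1 + 3 * i := by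
    rcases hm3 with rfl | rfl <;> [exact ⟨1, rfl⟩; exact ⟨0, rfl⟩]
  have e' := e (m * t)
  have : ι (1 - (1 + ((3 : ℤ) : Quad a b)) * (((m : ℤ) : Quad a b) + Quad.root b) ^ 2) * (m * t) =
      ι (Quad.root b) * t + 3 * ((-(1 + 4 * i) * m + 4 * j * m - ι (Quad.root b) *
        (3 + 8 * i)) * t) := by
    have h4 := Quad.root_sq hm
    have h6 : ((m : ℤ) : Quad a b) ^ 2 = 1 + 3 * (i : Quad a b) := by
      exact_mod_cast congrArg (Int.cast : ℤ → Quad a b) hi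
    have h7 : (m : A) ^ 2 = 1 + 3 * (i : A) := by exact_mod_cast congrArg (Int.cast : ℤ → A) hi
    have h5 : ((1 : Quad a b) - (1 + ((3 : ℤ) : Quad a b)) *
      (((m : ℤ) : Quad a b) + Quad.root b) ^ 2) =
       -3 * (1 + 4 * (i : Quad a b)) + 12 * (j : Quad a b) - 8 * (m : Quad a b) * Quad.root b := by
      rw [hj] at h4
      push_cast at h4 ⊢
      linear_combination -4 * h4 - 4 * h6
    rw [h5]
    simp only [map_add, map_sub, map_mul, map_neg, map_intCast, map_one, map_ofNat]
    linear_combination (-8 * ι (Quad.root b) * t) * h7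
  rw [this, map_add, h0, add_zero] at e'
  exact e'

omit [IsDomain A] hc in
theorem upper_eq_zero_of_norm {c : A} {η : Quad a b} (hη : IsCoprime (𝐍 η) l)
    (h : ∀ t, hF.upper (c * (ι η * t)) = 0) (t : A) : hF.upper (c * t) = 0 := by
  refine hC.zsmul hη ?_
  rw [← hF.upper_zsmul, ← h (ι (star η) * t), ← map_intCast ι, ← Quad.mul_star_self, map_mul ι]
  congr 1
  ring

theorem upper_two_inert {d : ℕ} (hd : Squarefree d) (hm : IsMaximal a b d)
    (hl2 : l = 2) (hd8 : d % 8 = 3) (t : A) : hF.upper t = 0 := by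
  have h1 : d ≠ 1 := by rintro rfl; simp at hd8
  have h0 := hc.upper_eight_mul hF hC hd h1 hm hl2
  rcases hm with ⟨-, -, h⟩ | ⟨rfl, h⟩
  · omega
  obtain ⟨N, hN⟩ : ∃ N : ℕ, -a = N := ⟨(-a).toNat, by omega⟩
  have e := hc.upper_two_eta hF hC hd h1 (Or.inr ⟨rfl, h⟩) hl2 (α := ⟨0, 1⟩) (N := N)
    (by simp [QuadraticAlgebra.norm_def, hN])
    (by rw [Nat.odd_iff]; omega) ⟨4, -1, by omega⟩ (by simpa using isCoprime_one_right) (by simp)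
  have hη : (1 - (1 + ((4 : ℤ) : Quad a 1)) * ⟨0, 1⟩ ^ 2) = (⟨1 - 5 * a, -5⟩ : Quad a 1) := by
    rw [pow_two]
    ext <;> simp
  rw [hη] at e
  have := upper_eq_zero_of_norm hF hC (c := 1) (η := (⟨1 - 5 * a, -5⟩ : Quad a 1)) (ι := ι) ?_
    (by simpa using e) t
  · simpa using this
  subst hl2
  refine (Int.isCoprime_two_left.mpr ?_).symm
  obtain ⟨k, hk⟩ : ∃ k, a = 2 * k + 1 := ⟨a / 2, by omega⟩
  refine ⟨50 * k ^ 2 + 40 * k + 5, ?_⟩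
  rw [QuadraticAlgebra.norm_def, hk]
  ring

theorem upper_two_ramified {d : ℕ} (hd : Squarefree d) (h1 : d ≠ 1) (hm : IsMaximal a b d)
    (hl2 : l = 2) (hd4 : d % 4 ≠ 3) (t : A) : hF.upper (2 * t) = 0 := by
  have hb : b = 0 ∧ a = -d := by rcases hm with h | h <;> omega
  obtain ⟨rfl, rfl⟩ := hb
  have hd0 : d % 4 ≠ 0 := fun h => absurd (hd 2 (Nat.dvd_of_mod_eq_zero h)) (by decide)
  obtain ⟨m, x, y, hmo, hm2, hxo, hx, hy⟩ : ∃ m x y : ℤ, Odd (m ^ 2 + d) ∧ (m = 1 ∨ m = 2) ∧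
    Odd (x ^ 2 + d * y ^ 2) ∧
      1 - 5 * (m ^ 2 - d) = 2 * x ∧ -5 * m = y := by
    have : d % 4 = 1 ∨ d % 4 = 2 := by omega
    rcases this with h | h
    · obtain ⟨j, rfl⟩ : ∃ j, d = 4 * j + 1 := ⟨d / 4, by omega⟩
      refine ⟨2, -7 + 10 * j, -10, ⟨2 * j + 2, by push_cast; ring⟩, Or.inr rfl, ?_,
        by push_cast; ring, by ring⟩
      exact ⟨50 * j ^ 2 + 130 * j + 74, by push_cast; ring⟩
    · obtain ⟨j, rfl⟩ : ∃ j, d = 4 * j + 2 := ⟨d / 4, by omega⟩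
      refine ⟨1, 3 + 10 * j, -5, ⟨2 * j + 1, by push_cast; ring⟩, Or.inl rfl, ?_,
        by push_cast; ring, by ring⟩
      exact ⟨50 * j ^ 2 + 80 * j + 29, by push_cast; ring⟩
  have hmd : IsCoprime (m ^ 2 + d) (d : ℤ) := by
    suffices IsCoprime m d by
      obtain ⟨u, v, huv⟩ := this.pow_left (m := 2)
      exact ⟨u, v - u, by linear_combination huv⟩
    rcases hm2 with rfl | rfl
    · exact isCoprime_one_left
    · have : Odd (d : ℤ) := by rw [Int.odd_iff] at hmo ⊢; omega
      exact Int.isCoprime_two_left.mpr this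
  obtain ⟨N, hN⟩ : ∃ N : ℕ, m ^ 2 + d = (N : ℤ) :=
    ⟨(m ^ 2 + d).toNat, by have := sq_nonneg m; omega⟩
  have e := hc.upper_two_eta hF hC hd h1 hm hl2 ((Quad.norm_add_root hm m).trans hN)
    (by rw [hN] at hmo; exact_mod_cast hmo) (by rw [← hN]; exact hmd)
    (by rw [Quad.trace_add_root hm m, ← hN]; exact Quad.isCoprime_add_root hmd hmo)
      (by simp [Quad.root])
  have hη : (1 - (1 + ((4 : ℤ) : Quad (-d) 0)) * ((m : Quad (-d) 0) + Quad.root 0) ^ 2) = 2 *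
    (⟨x, y⟩ : Quad (-d) 0) := by
    rw [pow_two]
    ext
    · simp [Quad.root]
      linear_combination hx
    · simp [Quad.root]
      linear_combination 2 * hy
  rw [hη] at e
  refine upper_eq_zero_of_norm hF hC (η := (⟨x, y⟩ : Quad (-d) 0)) (ι := ι) ?_ (fun t => ?_) t
  · subst hl2
    refine (Int.isCoprime_two_left.mpr ?_).symm
    rw [QuadraticAlgebra.norm_def]
    convert hxo using 1
    ring
  · rw [← e t, map_mul ι, map_ofNat ι, mul_assoc]

end Ctx

theorem exists_modEq {m n : ℤ} (h : IsCoprime m n) (x y : ℤ) : ∃ z, z ≡ x [ZMOD m] ∧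
    z ≡ y [ZMOD n] := by
  obtain ⟨u, v, huv⟩ := h
  refine ⟨x + (y - x) * (u * m), Int.modEq_iff_dvd.mpr ⟨-(y - x) * u, by ring⟩,
    Int.modEq_iff_dvd.mpr ⟨(y - x) * v, by linear_combination (x - y) * huv⟩⟩

theorem exists_sq_add_sym {p : ℕ} (hp : p.Prime) (hp2 : p ≠ 2) {d : ℤ} (hd : ¬ (p : ℤ) ∣ d) :
    ∃ x : ℤ, jacobiSym (x ^ 2 + d) p = -1 := by
  have := Fact.mk hp
  by_contra! hcon
  have hs : ∀ k : ℕ, IsSquare ((k : ZMod p) * d) := by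
    intro k
    induction k with
    | zero => simp
    | succ k ih =>
      obtain ⟨x, hx⟩ := ih
      obtain ⟨n, rfl⟩ := ZMod.intCast_surjective x
      have h1 : ((n ^ 2 + d : ℤ) : ZMod p) = ((k + 1 : ℕ) : ZMod p) * d := by
        push_cast
        linear_combination -hx
      rw [← h1]
      by_contra h2
      exact hcon n (by rw [← jacobiSym.legendreSym.to_jacobiSym]; exact (legendreSym.eq_neg_one_iff p).mpr h2)
  obtain ⟨n, hn⟩ := exists_nonresidue hp hp2
  rw [← jacobiSym.legendreSym.to_jacobiSym, legendreSym.eq_neg_one_iff] at hn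
  apply hn
  have hd0 : (d : ZMod p) ≠ 0 := by rwa [Ne, ZMod.intCast_zmod_eq_zero_iff_dvd]
  have := hs ((n : ZMod p) / d).val
  rwa [ZMod.natCast_zmod_val, div_mul_cancel₀ _ hd0] at this

theorem sym_neg_of_modEq {d r : ℕ} (hd : d % 4 = 3) (hr : r ≡ 1 [ZMOD 4]) (hrd : r ≡ -1 [ZMOD d]) :
    jacobiSym (-d) r = -1 := by
  have hr' : r % 4 = 1 := by
    have : (r : ℤ) % 4 = 1 := hr
    omega
  have hdo : Odd d := Nat.odd_iff.mpr (by omega)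
  rw [sym_neg_mul hr', ← jacobiSym.quadratic_reciprocity_one_mod_four hr' hdo,
    jacobiSym.mod_left' hrd,
    jacobiSym.at_neg_one hdo, ZMod.χ₄_nat_three_mod_four hd]

theorem IsHom.diag_like {A C : Type*} [CommRing A] [AddCommGroup C] {F : A → A → A → A → C}
    (hF : IsHom F)
    (u v : A) : F (u * (2 - u * v)) (u * v - 1) (1 - u * v) v = hF.upper (u + v + u) -
      3 • hF.upper 1 := by
  have e1 := hF.lower_mul (a := 1) (b := u) (c := 0) (d := 1) (c' := -v) (d' := 1 - u * v) (-v)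
    (by ring)
    (by ring) (by ring)
  have e2 := hF.upper_mul (a := 1) (b := u) (c := -v) (d := 1 - u * v) (a' := 1 - u * v)
    (b' := u * (2 - u * v)) u
    (by ring) (by ring) (by ring)
  have e3 := hF.mul' (a := 1 - u * v) (b := u * (2 - u * v)) (c := -v) (d := 1 - u * v) (a' := 0)
    (b' := -1) (c' := 1) (d' := 0)
    (a'' := u * (2 - u * v)) (b'' := u * v - 1) (c'' := 1 - u * v) (d'' := v) (by ring) (by ring)
    (by ring) (by ring) (by ring) (by ring)
  have e4 := hF.inv (a := 0) (b := 1) (c := -1) (d := 0) (by ring)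
  rw [neg_neg, hF.weyl] at e4
  rw [e3, e4, e2, e1, hF.upper_eq]
  simp only [map_add, map_neg]
  abel

namespace Ctx

variable {a b : ℤ} {A : Type*} [CommRing A] {ι : Quad a b →+* A} {π : Quad a b} (hc : Ctx ι π)
  [IsDomain A] {C : Type*} [AddCommGroup C] {F : A → A → A → A → C} (hF : IsHom F)
  {l : ℕ} (hC : TorsionAt l C)

omit hc [IsDomain A] in
include hF in
/-- Replacing the lower right entry by a congruent one. -/
theorem replace_diag {q : ℤ} (h0 : ∀ t, hF.upper (q * t) = 0) {x y z w w' j : A}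
    (hd : x * w - q * y * (q * z) = 1) (hw : w' = w + q * j * (q * z)) :
    ∃ y', x * w' - q * y' * (q * z) = 1 ∧ F x (q * y') (q * z) w' = F x (q * y) (q * z) w := by
  refine ⟨y + j * x, by rw [hw]; linear_combination hd, ?_⟩
  rw [hF.mul_upper (b := q * y) (d := w) (q * j) (by linear_combination hd) (by ring) hw, h0,
    add_zero]

omit hc [IsDomain A] in
include hF in
theorem exists_kappa {d : ℕ} (hm : b = 1 ∧ 4 * a + 1 = -d) (hd8 : d % 8 = 7)
    (h0 : ∀ t, hF.upper (8 * t) = 0)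
    (h4 : 4 • hF.upper 1 = 0) (B : ℕ) :
    ∃ r : ℕ, B < r ∧ r.Prime ∧ r ≡ 1 [ZMOD 8] ∧ r ≡ -1 [ZMOD d] ∧ ∃ z x y,
      x * r - ((8 : ℤ) : A) * y * (((8 : ℤ) : A) * ι z) = 1 ∧ jacobiSym (𝐍 z) r = -1 ∧
      F x (((8 : ℤ) : A) * y) (((8 : ℤ) : A) * ι z) r = 12 • hF.upper (ι ⟨0, 1⟩) := by
  obtain ⟨rfl, ha⟩ := hm
  obtain ⟨k, rfl⟩ : ∃ k, d = 8 * k + 7 := ⟨d / 8, by omega⟩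
  set n : ℤ := (k + 1) * (8 * k + 10) with hn
  set z : Quad a 1 := (n : Quad a 1) * ⟨-1, 2⟩ with hz
  have hNz : 𝐍 z = n ^ 2 * (8 * k + 7 : ℕ) := by
    rw [hz, map_mul, QuadraticAlgebra.norm_intCast, Int.cast_id, QuadraticAlgebra.norm_def]
    push_cast at ha ⊢
    linear_combination (-n ^ 2) * ha
  set D : ℤ := -(((8 * k + 7) ^ 2 + 3 * (8 * k + 7) + 1)) with hD
  have cD : IsCoprime D (64 * 𝐍 z) := by
    rw [hNz]
    have c1 : IsCoprime D (k + 1) := ⟨1, 64 * k + 72, by rw [hD]; ring⟩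
    have c2 : IsCoprime D (8 * k + 10) := ⟨-1, -(8 * k + 7), by rw [hD]; ring⟩
    have c3 : IsCoprime D ((8 * k + 7 : ℕ) : ℤ) := ⟨-1, -(8 * k + 10), by rw [hD]; push_cast; ring⟩
    have c4 : IsCoprime D 2 := ⟨1, 32 * k ^ 2 + 68 * k + 36, by rw [hD]; ring⟩
    have c5 := c4.pow_right (n := 6)
    norm_num at c5
    exact c5.mul_right ((c1.mul_right c2).pow_right.mul_right c3)
  have hNz0 : 64 * 𝐍 z ≠ 0 := by
    rw [hNz, hn]; positivity
  obtain ⟨r, hrB, hr, h1, -⟩ := exists_prime_of_crt B hNz0 one_ne_zero (isCoprime_one_right) cD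
    (isCoprime_one_right (x := 1))
  have hr8 : (r : ℤ) ≡ 1 [ZMOD 8] := by
    refine (h1.of_dvd (m := 8) ⟨8 * 𝐍 z, by ring⟩).trans
      (Int.modEq_iff_dvd.mpr ⟨8 * k ^ 2 + 17 * k + 9, by rw [hD]; ring⟩)
  have hrd : (r : ℤ) ≡ -1 [ZMOD (8 * k + 7 : ℕ)] := by
    refine (h1.of_dvd (m := (8 * k + 7 : ℕ)) ⟨64 * n ^ 2, by rw [hNz]; ring⟩).trans
      (Int.modEq_iff_dvd.mpr ⟨8 * k + 10, by rw [hD]; push_cast; ring⟩)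
  refine ⟨r, hrB, hr, hr8, hrd, z, ?_⟩
  set u : A := ι ⟨-1, 2⟩ with hu
  have hu2 : u ^ 2 = -(8 * k + 7) := by
    have : (⟨-1, 2⟩ : Quad a 1) ^ 2 = ((-(8 * k + 7 : ℕ) : ℤ) : Quad a 1) := by
      rw [← ha, pow_two]
      ext <;> simp
      ring
    rw [hu, ← map_pow, this, map_intCast]
    push_cast
    ring
  have e1 := hF.diag_like u u
  have e2 := hF.mul' (a := u * (2 - u * u)) (b := u * u - 1) (c := 1 - u * u) (d := u)
    (a' := u * (2 - u * u)) (b' := u * u - 1) (c' := 1 - u * u) (d' := u)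
    (a'' := (u * (2 - u * u)) ^ 2 - (1 - u * u) ^ 2) (b'' := -(8 * (n * u))) (c'' := 8 * (n * u))
      (d'' := D)
    (by ring) (by ring) (by ring) 
    (by rw [hn]; push_cast; grind) (by rw [hn]; push_cast; grind) (by rw [hD]; push_cast; grind)
  have hιz : ι z = n * u := by rw [hz, map_mul, map_intCast]
  have hval : (hF.upper (u + u + u) - 3 • hF.upper 1) + (hF.upper (u + u + u) - 3 • hF.upper 1) =
    12 • hF.upper (ι ⟨0, 1⟩) := by
    have : u = 2 * ι ⟨0, 1⟩ - 1 := by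
      rw [hu, ← map_one ι, ← map_ofNat ι 2, ← map_mul, ← map_sub]
      congr 1
      ext <;> simp
    have h2 : hF.upper u = 2 • hF.upper (ι ⟨0, 1⟩) - hF.upper 1 := by
      rw [this, map_sub, ← map_nsmul, nsmul_eq_mul]
      push_cast
      rfl
    rw [map_add, map_add, h2]
    have h12 : 12 • hF.upper 1 = 0 := by rw [show 12 = 3 * 4 by rfl, mul_smul, h4, smul_zero]
    have h5 : ∀ w o : C, 2 • w - o + (2 • w - o) + (2 • w - o) - 3 • o +
      (2 • w - o + (2 • w - o) + (2 • w - o) - 3 • o) =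
      12 • w - 12 • o := by intros; abel
    rw [h5, h12, sub_zero]
  rw [e1, hval] at e2
  obtain ⟨j, hj⟩ := h1.symm.dvd
  have hnz : ι z * ι (star z) = ((𝐍 z : ℤ) : A) := by
    rw [← map_mul, Quad.mul_star_self, map_intCast]
  have hdet : ((u * (2 - u * u)) ^ 2 - (1 - u * u) ^ 2) * (D : A) - ((8 : ℤ) : A) * (-(n * u)) *
    (((8 : ℤ) : A) * ι z) = 1 := by
    rw [hιz, hD, hn]
    push_cast
    grind
  have hrD : (r : A) = D + ((8 : ℤ) : A) * (j * ι (star z)) * (((8 : ℤ) : A) * ι z) := by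
    have := congrArg (Int.cast : ℤ → A) hj
    push_cast at this hnz ⊢
    linear_combination this - 64 * j * hnz
  obtain ⟨y, hy, hy'⟩ := replace_diag (q := 8) hF (by simpa using h0)
    (x := (u * (2 - u * u)) ^ 2 - (1 - u * u) ^ 2)
    (y := -(n * u)) (z := ι z) (w := D) (w' := r) (j := j * ι (star z)) hdet hrD
  refine ⟨_, y, hy, ?_, ?_⟩
  · have hr4 : r % 4 = 1 := by
      have : (r : ℤ) % 8 = 1 := hr8
      omega
    have := sym_neg_of_modEq (d := 8 * k + 7) (r := r) (by omega) (hr8.of_dvd (by norm_num)) hrd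
    rw [sym_neg_mul hr4] at this
    rw [hNz, jacobiSym.mul_left, this, jacobiSym.sq_one', one_mul]
    have c1 := IsCoprime.of_isCoprime_of_dvd_right cD
      (⟨64 * n * (8 * k + 7 : ℕ), by rw [hNz]; ring⟩ : n ∣ 64 * 𝐍 z)
    have c2 := isCoprime_of_modEq (h1.of_dvd (m := n)
      ⟨64 * n * (8 * k + 7 : ℕ), by rw [hNz]; ring⟩) c1
    exact Int.isCoprime_iff_gcd_eq_one.mp c2.symm
  · rw [hy', ← e2, hιz]
    push_cast
    congr 1
    ring

end Ctx

/-- The prime discriminant `s = ±p`. -/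
theorem exists_prime_disc {p : ℕ} (hp : p.Prime) (hp2 : p ≠ 2) : ∃ s : ℤ, (s = p ∨ s = -p) ∧
    s ≡ 1 [ZMOD 4] ∧
    ∀ n : ℕ, n % 4 = 3 → jacobiSym s n = jacobiSym n p := by
  have hpo := hp.odd_of_ne_two hp2
  have : p % 4 = 1 ∨ p % 4 = 3 := by
    have := Nat.odd_iff.mp hpo
    omega
  rcases this with h | h
  · refine ⟨p, Or.inl rfl, show (p : ℤ) % 4 = 1 % 4 by omega, fun n hn => ?_⟩
    exact jacobiSym.quadratic_reciprocity_one_mod_four h (Nat.odd_iff.mpr (by omega))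
  · refine ⟨-p, Or.inr rfl, show (-p : ℤ) % 4 = 1 % 4 by omega, fun n hn => ?_⟩
    rw [jacobiSym.neg _ (Nat.odd_iff.mpr (by omega)), ZMod.χ₄_nat_three_mod_four hn,
      jacobiSym.quadratic_reciprocity_three_mod_four h hn]
    ring

theorem IsHom.diag_eq_zero {A C : Type*} [CommRing A] [AddCommGroup C] {F : A → A → A → A → C}
    (hF : IsHom F)
    (h0 : ∀ t, hF.upper (8 * t) = 0) (h4 : 4 • hF.upper 1 = 0) {s : ℤ} (hs : s ≡ 1 [ZMOD 4]) {t : A}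
    (hst : s * t = 1) : F t 0 0 s = 0 := by
  obtain ⟨k, hk⟩ := hs.symm.dvd
  have hsk : (s : A) = 1 + 4 * k := by
    have := congrArg (Int.cast : ℤ → A) hk
    push_cast at this
    linear_combination this
  have e1 : hF.upper (s : A) = hF.upper 1 := by
    rw [← mul_one (s : A), hF.upper_zsmul, show s = k * 4 + 1 by linarith, add_smul, mul_smul]
    have : (4 : ℤ) • hF.upper 1 = 0 := by exact_mod_cast h4
    rw [this, smul_zero, zero_add, one_smul]
  have e2 : hF.upper t = hF.upper 1 := by
    have : t = s + 8 * ((-k - 2 * k ^ 2) * t) := by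
      linear_combination (s : A) * hst - (t * (s + 1 + 4 * k)) * hsk
    rw [this, map_add, h0, add_zero, e1]
  rw [hF.diag_eq (by linear_combination hst), map_add, map_add, e1, e2]
  abel

namespace Ctx

variable {a b : ℤ} {A : Type*} [CommRing A] {ι : Quad a b →+* A}
  [IsDomain A] {C : Type*} [AddCommGroup C] {F : A → A → A → A → C} (hF : IsHom F)

include hF

theorem exists_zero_of_isUnit {d : ℕ} (hm : IsMaximal a b d) (hd8 : d % 8 = 7)
    (h0 : ∀ t, hF.upper (8 * t) = 0)
    (h4 : 4 • hF.upper 1 = 0) {B : ℕ} (hB : ∀ r ≥ B, Inert (b ^ 2 + 4 * a) r → r ≡ 1 [ZMOD 4] →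
      Good F 8 4 r)
    {r : ℕ} (hr : r.Prime) (hr8 : r ≡ 1 [ZMOD 8]) (hrd : r ≡ -1 [ZMOD d]) {p : ℕ} (hp : p.Prime)
      (hp2 : p ≠ 2)
    (hpr : p ≠ r) (hpd : ¬ p ∣ d) (hu : IsUnit (p : A)) :
    ∃ z x y, x * r - ((8 : ℤ) : A) * y * (((8 : ℤ) : A) * ι z) = 1 ∧ jacobiSym (𝐍 z) r = -1 ∧
      F x (((8 : ℤ) : A) * y) (((8 : ℤ) : A) * ι z) r = 0 := by
  have hr8' : r % 8 = 1 := by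
    have : (r : ℤ) % 8 = 1 := hr8
    omega
  have h8 : ∀ {x : ℤ}, Odd x → IsCoprime (64 : ℤ) x := fun hx => by
    have : IsCoprime (2 : ℤ) _ := Int.isCoprime_two_left.mpr hx
    simpa using this.pow_left (m := 6)
  have hdo : Odd (d : ℤ) := by rw [Int.odd_iff]; omega
  have hro : Odd (r : ℤ) := by rw [Int.odd_iff]; omega
  have hrd' : IsCoprime (r : ℤ) d := isCoprime_of_modEq hrd isCoprime_one_left.neg_left
  have hpd' : ¬ (p : ℤ) ∣ d := by exact_mod_cast hpd
  have hpr' : IsCoprime (p : ℤ) r := Nat.isCoprime_iff_coprime.mpr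
    ((Nat.coprime_primes hp hr).mpr hpr)
  have hp2' : IsCoprime (2 : ℤ) p := by
    rw [Int.isCoprime_two_left]
    exact_mod_cast hp.odd_of_ne_two hp2
  obtain ⟨s, hs, hs4, hsn⟩ := exists_prime_disc hp hp2
  obtain ⟨x₀, hx₀⟩ := exists_sq_add_sym hp hp2 hpd'
  obtain ⟨x₁, h1, h2⟩ := exists_modEq ((Int.isCoprime_two_left.mpr hdo).mul_left hrd') 0 1
  obtain ⟨X, h3, h4'⟩ := exists_modEq (m := 2 * r * d) (n := p)
    ((hp2'.mul_left hpr'.symm).mul_left (isCoprime_natPrime hp hpd').symm) x₁ x₀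
  have hX2 : X ≡ 0 [ZMOD 2] := (h3.of_dvd ⟨r * d, by ring⟩).trans (h1.of_dvd ⟨r, rfl⟩)
  have hXr : X ≡ 0 [ZMOD r] := (h3.of_dvd ⟨2 * d, by ring⟩).trans (h1.of_dvd ⟨2, by ring⟩)
  have hXd : X ≡ 1 [ZMOD d] := (h3.of_dvd ⟨2 * r, by ring⟩).trans h2
  obtain ⟨n, hn⟩ : ∃ n : ℕ, X ^ 2 + d = n := ⟨(X ^ 2 + d).toNat, by have := sq_nonneg X; omega⟩
  have hN : 𝐍 (((X : ℤ) : Quad a b) + Quad.root b) = n := (Quad.norm_add_root hm X).trans hn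
  have hn4 : n % 4 = 3 := by
    obtain ⟨k, hk⟩ := hX2.symm.dvd
    have : (n : ℤ) = 4 * k ^ 2 + d := by
      rw [← hn, show X = 2 * k by linarith]; ring
    omega
  have hno : Odd n := Nat.odd_iff.mpr (by omega)
  have hnr : jacobiSym n r = -1 := by
    have e : (n : ℤ) ≡ d [ZMOD r] := by
      rw [← hn]
      simpa using (hXr.pow 2).add_right (d : ℤ)
    rw [jacobiSym.mod_left' e, ← sym_neg_mul (by omega)]
    exact sym_neg_of_modEq (by omega) (hr8.of_dvd (by norm_num)) hrd
  have hnp : jacobiSym n p = -1 := by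
    rw [← hx₀, ← hn]
    exact jacobiSym.mod_left' ((h4'.pow 2).add_right _)
  have hnd : IsCoprime (n : ℤ) d := by
    refine isCoprime_of_modEq (x := 1) ?_ isCoprime_one_left
    rw [← hn]
    simpa using (hXd.pow 2).add (Int.modEq_zero_iff_dvd.mpr (dvd_refl (d : ℤ)))
  have hn0 : (n : ℤ) ≠ 0 := by rintro h; omega
  have cr : IsCoprime (r : ℤ) (64 * n) := (h8 hro).symm.mul_right
    (isCoprime_of_sym hr.ne_zero (by rw [hnr]; norm_num)).symm
  have cs : IsCoprime s (64 * n) := by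
    refine (h8 ?_).symm.mul_right (isCoprime_of_sym (by omega) (by rw [hsn n hn4, hnp]; norm_num))
    have : s % 4 = 1 := hs4
    rw [Int.odd_iff]
    omega
  obtain ⟨r', hrB, hr', e1, e2⟩ := exists_prime_of_crt B (m := 64 * n) (n := d)
    (mul_ne_zero (by norm_num) hn0) (by omega)
    ((h8 hdo).mul_left hnd) (cr.mul_left cs) (isCoprime_one_left.neg_left (x := 1))
  have hr'4 : (r' : ℤ) ≡ 1 [ZMOD 4] := (e1.of_dvd ⟨16 * n, by ring⟩).trans (by
    simpa using (hr8.of_dvd (by norm_num : (4 : ℤ) ∣ 8)).mul hs4)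
  have hrmod4 : r' % 4 = 1 := by
    have : (r' : ℤ) % 4 = 1 := hr'4
    omega
  have hI := hm.inert hr' (sym_neg_of_modEq (by omega) hr'4 e2)
  have hG := hB r' hrB.le hI hr'4
  have hnr' : jacobiSym n r' = 1 := by
    rw [← jacobiSym.quadratic_reciprocity_one_mod_four hrmod4 hno,
      jacobiSym.mod_left' (e1.of_dvd (m := n) ⟨64, by ring⟩), jacobiSym.mul_left, hsn n hn4, hnp,
      jacobiSym.quadratic_reciprocity_one_mod_four (by omega) hno, hnr]
    norm_num
  obtain ⟨t, ht⟩ : ∃ t : A, s * t = 1 := by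
    have : IsUnit (s : A) := by
      rcases hs with rfl | rfl
      · simpa using hu
      · simpa using hu.neg
    exact this.exists_right_inv
  set z : Quad a b := ((X : ℤ) : Quad a b) + Quad.root b with hz
  have hnz : ι z * ι (star z) = n := by
    rw [← map_mul, Quad.mul_star_self, hN, map_intCast, Int.cast_natCast]
  obtain ⟨u, v, huv⟩ := cr
  have huv' : (u : A) * r + v * (64 * n) = 1 := by exact_mod_cast congrArg (Int.cast : ℤ → A) huv
  have hdet : (u : A) * r - ((8 : ℤ) : A) * (-(v * ι (star z))) * (((8 : ℤ) : A) * ι z) = 1 := by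
    push_cast
    linear_combination huv' + 64 * v * hnz
  refine ⟨z, u, -(v * ι (star z)), hdet, by rw [hN, hnr], ?_⟩
  have f1 := hF.mul' (a := u) (b := ((8 : ℤ) : A) * (-(v * ι (star z)))) (c := ((8 : ℤ) : A) * ι z)
    (d := r)
    (a' := t) (b' := 0) (c' := 0) (d' := s) (a'' := u * t)
      (b'' := ((8 : ℤ) : A) * (-(v * ι (star z)) * s))
    (c'' := ((8 : ℤ) : A) * (ι z * t)) (d'' := r * s) hdet (by linear_combination ht) (by ring)
      (by ring) (by ring) (by ring)
  rw [hF.diag_eq_zero h0 h4 hs4 ht, add_zero] at f1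
  have hdet2 : (u * t : A) * (r * s) - ((8 : ℤ) : A) * (-(v * ι (star z)) * s) *
    (((8 : ℤ) : A) * (ι z * t)) = 1 := by
    linear_combination s * t * hdet + ht
  obtain ⟨j, hj⟩ := e1.symm.dvd
  have hw : (r' : A) = r * s + ((8 : ℤ) : A) * (s * ι (star z) * j) *
    (((8 : ℤ) : A) * (ι z * t)) := by
    have := congrArg (Int.cast : ℤ → A) hj
    push_cast at this ⊢
    linear_combination this - 64 * j * hnz - 64 * j * ι z * ι (star z) * ht
  obtain ⟨y', hy, hy'⟩ := replace_diag hF (by simpa using h0) hdet2 hw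
  rw [← f1, ← hy']
  obtain ⟨σ, hσ⟩ := hI.exists_sq_of_norm (by rw [hN, hnr'] : jacobiSym (𝐍 z) r' = 1)
  obtain ⟨i, k, hi⟩ := hG.sqr s
  obtain ⟨k', hk'⟩ := map_dvd ι hσ
  rw [map_sub, map_pow, map_natCast] at hk'
  refine hG.eq_zero_of_sq (s := ι σ * i * t) hy ⟨s * t ^ 2 * k' - ι σ ^ 2 * t ^ 2 * k, ?_⟩
  linear_combination s * t ^ 2 * hk' - ι σ ^ 2 * t ^ 2 * hi - ι z * t * ht

end Ctx

/-- A class of primes modulo a divisor `e` of `d` prime to `p` which, together with a prescribed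
change of the Legendre symbol modulo `p`, consists of primes inert in `ℚ(√-d)`. -/
theorem exists_class_of_sym {d p r : ℕ} (hd : Squarefree d) (hd4 : d % 4 = 3) (hp : p.Prime)
    (hdp : d ≠ p)
    (hrd : r ≡ -1 [ZMOD d]) :
    ∃ e : ℕ, ∃ ρ : ℤ, e ∣ d ∧ ¬ p ∣ e ∧ IsCoprime ρ e ∧
      ∀ r' : ℕ, r' ≡ 1 [ZMOD 4] → jacobiSym r' p = - jacobiSym r p → r' ≡ ρ [ZMOD e] →
        jacobiSym (-d) r' = -1 := by
  by_cases hpd : p ∣ d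
  · obtain ⟨e, rfl⟩ := hpd
    have hpe : ¬ p ∣ e := fun h => hp.not_isUnit (hd p (mul_dvd_mul_left p h))
    have hoo : Odd (p * e) := Nat.odd_iff.mpr (by omega)
    have he := (Nat.odd_mul.mp hoo).2
    obtain ⟨g, hg, hge⟩ := exists_sym_eq_neg_one (hd.of_mul_right) he (by rintro rfl; simp at hdp)
    refine ⟨e, -g, dvd_mul_left _ _, hpe, hg.neg_left, fun r' h4 h5 h6 => ?_⟩
    have h4' : r' % 4 = 1 := by
      have : (r' : ℤ) % 4 = 1 := h4
      omega
    have hre : jacobiSym r p * jacobiSym (-1) e = -1 := by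
      rw [← jacobiSym.mod_left' (hrd.of_dvd (m := e) ⟨p, by push_cast; ring⟩),
        ← jacobiSym.mul_right' _ hp.ne_zero (by rintro rfl; simp at he), jacobiSym.mod_left' hrd]
      rw [jacobiSym.at_neg_one hoo, ZMod.χ₄_nat_three_mod_four hd4]
    have e1 : jacobiSym (-g) e = - jacobiSym (-1) e := by
      rw [show -g = -1 * g by ring, jacobiSym.mul_left, hge]; ring
    rw [sym_neg_mul h4', ← jacobiSym.quadratic_reciprocity_one_mod_four h4' hoo,
      jacobiSym.mul_right' _ hp.ne_zero (by rintro rfl; simp at he), h5, jacobiSym.mod_left' h6, e1,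
        neg_mul_neg, hre]
  · exact ⟨d, -1, dvd_rfl, hpd, isCoprime_one_left.neg_left, fun r' h4 _ h6 =>
      sym_neg_of_modEq hd4 h4 h6⟩

namespace Ctx

variable {a b : ℤ} {A : Type*} [CommRing A] {ι : Quad a b →+* A}
  [IsDomain A] {C : Type*} [AddCommGroup C] {F : A → A → A → A → C} (hF : IsHom F)

include hF

theorem exists_zero_of_dvd {d : ℕ} (hd : Squarefree d) (hm : IsMaximal a b d) (hd8 : d % 8 = 7)
    (h0 : ∀ t, hF.upper (8 * t) = 0) {B : ℕ}
    (hB : ∀ r ≥ B, Inert (b ^ 2 + 4 * a) r → r ≡ 1 [ZMOD 4] → Good F 8 4 r)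
    {r : ℕ} (hr : r.Prime) (hr8 : r ≡ 1 [ZMOD 8]) (hrd : r ≡ -1 [ZMOD d]) {p : ℕ} (hp : p.Prime)
      (hp2 : p ≠ 2)
    (hpr : p ≠ r) (hpd : d ≠ p) (hp0 : (p : A) ≠ 0) {γ : Quad a b} (h1 : (p : ℤ) ∣ 𝐍 γ)
      (h2 : ¬ (p ^ 2 : ℤ) ∣ 𝐍 γ)
    (h3 : (p : A) ∣ ι (star γ)) :
    ∃ z x y, x * r - ((8 : ℤ) : A) * y * (((8 : ℤ) : A) * ι z) = 1 ∧ jacobiSym (𝐍 z) r = -1 ∧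
      F x (((8 : ℤ) : A) * y) (((8 : ℤ) : A) * ι z) r = 0 := by
  have hr8' : r % 8 = 1 := by
    have : (r : ℤ) % 8 = 1 := hr8
    omega
  have h8 : ∀ {x : ℤ}, Odd x → IsCoprime (64 : ℤ) x := fun hx => by
    have : IsCoprime (2 : ℤ) _ := Int.isCoprime_two_left.mpr hx
    simpa using this.pow_left (m := 6)
  have hro : Odd (r : ℤ) := by rw [Int.odd_iff]; omega
  have hpo := hp.odd_of_ne_two hp2
  obtain ⟨e, ρ, hed, hpe, hρ, hcls⟩ := exists_class_of_sym hd (by omega) hp hpd hrd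
  have heo : Odd e := by
    obtain ⟨f, rfl⟩ := hed
    have : Odd (e * f) := Nat.odd_iff.mpr (by omega)
    exact (Nat.odd_mul.mp this).1
  have hre' : IsCoprime (r : ℤ) e :=
    (isCoprime_of_modEq hrd isCoprime_one_left.neg_left).of_isCoprime_of_dvd_right
      (by exact_mod_cast hed)
  have hpe' : IsCoprime (p : ℤ) e := isCoprime_natPrime hp (by exact_mod_cast hpe)
  have hpr' : IsCoprime (p : ℤ) r := Nat.isCoprime_iff_coprime.mpr
    ((Nat.coprime_primes hp hr).mpr hpr)
  have h2c : ∀ {n : ℕ}, Odd n → IsCoprime (2 : ℤ) n := fun hn =>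
    Int.isCoprime_two_left.mpr (by exact_mod_cast hn)
  have hr2 : IsCoprime (r : ℤ) (2 * e) := IsCoprime.mul_right
    (Int.isCoprime_two_left.mpr hro).symm hre'
  have hco : IsCoprime (p ^ 2 : ℤ) (r * (2 * e)) :=
    (hpr'.mul_right ((h2c hpo).symm.mul_right hpe')).pow_left
  have crt : ∀ x y w : ℤ, ∃ X, X ≡ x [ZMOD p ^ 2] ∧ X ≡ y [ZMOD r] ∧ X ≡ w [ZMOD 2 * e] :=
    fun x y w => by
    obtain ⟨u, hu1, hu2⟩ := exists_modEq hr2 y w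
    obtain ⟨X, hX1, hX2⟩ := exists_modEq hco x u
    exact ⟨X, hX1, (hX2.of_dvd (dvd_mul_right _ _)).trans hu1,
      (hX2.of_dvd (dvd_mul_left _ _)).trans hu2⟩
  obtain ⟨X, hX1, hX2, hX3⟩ := crt γ.re (Quad.root b : Quad a b).re 1
  obtain ⟨Y, hY1, hY2, hY3⟩ := crt γ.im (Quad.root b : Quad a b).im 0
  have key : ∀ {n : ℤ} {w : Quad a b}, X ≡ w.re [ZMOD n] → Y ≡ w.im [ZMOD n] →
    (n : Quad a b) ∣ ⟨X, Y⟩ - w :=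
    fun hX hY => Quad.intCast_dvd_iff.mpr ⟨by simpa using hX.symm.dvd, by simpa using hY.symm.dvd⟩
  set z : Quad a b := ⟨X, Y⟩ with hz
  have k1 := key hX1 hY1
  have k2 := Quad.norm_modEq k1
  have k3 : 𝐍 z ≡ d [ZMOD r] := by
    have := Quad.norm_add_root hm 0
    rw [Int.cast_zero, zero_add] at this
    exact (Quad.norm_modEq (key hX2 hY2)).trans (by rw [this]; simp)
  have k4 : 𝐍 z ≡ 1 [ZMOD 2 * e] := by
    simpa using Quad.norm_modEq (w := 1) (key (by simpa using hX3) (by simpa using hY3))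
  have hzr : jacobiSym (𝐍 z) r = -1 := by
    rw [jacobiSym.mod_left' k3, ← sym_neg_mul (by omega)]
    exact sym_neg_of_modEq (by omega) (hr8.of_dvd (by norm_num)) hrd
  obtain ⟨n, hn⟩ : ∃ n : ℤ, 𝐍 z = p * n := by
    have := h1.trans (dvd_of_eq rfl)
    obtain ⟨i, hi⟩ := k2.symm.dvd
    obtain ⟨j, hj⟩ := h1
    exact ⟨p * i + j, by linear_combination hi + hj⟩
  have hpn : ¬ (p : ℤ) ∣ n := fun ⟨j, hj⟩ => h2 <| by
    obtain ⟨i, hi⟩ := k2.symm.dvd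
    exact ⟨j - i, by linear_combination hn + p * hj - hi⟩
  have hn0 : n ≠ 0 := by rintro rfl; simp at hpn
  have hn2 : IsCoprime n (2 * e) :=
    (isCoprime_of_modEq k4 isCoprime_one_left).of_isCoprime_of_dvd_left ⟨p, by rw [hn]; ring⟩
  have hno : Odd n := (Int.isCoprime_two_left.mp
    (hn2.of_isCoprime_of_dvd_right (dvd_mul_right _ _)).symm)
  have hne : IsCoprime n e := hn2.of_isCoprime_of_dvd_right (dvd_mul_left _ _)
  have hnr : IsCoprime n r :=
    (isCoprime_of_sym hr.ne_zero (by rw [hzr]; norm_num)).of_isCoprime_of_dvd_left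
      ⟨p, by rw [hn]; ring⟩
  obtain ⟨w, hw⟩ : ∃ w, ι z * w = n := by
    obtain ⟨i, hi⟩ := k1
    obtain ⟨j, hj⟩ := h3
    refine ⟨j + p * ι (star i), mul_left_cancel₀ hp0 ?_⟩
    have e1 := congrArg ι (Quad.mul_star_self z)
    have e2 : star z = star γ + ((p : ℤ) : Quad a b) * ((p : ℤ) : Quad a b) * star i := by
      have : z = γ + (((p ^ 2 : ℤ)) : Quad a b) * i := by rw [← hi]; ring
      rw [this, star_add, star_mul]
      push_cast
      simp
      ring
    rw [hn, map_mul, e2, map_add, map_mul ι (_ * _), map_mul ι ((p : ℤ) : Quad a b)] at e1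
    simp only [map_intCast] at e1
    push_cast at e1
    linear_combination e1 - ι z * hj
  obtain ⟨g, hg, hgp⟩ := exists_sym_eq_neg_one hp.prime.squarefree hpo hp.ne_one
  have cr : IsCoprime (r : ℤ) (64 * n) := (h8 hro).symm.mul_right hnr.symm
  have cp : IsCoprime (64 * n) (p : ℤ) :=
    (h8 (by exact_mod_cast hpo)).mul_left (isCoprime_natPrime hp hpn).symm
  have ce : IsCoprime (64 * n) (e : ℤ) := (h8 (by exact_mod_cast heo)).mul_left hne
  obtain ⟨r', hrB, hr', e1, e2, e3⟩ := exists_prime_of_crt₃ B (l := 64 * n) (m := p) (n := e)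
    (mul_ne_zero (by norm_num) hn0) (by exact_mod_cast hp.ne_zero) (by rintro h; simp_all)
    cp ce hpe' cr (hpr'.symm.mul_left hg) hρ
  have hr'4 : (r' : ℤ) ≡ 1 [ZMOD 4] := (e1.of_dvd ⟨16 * n, by ring⟩).trans
    (hr8.of_dvd (by norm_num))
  have hrmod4 : r' % 4 = 1 := by
    have : (r' : ℤ) % 4 = 1 := hr'4
    omega
  have hrp : jacobiSym r' p = - jacobiSym r p := by
    rw [jacobiSym.mod_left' e2, jacobiSym.mul_left, hgp]
    ring
  have hI := hm.inert hr' (hcls r' hr'4 hrp e3)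
  have hG := hB r' hrB.le hI hr'4
  have hsn : jacobiSym n r' = jacobiSym n r := by
    have hnat : ∀ s : ℕ, s % 4 = 1 → jacobiSym n s = jacobiSym s n.natAbs := fun s hs => by
      have : Odd n.natAbs := Int.natAbs_odd.mpr hno
      rw [jacobiSym.quadratic_reciprocity_one_mod_four hs this]
      rcases Int.natAbs_eq n with h | h
      · rw [← h]
      · conv_lhs => rw [h]
        exact sym_neg_mul hs _
    rw [hnat r' hrmod4, hnat r (by omega)]
    exact jacobiSym.mod_left' (e1.of_dvd (Int.natAbs_dvd.mpr ⟨64, by ring⟩))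
  have hzr' : jacobiSym (𝐍 z) r' = 1 := by
    rw [hn, jacobiSym.mul_left, hsn, ← jacobiSym.quadratic_reciprocity_one_mod_four hrmod4 hpo, hrp]
    rw [hn, jacobiSym.mul_left, ← jacobiSym.quadratic_reciprocity_one_mod_four
      (by omega) hpo] at hzr
    linarith
  obtain ⟨u, v, huv⟩ := cr
  have huv' : (u : A) * r + v * (64 * n) = 1 := by exact_mod_cast congrArg (Int.cast : ℤ → A) huv
  have hdet : (u : A) * r - ((8 : ℤ) : A) * (-(v * w)) * (((8 : ℤ) : A) * ι z) = 1 := by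
    push_cast
    linear_combination huv' + 64 * v * hw
  refine ⟨z, u, -(v * w), hdet, hzr, ?_⟩
  obtain ⟨j, hj⟩ := e1.symm.dvd
  have hwr : (r' : A) = r + ((8 : ℤ) : A) * (w * j) * (((8 : ℤ) : A) * ι z) := by
    have := congrArg (Int.cast : ℤ → A) hj
    push_cast at this ⊢
    linear_combination this - 64 * j * hw
  obtain ⟨y', hy, hy'⟩ := replace_diag hF (by simpa using h0) hdet hwr
  rw [← hy', hG.eq_zero_of_norm hI hy hzr']

end Ctx

namespace Ctx

variable {a b : ℤ} {A : Type*} [CommRing A] {ι : Quad a b →+* A} {π : Quad a b} (hc : Ctx ι π)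
  [IsDomain A] {C : Type*} [AddCommGroup C] {F : A → A → A → A → C} (hF : IsHom F)
  {l : ℕ} (hC : TorsionAt l C)

omit hc in
include hF in
theorem kappa_eq_zero_of_dvd {d : ℕ} (hm : b = 1 ∧ 4 * a + 1 = -d) (hd8 : d % 8 = 7)
    (hd0 : (d : A) ≠ 0) (h0 : ∀ t, hF.upper (8 * t) = 0) (h4 : 4 • hF.upper 1 = 0) {m : ℤ}
    (h1 : (d : ℤ) ∣ 2 * m + 1) (h2 : (d : A) ∣ ι ⟨m, 1⟩) : 12 • hF.upper (ι ⟨0, 1⟩) = 0 := by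
  obtain ⟨rfl, ha⟩ := hm
  set u : A := ι ⟨-1, 2⟩ with hu
  have hu2 : u ^ 2 = -d := by
    have : (⟨-1, 2⟩ : Quad a 1) ^ 2 = ((-d : ℤ) : Quad a 1) := by
      rw [← ha, pow_two]
      ext <;> simp
      ring
    rw [hu, ← map_pow, this, map_intCast]
    push_cast
    rfl
  obtain ⟨w, hw⟩ : (d : A) ∣ u := by
    have e : (⟨-1, 2⟩ : Quad a 1) = 2 * ⟨m, 1⟩ - ((2 * m + 1 : ℤ) : Quad a 1) := by
      ext <;> simp
    rw [hu, e, map_sub, map_mul ι, map_intCast]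
    refine dvd_sub (h2.mul_left _) ?_
    obtain ⟨i, hi⟩ := h1
    exact ⟨i, by exact_mod_cast congrArg (Int.cast : ℤ → A) hi⟩
  have huw : u * (-w) = 1 := mul_left_cancel₀ hd0 (by linear_combination u * hw - hu2)
  have hs4 : (-d : ℤ) ≡ 1 [ZMOD 4] := show (-d : ℤ) % 4 = 1 % 4 by omega
  have hst : ((-d : ℤ) : A) * w ^ 2 = 1 := by
    push_cast
    linear_combination w * hw + huw
  have e1 := hF.diag_eq_zero h0 h4 hs4 hst
  have e2 := hF.inv (a := w ^ 2) (b := 0) (c := 0) (d := ((-d : ℤ) : A)) (by linear_combination hst)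
  have e3 := hF.mul' (a := u) (b := 0) (c := 0) (d := -w) (a' := u) (b' := 0) (c' := 0) (d' := -w)
    (a'' := ((-d : ℤ) : A)) (b'' := 0) (c'' := 0) (d'' := w ^ 2) (by linear_combination huw)
      (by linear_combination huw)
    (by push_cast; linear_combination -hu2) (by ring) (by ring) (by ring)
  rw [e1, neg_zero, neg_zero] at e2
  rw [e2, hF.diag_eq huw] at e3
  obtain ⟨k, hk⟩ : ∃ k : ℤ, (d : ℤ) = 8 * k - 1 := ⟨(d + 1) / 8, by omega⟩
  have hk' : (d : A) = 8 * k - 1 := by exact_mod_cast congrArg (Int.cast : ℤ → A) hk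
  have e4 : hF.upper (-w) = hF.upper u := by
    have : -w = u + 8 * (-(k * w)) := by rw [hw, hk']; ring
    rw [this, map_add, h0, add_zero]
  have e5 : hF.upper u = 2 • hF.upper (ι ⟨0, 1⟩) - hF.upper 1 := by
    have : u = 2 * ι ⟨0, 1⟩ - 1 := by
      rw [hu, ← map_one ι, ← map_ofNat ι 2, ← map_mul, ← map_sub]
      congr 1
      ext <;> simp
    rw [this, map_sub, ← map_nsmul, nsmul_eq_mul]
    push_cast
    rfl
  rw [map_add, map_add, e4, e5] at e3
  have h12 : 12 • hF.upper 1 = 0 := by rw [show 12 = 3 * 4 by rfl, mul_smul, h4, smul_zero]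
  have h5 : ∀ w o : C, 2 • w - o + (2 • w - o) + (2 • w - o) - 3 • o +
    (2 • w - o + (2 • w - o) + (2 • w - o) - 3 • o) =
    12 • w - 12 • o := by intros; abel
  rw [h5, h12, sub_zero] at e3
  exact e3.symm

include hc hF hC

theorem upper_two_split {d : ℕ} (hd : Squarefree d) (hm : IsMaximal a b d) (hl2 : l = 2)
    (hd8 : d % 8 = 7)
    {p : ℕ} (hp : p.Prime) (hS : (IsUnit (p : A) ∧ ¬ p ∣ d) ∨
      ∃ m : ℤ, (p : ℤ) ∣ 𝐍 (⟨m, 1⟩ : Quad a b) ∧ ¬ (p ^ 2 : ℤ) ∣ 𝐍 (⟨m, 1⟩ : Quad a b) ∧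
        (p : A) ∣ ι ⟨m, 1⟩) (t : A) :
    hF.upper (4 * t) = 0 := by
  have h0 := hc.upper_eight_mul hF hC hd (by rintro rfl; simp at hd8) hm hl2
  have h4 := upper_one_zsmul_four hF hC hl2
  have hm1 : b = 1 ∧ 4 * a + 1 = -d := by
    rcases hm with ⟨-, -, h⟩ | h
    · omega
    · exact h
  have := hc.charZero
  have h4' : ∀ n : ℤ, hF.upper (4 * n) = 0 := fun n => by
    rw [show (4 * n : A) = n * ((4 : ℤ) : A) by push_cast; ring, hF.upper_zsmul, ← mul_one ((4 : ℤ) : A), hF.upper_zsmul]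
    have : (4 : ℤ) • hF.upper 1 = 0 := by exact_mod_cast h4
    rw [this, smul_zero]
  obtain ⟨y, s, hs⟩ := hc.exists_rep (n := 2) two_ne_zero t
  have hy : ι y = y.re + y.im * ι ⟨0, 1⟩ := by
    conv_lhs => rw [Quad.eq_add_mul y]
    rw [map_add ι, map_mul ι, map_intCast, map_intCast]
  push_cast at hs
  by_cases hp2 : p = 2
  · subst hp2
    rcases hS with ⟨⟨u, hu⟩, -⟩ | ⟨m, -, -, w, hw⟩
    · have hu2 : (2 : A) * ↑u⁻¹ = 1 := by
        have := u.mul_inv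
        rw [hu] at this
        simpa using this
      rw [show 4 * t = 8 * (↑u⁻¹ * t) by linear_combination (-4 * t) * hu2, h0]
    · have e : (⟨m, 1⟩ : Quad a b) = (m : Quad a b) + ⟨0, 1⟩ := by ext <;> simp
      rw [e, map_add ι, map_intCast] at hw
      push_cast at hw
      have : 4 * t = 4 * ((y.re - y.im * m : ℤ) : A) + 8 * (s + y.im * w) := by
        push_cast
        linear_combination 4 * hs + 4 * hy + 4 * y.im * hw
      rw [this, map_add, h0, h4', add_zero]
  suffices H : 12 • hF.upper (ι ⟨0, 1⟩) = 0 by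
    refine hC 3 (by rw [hl2]; norm_num) _ ?_
    have e1 : (12 : ℤ) • hF.upper (ι ⟨0, 1⟩) = 0 := by exact_mod_cast H
    rw [← map_nsmul, nsmul_eq_mul]
    have : ((3 : ℕ) : A) * (4 * t) = 4 * ((3 * y.re : ℤ) : A) + (((y.im * 12 : ℤ)) : A) * ι ⟨0, 1⟩ +
      8 * (3 * s) := by
      push_cast
      linear_combination 12 * hs + 12 * hy
    rw [this, map_add, map_add, h0, h4', hF.upper_zsmul, mul_smul, e1, smul_zero, add_zero,
      add_zero]
  have hdA : (d : A) ≠ 0 := by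
    have : d ≠ 0 := by omega
    exact_mod_cast this
  have hp0 : (p : A) ≠ 0 := by exact_mod_cast hp.ne_zero
  by_cases hdp : d = p ∧ ∃ m : ℤ, (p : ℤ) ∣ 𝐍 (⟨m, 1⟩ : Quad a b) ∧ (p : A) ∣ ι ⟨m, 1⟩
  · obtain ⟨rfl, m, h1, h2⟩ := hdp
    refine kappa_eq_zero_of_dvd hF hm1 hd8 hdA h0 h4 ?_ h2
    refine (Nat.prime_iff_prime_int.mp hp).dvd_of_dvd_pow (n := 2) ?_
    obtain ⟨i, hi⟩ := h1
    rw [QuadraticAlgebra.norm_def] at hi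
    obtain ⟨rfl, ha⟩ := hm1
    exact ⟨4 * i - 1, by simp only at hi; linear_combination 4 * hi + ha⟩
  obtain ⟨B, hB⟩ := eventually_atTop.mp (hc.good_eight hF hC hl2 h0)
  obtain ⟨r, hrB, hr, hr8, hrd, z, x, y, hdet, hz, hval⟩ := exists_kappa hF hm1 hd8 h0 h4 (max B p)
  have hr4 := hr8.of_dvd (by norm_num : (4 : ℤ) ∣ 8)
  have hI := hm.inert hr (sym_neg_of_modEq (by omega) hr4 hrd)
  have hG := hB r ((le_max_left _ _).trans hrB.le) hI hr4
  have hpr : p ≠ r := ((le_max_right B p).trans_lt hrB).ne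
  obtain ⟨z', x', y', hdet', hz', hval'⟩ : ∃ z x y,
    x * r - ((8 : ℤ) : A) * y * (((8 : ℤ) : A) * ι z) = 1 ∧
      jacobiSym (𝐍 z) r = -1 ∧ F x (((8 : ℤ) : A) * y) (((8 : ℤ) : A) * ι z) r = 0 := by
    rcases hS with ⟨hu, hpd⟩ | ⟨m, h1, h2, h3⟩
    · exact exists_zero_of_isUnit hF hm hd8 h0 h4 hB hr hr8 hrd hp hp2 hpr hpd hu
    · exact exists_zero_of_dvd hF hd hm hd8 h0 hB hr hr8 hrd hp hp2 hpr
        (fun h => hdp ⟨h, m, h1, h3⟩) hp0 (γ := star ⟨m, 1⟩) (by rwa [QuadraticAlgebra.norm_star])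
        (by rwa [QuadraticAlgebra.norm_star]) (by rwa [star_star])
  rw [← hval, hG.eq_of_norm hI hdet hdet' (hz.trans hz'.symm) (by rw [hz]; norm_num), hval']

end Ctx

theorem IsHom.upper_sq_mul {A C : Type*} [CommRing A] [AddCommGroup C] {F : A → A → A → A → C}
    (hF : IsHom F)
    {u v : A} (h : u * v = 1) (t : A) : hF.upper (u ^ 2 * t) = hF.upper t := by
  have e1 := hF.mul' (a := u) (b := 0) (c := 0) (d := v) (a' := 1) (b' := t) (c' := 0) (d' := 1)
    (a'' := u) (b'' := u * t) (c'' := 0) (d'' := v) (by linear_combination h) (by ring) (by ring)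
      (by ring)
    (by ring) (by ring)
  have e2 := hF.mul' (a := 1) (b := u ^ 2 * t) (c := 0) (d := 1) (a' := u) (b' := 0) (c' := 0)
    (d' := v)
    (a'' := u) (b'' := u * t) (c'' := 0) (d'' := v) (by ring) (by linear_combination h) (by ring)
    (by linear_combination (-u * t) * h) (by ring) (by ring)
  rw [e1, hF.upper_eq, hF.upper_eq] at e2
  rw [add_comm] at e2
  exact (add_right_cancel e2).symm

namespace Quad

theorem exists_norm_sub_mul_lt {b : ℤ} (hb : b = 0 ∨ b = 1) {c : Quad (-1) b} (hc : c ≠ 0)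
    (w : Quad (-1) b) :
    ∃ q, 𝐍 (w - q * c) < 𝐍 c := by
  have hN : 0 < 𝐍 c := norm_pos (by rcases hb with rfl | rfl <;> norm_num) hc
  have hdiv : ∀ x : ℤ, ∃ q, -𝐍 c ≤ 2 * (x - 𝐍 c * q) ∧ 2 * (x - 𝐍 c * q) ≤ 𝐍 c := fun x => by
    refine ⟨(2 * x + 𝐍 c) / (2 * 𝐍 c), ?_⟩
    have h1 := Int.emod_add_mul_ediv (2 * x + 𝐍 c) (2 * 𝐍 c)
    have h2 := Int.emod_nonneg (2 * x + 𝐍 c) (by positivity : 2 * 𝐍 c ≠ 0)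
    have h3 := Int.emod_lt_of_pos (2 * x + 𝐍 c) (by positivity : 0 < 2 * 𝐍 c)
    constructor <;> linarith
  obtain ⟨q₁, h₁⟩ := hdiv (w * star c).re
  obtain ⟨q₂, h₂⟩ := hdiv (w * star c).im
  set X := (w * star c).re - 𝐍 c * q₁ with hX
  set Y := (w * star c).im - 𝐍 c * q₂ with hY
  refine ⟨⟨q₁, q₂⟩, ?_⟩
  have e1 : (w - ⟨q₁, q₂⟩ * c) * star c = ⟨X, Y⟩ := by
    rw [sub_mul, mul_assoc, mul_star_self]
    ext
    · simp [hX]; ring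
    · simp [hY]; ring
  have e2 : 𝐍 (w - ⟨q₁, q₂⟩ * c) * 𝐍 c = X ^ 2 + b * X * Y + Y ^ 2 := by
    rw [← QuadraticAlgebra.norm_star c, ← map_mul, e1, QuadraticAlgebra.norm_def]
    ring
  have e3 : 4 * X ^ 2 ≤ 𝐍 c * 𝐍 c := by nlinarith
  have e4 : 4 * Y ^ 2 ≤ 𝐍 c * 𝐍 c := by nlinarith
  refine lt_of_mul_lt_mul_right (a := 𝐍 c) ?_ hN.le
  rw [e2]
  rcases hb with rfl | rfl <;> nlinarith [sq_nonneg (X - Y)]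

end Quad

/-- A homomorphism killing elementary matrices vanishes if the quadratic order is norm-Euclidean. -/
theorem Ctx.eq_zero_of_euclidean {b : ℤ} (hb : b = 0 ∨ b = 1) {A : Type*} [CommRing A]
    {ι : Quad (-1) b →+* A}
    {π : Quad (-1) b} (hc : Ctx ι π) {C : Type*} [AddCommGroup C] {F : A → A → A → A → C}
      (hF : IsHom F)
    (h0 : ∀ t, hF.upper t = 0) {p q s t : A} (hd : p * t - q * s = 1) : F p q s t = 0 := by
  have hdiag : ∀ u v : A, u * v = 1 → F u 0 0 v = 0 := fun u v h => by
    rw [hF.diag_eq h, h0, h0, smul_zero, sub_zero]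
  have key : ∀ n : ℕ, ∀ s' t' : Quad (-1) b, 𝐍 s' = n → ∀ p q : A, p * ι t' - q * ι s' = 1 →
      F p q (ι s') (ι t') = 0 := fun n => by
    induction n using Nat.strong_induction_on with
    | _ n ih =>
      intro s' t' hs p q hd
      by_cases h : s' = 0
      · subst h
        rw [map_zero] at hd ⊢
        have hd' : p * ι t' = 1 := by linear_combination hd
        rw [hF.mul_upper (b := 0) (d := ι t') (q * ι t') (by linear_combination hd')
          (by linear_combination (-q) * hd') (by ring), h0, hdiag _ _ hd', zero_add]
      · obtain ⟨k, hk⟩ := Quad.exists_norm_sub_mul_lt hb h t'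
        have hN : 0 ≤ 𝐍 (t' - k * s') := by
          by_cases h' : t' - k * s' = 0
          · rw [h', QuadraticAlgebra.norm_def]; simp
          · exact (Quad.norm_pos hc.neg h').le
        have e : ι (-(t' - k * s')) = -(ι t' - ι k * ι s') := by rw [map_neg, map_sub, map_mul ι]
        have e1 := ih (𝐍 (t' - k * s')).toNat (by omega) (-(t' - k * s')) s'
          (by rw [QuadraticAlgebra.norm_neg]; omega) (-(q - ι k * p)) p
            (by rw [e]; linear_combination hd)
        have e2 := hF.mul_upper (a := p) (b := q - ι k * p) (c := ι s') (d := ι t' - ι k * ι s')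
          (b' := q) (d' := ι t')
          (ι k) (by linear_combination hd) (by ring) (by ring)
        have e3 := hF.mul' (a := p) (b := q - ι k * p) (c := ι s') (d := ι t' - ι k * ι s')
          (a' := 0) (b' := 1) (c' := -1) (d' := 0) (a'' := -(q - ι k * p)) (b'' := p)
          (c'' := ι (-(t' - k * s'))) (d'' := ι s') (by linear_combination hd) (by ring) (by ring)
            (by ring)
          (by rw [e]; ring) (by ring)
        rw [e1, hF.weyl, h0, smul_zero, add_zero] at e3
        rw [e2, h0, ← e3, zero_add]
  obtain ⟨k₁, s', hs⟩ := hc.den s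
  obtain ⟨k₂, t', ht⟩ := hc.den t
  obtain ⟨v, hv⟩ := (hc.unit.pow (k₁ + k₂)).exists_right_inv
  have e := hF.mul' (a := v) (b := 0) (c := 0) (d := ι π ^ (k₁ + k₂)) (a' := p) (b' := q) (c' := s)
    (d' := t)
    (a'' := v * p) (b'' := v * q) (c'' := ι (π ^ k₂ * s')) (d'' := ι (π ^ k₁ * t'))
      (by linear_combination hv) hd
    (by ring) (by ring) (by rw [map_mul ι, map_pow, ← hs]; ring)
      (by rw [map_mul ι, map_pow, ← ht]; ring)
  rw [hdiag _ _ (by linear_combination hv), zero_add] at e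
  rw [← e]
  have hN : 0 ≤ 𝐍 (π ^ k₂ * s') := by
    by_cases h' : π ^ k₂ * s' = 0
    · rw [h', QuadraticAlgebra.norm_def]; simp
    · exact (Quad.norm_pos hc.neg h').le
  refine key (𝐍 (π ^ k₂ * s')).toNat _ _ (by omega) _ _ ?_
  rw [map_mul ι, map_mul ι, map_pow, map_pow, ← hs, ← ht]
  linear_combination v * ι π ^ (k₁ + k₂) * hd + hv

namespace Ctx

variable {a b : ℤ} {A : Type*} [CommRing A] {ι : Quad a b →+* A} {π : Quad a b} (hc : Ctx ι π)
  [IsDomain A] {C : Type*} [AddCommGroup C] {F : A → A → A → A → C} (hF : IsHom F)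
  {l : ℕ} (hC : TorsionAt l C)

omit [IsDomain A] in
include hc hF in
theorem upper_two_mul_of_one (hm : IsMaximal a b 1) (t : A) : hF.upper (2 * t) = 0 := by
  obtain ⟨rfl, rfl⟩ : b = 0 ∧ a = -1 := by
    rcases hm with h | h
    · exact ⟨h.1, by simpa using h.2.1⟩
    · omega
  have hu : (⟨0, 1⟩ : Quad (-1) 0) * ⟨0, -1⟩ = 1 := by ext <;> simp
  have hu2 : (⟨0, 1⟩ : Quad (-1) 0) ^ 2 = -1 := by rw [pow_two]; ext <;> simp
  have := hF.upper_sq_mul (u := ι ⟨0, 1⟩) (v := ι ⟨0, -1⟩) (by rw [← map_mul, hu, map_one]) t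
  rw [← map_pow, hu2, map_neg, map_one, neg_one_mul, map_neg] at this
  rw [two_mul, map_add]
  nth_rw 1 [← this]
  exact neg_add_cancel _

omit [IsDomain A] in
include hc hF in
theorem upper_root_mul_of_three (hm : IsMaximal a b 3) (t : A) :
    hF.upper (ι (Quad.root b) * t) = 0 := by
  obtain ⟨rfl, rfl⟩ : b = 1 ∧ a = -1 := by
    rcases hm with h | h
    · simp at h
    · omega
  have hu : (⟨0, 1⟩ : Quad (-1) 1) * ⟨1, -1⟩ = 1 := by ext <;> simp
  have hr : (Quad.root 1 : Quad (-1) 1) = (⟨0, 1⟩ ^ 2 - 1) * (1 - ⟨0, 1⟩) := by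
    rw [pow_two]; ext <;> simp [Quad.root]
  have := hF.upper_sq_mul (u := ι ⟨0, 1⟩) (v := ι ⟨1, -1⟩) (by rw [← map_mul, hu, map_one])
    (ι (1 - ⟨0, 1⟩) * t)
  rw [hr, map_mul ι, map_sub, map_pow, map_one, mul_assoc, sub_mul, one_mul, map_sub hF.upper, this,
    sub_self]

omit [IsDomain A] in
include hc hF in
theorem upper_three_mul_of_three (hm : IsMaximal a b 3) (t : A) : hF.upper (3 * t) = 0 := by
  have := hc.upper_root_mul_of_three hF hm (ι (Quad.root b) * t)
  rw [← mul_assoc, ← map_mul, ← pow_two, Quad.root_sq hm, map_intCast] at this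
  push_cast at this
  rwa [neg_mul, map_neg, neg_eq_zero] at this

end Ctx

/-- The elements of order prime to `l`. -/
def torsionAway (l : ℕ) (C : Type*) [AddCommGroup C] : AddSubgroup C where
  carrier := {c | ∃ n : ℕ, n.Coprime l ∧ n • c = 0}
  zero_mem' := ⟨1, Nat.coprime_one_left l, smul_zero _⟩
  add_mem' := by
    rintro x y ⟨m, hm, hx⟩ ⟨n, hn, hy⟩
    refine ⟨m * n, hm.mul_left hn, ?_⟩
    rw [smul_add, mul_smul m n y, hy, mul_comm, mul_smul n m x, hx, smul_zero, smul_zero, add_zero]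
  neg_mem' := by
    rintro x ⟨m, hm, hx⟩
    exact ⟨m, hm, by rw [smul_neg, hx, neg_zero]⟩

theorem torsionAt_quotient (l : ℕ) (C : Type*) [AddCommGroup C] :
    TorsionAt l (C ⧸ torsionAway l C) := by
  intro n hn c hc
  induction c using QuotientAddGroup.induction_on with
  | H x =>
    rw [← QuotientAddGroup.mk_nsmul, QuotientAddGroup.eq_zero_iff] at hc
    obtain ⟨m, hm, hx⟩ := hc
    exact (QuotientAddGroup.eq_zero_iff _).mpr ⟨m * n, hm.mul_left hn, by rw [mul_smul, hx]⟩

theorem eq_zero_of_mem_torsionAway {C : Type*} [AddCommGroup C] {c : C}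
    (h : ∀ l : ℕ, l.Prime → c ∈ torsionAway l C) : c = 0 := by
  rw [← AddMonoid.addOrderOf_eq_one_iff]
  by_contra h1
  obtain ⟨l, hl, hdvd⟩ := Nat.exists_prime_and_dvd h1
  obtain ⟨n, hn, hc⟩ := h l hl
  exact (Nat.Prime.coprime_iff_not_dvd hl).mp hn.symm
    (hdvd.trans (addOrderOf_dvd_of_nsmul_eq_zero hc))

namespace Ctx

variable {a b : ℤ} {A : Type*} [CommRing A] {ι : Quad a b →+* A} {π : Quad a b} (hc : Ctx ι π)
  [IsDomain A] {C : Type*} [AddCommGroup C] {F : A → A → A → A → C} (hF : IsHom F)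

include hc hF

/-- A homomorphism on `SL₂(A)` to an abelian group vanishes if it kills the elementary matrices. -/
theorem eq_zero {d : ℕ} (hd : Squarefree d) (hm : IsMaximal a b d) (h0 : ∀ t, hF.upper t = 0)
    {p q s t : A} (hdet : p * t - q * s = 1) : F p q s t = 0 := by
  by_cases h1 : d = 1
  · subst h1
    obtain ⟨rfl, rfl⟩ : b = 0 ∧ a = -1 := by
      rcases hm with h | h
      · exact ⟨h.1, by simpa using h.2.1⟩
      · omega
    exact hc.eq_zero_of_euclidean (Or.inl rfl) hF h0 hdet
  by_cases h3 : d = 3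
  · subst h3
    obtain ⟨rfl, rfl⟩ : b = 1 ∧ a = -1 := by
      rcases hm with h | h
      · simp at h
      · omega
    exact hc.eq_zero_of_euclidean (Or.inr rfl) hF h0 hdet
  refine eq_zero_of_mem_torsionAway fun l hl => ?_
  have hC := torsionAt_quotient l C
  rw [← QuotientAddGroup.eq_zero_iff]
  have hF' := hF.comp_addHom (QuotientAddGroup.mk' (torsionAway l C))
  have h0' : ∀ t, hF'.upper t = 0 := fun t => by
    rw [← hF'.upper_eq, hF.upper_eq, h0, map_zero]
  by_cases hl2 : l = 2
  · obtain ⟨M, g, hM, hMo, hg, hMd, h⟩ := exists_inert_class hd h1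
    have hI := fun r hr h5 hrg => hm.inert (r := r) hr (h r h5 hrg)
    have hnorm : ∀ k : ℤ, 𝐍 (1 - (k : Quad a b) * Quad.root b) = 1 + k ^ 2 * d := fun k => by
      have hr : 𝐍 (Quad.root b : Quad a b) = d := by simpa using Quad.norm_add_root hm 0
      have ht := Quad.trace_add_root hm 0
      rw [Int.cast_zero, zero_add, mul_zero, QuadraticAlgebra.re_add] at ht
      rw [QuadraticAlgebra.norm_def] at hr ⊢
      simp [Quad.root] at hr ht ⊢
      grind
    have hN1 : ∀ k : ℤ, IsCoprime (1 + k ^ 2 * d) M := fun k =>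
      IsCoprime.of_isCoprime_of_dvd_right (y := (d : ℤ)) ⟨1, -k ^ 2, by ring⟩ hMd
    rcases Nat.even_or_odd d with he | ho
    · have hd4 : d % 4 = 2 := by
        have := Nat.even_iff.mp he
        have : d % 4 ≠ 0 := fun h => absurd (hd 2 (Nat.dvd_of_mod_eq_zero h)) (by decide)
        omega
      have ho1 : Odd (1 + d) := Nat.odd_iff.mpr (by omega)
      refine hc.eq_zero_of_two hF' (hl2 ▸ hC) rfl h0' hM hMo hg hI
        (α := 1 - ((-1 : ℤ) : Quad a b) * Quad.root b)
        (m := Quad.root b) (k := -1) (N := 1 + d) ?_ ho1 ?_ (by ring) ?_ hdet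
      · rw [hnorm]; push_cast; ring
      · simpa using hN1 (-1)
      · rw [jacobiSym.at_neg_one ho1, ZMod.χ₄_nat_three_mod_four (by omega)]
    · have ho1 : Odd (1 + 4 * d) := Nat.odd_iff.mpr (by omega)
      refine hc.eq_zero_of_two hF' (hl2 ▸ hC) rfl h0' hM hMo hg hI
        (α := 1 - ((2 : ℤ) : Quad a b) * Quad.root b)
        (m := Quad.root b) (k := 2) (N := 1 + 4 * d) ?_ ho1 ?_ (by ring) ?_ hdet
      · rw [hnorm]; push_cast; ring
      · simpa using hN1 2
      · rw [jacobiSym.at_two ho1, ZMod.χ₈_nat_eq_if_mod_eight]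
        have := Nat.odd_iff.mp ho
        rw [if_neg (by omega), if_neg (by omega)]
  · obtain ⟨M, g, hM, hg, h⟩ := exists_odd_class hd h1 h3 hl hl2
    exact hc.eq_zero_of_odd hF' hl hC hl2 h0' hM hg
      (fun r hr hrg => ⟨hm.inert hr (h r hrg).1, (h r hrg).2.1⟩) hdet

/-- Elementary matrices killed by every homomorphism to an abelian group. -/
theorem upper_eq_zero {d : ℕ} (hd : Squarefree d) (hm : IsMaximal a b d)
    (hS : d % 8 = 7 → ∃ p : ℕ, p.Prime ∧ ((IsUnit (p : A) ∧ ¬ p ∣ d) ∨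
      ∃ m : ℤ, (p : ℤ) ∣ 𝐍 (⟨m, 1⟩ : Quad a b) ∧ ¬ (p ^ 2 : ℤ) ∣ 𝐍 (⟨m, 1⟩ : Quad a b) ∧
        (p : A) ∣ ι ⟨m, 1⟩))
    {t : A} (h2 : d % 8 = 3 ∨ d % 8 = 7 ∧ (4 : A) ∣ t ∨ d % 4 ≠ 3 ∧ (2 : A) ∣ t)
    (h3 : d % 3 = 1 ∨ d % 3 = 2 ∧ (3 : A) ∣ t ∨ d % 3 = 0 ∧ ∃ x y,
      t = 3 * x + ι (Quad.root b) * y) :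
    hF.upper t = 0 := by
  refine eq_zero_of_mem_torsionAway fun l hl => ?_
  have hC := torsionAt_quotient l C
  rw [← QuotientAddGroup.eq_zero_iff]
  have hF' := hF.comp_addHom (QuotientAddGroup.mk' (torsionAway l C))
  change hF'.upper t = 0
  by_cases hl2 : l = 2
  · subst hl2
    rcases h2 with h2 | ⟨h2, w, rfl⟩ | ⟨h2, w, rfl⟩
    · exact hc.upper_two_inert hF' hC hd hm rfl h2 t
    · obtain ⟨p, hp, hS⟩ := hS h2
      exact hc.upper_two_split hF' hC hd hm rfl h2 hp hS w
    · by_cases h1 : d = 1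
      · subst h1
        exact hc.upper_two_mul_of_one hF' hm w
      · exact hc.upper_two_ramified hF' hC hd h1 hm rfl h2 w
  have hl2' : Nat.Coprime 2 l := (Nat.coprime_primes Nat.prime_two hl).mpr (Ne.symm hl2)
  by_cases h1 : d = 1
  · subst h1
    refine hC 2 hl2' _ ?_
    rw [← map_nsmul, nsmul_eq_mul]
    exact_mod_cast hc.upper_two_mul_of_one hF' hm t
  by_cases hl3 : l = 3
  · subst hl3
    rcases h3 with h3 | ⟨h3, w, rfl⟩ | ⟨h3, x, y, rfl⟩
    · exact hc.upper_three_inert hF' hC hd h1 hm rfl h3 t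
    · exact hc.upper_three_mul hF' hC hd h1 (by rintro rfl; simp at h3) hm rfl w
    · by_cases h4 : d = 3
      · subst h4
        rw [map_add, hc.upper_three_mul_of_three hF' hm, hc.upper_root_mul_of_three hF' hm,
          add_zero]
      · rw [map_add, hc.upper_three_mul hF' hC hd h1 h4 hm rfl,
          hc.upper_three_ramified hF' hC hd h4 hm rfl h3, add_zero]
  by_cases h4 : d = 3
  · subst h4
    refine hC 3 ((Nat.coprime_primes Nat.prime_three hl).mpr (Ne.symm hl3)) _ ?_
    rw [← map_nsmul, nsmul_eq_mul]
    exact_mod_cast hc.upper_three_mul_of_three hF' hm t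
  · refine hc.upper_eq_zero_of_five_le hF' hC hd h1 h4 hm hl ?_ t
    by_contra h5
    have : l = 0 ∨ l = 1 ∨ l = 4 := by omega
    rcases this with rfl | rfl | rfl <;> revert hl <;> norm_num

end Ctx

end SL2Ab

namespace SL2Ab

section Universal

variable {A C : Type*} [CommRing A] [AddCommGroup C]

/-- The element of `SL₂(A)` with given entries. -/
def slMk {a b c d : A} (h : a * d - b * c = 1) : Matrix.SpecialLinearGroup (Fin 2) A :=
  ⟨!![a, b; c, d], by rw [Matrix.det_fin_two_of, h]⟩

theorem slMk_mul {a b c d a' b' c' d' : A} (h : a * d - b * c = 1) (h' : a' * d' - b' * c' = 1)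
    (h2 : (a * a' + b * c') * (c * b' + d * d') - (a * b' + b * d') * (c * a' + d * c') = 1) :
    slMk h2 = slMk h * slMk h' := by
  apply Subtype.ext
  rw [Matrix.SpecialLinearGroup.coe_mul]
  simp [slMk]

/-- The universal homomorphism from `SL₂(A)` to an additive abelian group. -/
noncomputable def univ (A : Type*) [CommRing A] (a b c d : A) :
    Additive (Abelianization (Matrix.SpecialLinearGroup (Fin 2) A)) :=
  open Classical in
  if h : a * d - b * c = 1 then
    Additive.ofMul (Abelianization.of (slMk h)) else 0

theorem isHom_univ (A : Type*) [CommRing A] : IsHom (univ A) where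
  mul {a b c d a' b' c' d'} h h' := by
    have h2 : (a * a' + b * c') * (c * b' + d * d') - (a * b' + b * d') * (c * a' + d * c') =
      1 := by
      linear_combination (a' * d' - b' * c') * h + h'
    rw [univ, univ, univ, dif_pos h, dif_pos h', dif_pos h2, ← ofMul_mul, ← map_mul,
      slMk_mul h h' h2]

theorem exists_univ (x : Additive (Abelianization (Matrix.SpecialLinearGroup (Fin 2) A))) :
    ∃ a b c d, a * d - b * c = 1 ∧ univ A a b c d = x := by
  obtain ⟨g, hg⟩ := QuotientGroup.mk'_surjective _ (Additive.toMul x)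
  have h := g.det_coe
  rw [Matrix.det_fin_two] at h
  refine ⟨g 0 0, g 0 1, g 1 0, g 1 1, h, ?_⟩
  have e : slMk h = g := by
    apply Subtype.ext
    ext i j
    fin_cases i <;> fin_cases j <;> rfl
  rw [univ, dif_pos h, e]
  exact congrArg Additive.ofMul hg

theorem IsHom.exists_lift {F : A → A → A → A → C} (hF : IsHom F) :
    ∃ θ : Additive (Abelianization (Matrix.SpecialLinearGroup (Fin 2) A)) →+ C,
      ∀ a b c d, a * d - b * c = 1 → θ (univ A a b c d) = F a b c d := by
  let f : Matrix.SpecialLinearGroup (Fin 2) A →* Multiplicative C :=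
    { toFun := fun g => Multiplicative.ofAdd (F (g 0 0) (g 0 1) (g 1 0) (g 1 1))
      map_one' := by simpa using hF.one
      map_mul' := fun g g' => by
        have h1 := g.det_coe
        have h2 := g'.det_coe
        rw [Matrix.det_fin_two] at h1 h2
        rw [← ofAdd_add, ← hF.mul h1 h2]
        simp }
  refine ⟨MonoidHom.toAdditiveLeft (Abelianization.lift f), fun a b c d h => ?_⟩
  rw [univ, dif_pos h]
  exact Abelianization.lift_apply_of f (slMk h)

end Universal

/-- There is a homomorphism from `SL₂(R)` to the additive group of `R` which is the identity on
upper unitriangular matrices. -/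
def HasChi (R : Type*) [CommRing R] : Prop :=
  ∃ χ : R → R → R → R → R, IsHom χ ∧ ∀ t, χ 1 t 0 1 = t

theorem hasChi_zmod_three : HasChi (ZMod 3) := ⟨chi, isHom_chi_three, by decide⟩

theorem hasChi_zmod_four : HasChi (ZMod 4) := ⟨chi, isHom_chi_four, by decide⟩

theorem hasChi_punit : HasChi PUnit := ⟨fun _ _ _ _ => 0, ⟨fun _ _ => rfl⟩, fun _ => rfl⟩

theorem HasChi.pi {I R : Type*} [CommRing R] (h : HasChi R) : HasChi (I → R) := by
  obtain ⟨χ, h1, h2⟩ := h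
  refine ⟨fun a b c d i => χ (a i) (b i) (c i) (d i), ⟨fun {a b c d a' b' c' d'} h h' => ?_⟩,
    fun t => funext fun i => h2 _⟩
  funext i
  exact h1.mul (congrFun h i) (congrFun h' i)

instance (a : ZMod 2) : Fintype (QuadraticAlgebra (ZMod 2) a 0) :=
  Fintype.ofEquiv _ (QuadraticAlgebra.equivProd a 0).symm

/-- A formula for a homomorphism from `SL₂(R)` to `R` for certain rings with four elements. -/
def chiTwo {R : Type*} [CommRing R] (a b c d : R) : R :=
  (1 - c ^ 2) * (b * d + c * a + d + 1) + c ^ 3 * (a + d + 1)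

theorem hasChi_quadraticAlgebra (a : ZMod 2) : HasChi (QuadraticAlgebra (ZMod 2) a 0) := by
  have key : ∀ e : ZMod 2, ∀ a b c d : QuadraticAlgebra (ZMod 2) e 0, a * d - b * c = 1 →
      ∀ a' b' c' d' : QuadraticAlgebra (ZMod 2) e 0, a' * d' - b' * c' = 1 →
      chiTwo (a * a' + b * c') (a * b' + b * d') (c * a' + d * c') (c * b' + d * d') =
      chiTwo a b c d + chiTwo a' b' c' d' := by decide +kernel
  have key2 : ∀ e : ZMod 2, ∀ t : QuadraticAlgebra (ZMod 2) e 0, chiTwo 1 t 0 1 = t := by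
    decide +kernel
  exact ⟨chiTwo, ⟨fun h h' => key a _ _ _ _ h _ _ _ _ h'⟩, key2 a⟩

end SL2Ab

namespace SL2Ab

open QuadraticAlgebra

local notation "𝐍" => QuadraticAlgebra.norm (R := ℤ)

namespace Ctx

variable {a b : ℤ} {A : Type*} [CommRing A] [IsDomain A] {ι : Quad a b →+* A} {π : Quad a b}

theorem univ_mem_range_upper (hc : Ctx ι π) {d : ℕ} (hd : Squarefree d) (hm : IsMaximal a b d)
    (x : Additive (Abelianization (Matrix.SpecialLinearGroup (Fin 2) A))) :
    ∃ t, (isHom_univ A).upper t = x := by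
  obtain ⟨p, q, s, t, h, rfl⟩ := exists_univ x
  have hF := (isHom_univ A).comp_addHom (QuotientAddGroup.mk' (isHom_univ A).upper.range)
  have h0 : ∀ t, hF.upper t = 0 := fun t =>
    (QuotientAddGroup.eq_zero_iff _).mpr ⟨t, rfl⟩
  have := hc.eq_zero hF hd hm h0 (p := p) (q := q) (s := s) (t := t) (by linear_combination h)
  exact (QuotientAddGroup.eq_zero_iff _).mp this

theorem nonempty_addEquiv (hc : Ctx ι π) {d : ℕ} (hd : Squarefree d) (hm : IsMaximal a b d)
    (hS : d % 8 = 7 → ∃ p : ℕ, p.Prime ∧ ((IsUnit (p : A) ∧ ¬ p ∣ d) ∨ ∃ m : ℤ,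
      (p : ℤ) ∣ 𝐍 (⟨m, 1⟩ : Quad a b) ∧ ¬ (p ^ 2 : ℤ) ∣ 𝐍 (⟨m, 1⟩ : Quad a b) ∧
      (p : A) ∣ ι ⟨m, 1⟩))
    {R₂ R₃ : Type*} [CommRing R₂] [CommRing R₃] (e₂ : (4 : R₂) = 0) (e₃ : (3 : R₃) = 0)
    (c₂ : HasChi R₂) (c₃ : HasChi R₃) {g₂ : A →+* R₂} {g₃ : A →+* R₃}
    (s₂ : Function.Surjective g₂) (s₃ : Function.Surjective g₃)
    (k₂ : ∀ t, g₂ t = 0 → d % 8 = 3 ∨ d % 8 = 7 ∧ (4 : A) ∣ t ∨ d % 4 ≠ 3 ∧ (2 : A) ∣ t)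
    (k₃ : ∀ t, g₃ t = 0 → d % 3 = 1 ∨ d % 3 = 2 ∧ (3 : A) ∣ t ∨
      d % 3 = 0 ∧ ∃ x y, t = 3 * x + ι (Quad.root b) * y) :
    Nonempty (Additive (Abelianization (Matrix.SpecialLinearGroup (Fin 2) A)) ≃+ R₂ × R₃) := by
  obtain ⟨χ₂, h2, u2⟩ := c₂
  obtain ⟨χ₃, h3, u3⟩ := c₃
  obtain ⟨θ₂, t2⟩ := (h2.comp_ringHom g₂).exists_lift
  obtain ⟨θ₃, t3⟩ := (h3.comp_ringHom g₃).exists_lift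
  have v2 : ∀ t, θ₂ ((isHom_univ A).upper t) = g₂ t := fun t => by
    refine (t2 1 t 0 1 (by ring)).trans ?_
    simp [u2]
  have v3 : ∀ t, θ₃ ((isHom_univ A).upper t) = g₃ t := fun t => by
    refine (t3 1 t 0 1 (by ring)).trans ?_
    simp [u3]
  refine ⟨AddEquiv.ofBijective (θ₂.prod θ₃) ⟨?_, ?_⟩⟩
  · rw [injective_iff_map_eq_zero]
    intro x hx
    obtain ⟨t, rfl⟩ := hc.univ_mem_range_upper hd hm x
    rw [AddMonoidHom.prod_apply, v2, v3, Prod.mk_eq_zero] at hx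
    exact hc.upper_eq_zero (isHom_univ A) hd hm hS (k₂ t hx.1) (k₃ t hx.2)
  · rintro ⟨x, y⟩
    obtain ⟨x, rfl⟩ := s₂ x
    obtain ⟨y, rfl⟩ := s₃ y
    refine ⟨(isHom_univ A).upper (9 * x - 8 * y), ?_⟩
    rw [AddMonoidHom.prod_apply, v2, v3, map_sub, map_sub, map_mul, map_mul, map_mul, map_mul,
      map_ofNat, map_ofNat, map_ofNat, map_ofNat]
    exact Prod.ext (by linear_combination (2 * g₂ x - 2 * g₂ y) * e₂)
      (by linear_combination (3 * g₃ x - 3 * g₃ y) * e₃)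

end Ctx

end SL2Ab

namespace SL2Ab

open QuadraticAlgebra

namespace Ctx

variable {a b : ℤ} {A : Type*} [CommRing A] {ι : Quad a b →+* A} {π : Quad a b}

theorem exists_extension (hc : Ctx ι π) {R : Type*} [CommRing R] {f : Quad a b →+* R}
    (hu : IsUnit (f π)) :
    ∃ g : A →+* R, ∀ y, g (ι y) = f y := by
  let := ι.toAlgebra
  have : IsLocalization.Away π A := by
    refine IsLocalization.Away.mk π hc.unit (fun x => ?_) (fun x y h => ?_)
    · obtain ⟨k, y, h⟩ := hc.den x
      exact ⟨k, y, by rw [mul_comm]; exact h⟩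
    · exact ⟨0, by rw [hc.inj h]⟩
  exact ⟨IsLocalization.Away.lift π hu, fun y => IsLocalization.Away.lift_eq π hu y⟩

theorem mem_map (hc : Ctx ι π) {J : Ideal (Quad a b)} {k : ℕ} {t : A} {y : Quad a b}
    (h : ι π ^ k * t = ι y)
    (hy : π ^ 2 * y ∈ J) : t ∈ J.map ι := by
  have h2 : ι π ^ (k + 2) * t ∈ J.map ι := by
    have := Ideal.mem_map_of_mem ι hy
    rwa [map_mul, map_pow, ← h, ← mul_assoc, ← pow_add, add_comm 2 k] at this
  exact (Ideal.unit_mul_mem_iff_mem _ (hc.unit.pow _)).mp h2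

/-- Extending a homomorphism as far as possible: `k` is the number of extensions. -/
theorem exists_extension_one (hc : Ctx ι π) {R : Type*} [CommRing R] {f : Quad a b →+* R}
    (hf : Function.Surjective f) {J : Ideal (Quad a b)}
      (hJ : ∀ y, f (π ^ 2 * y) = 0 → π ^ 2 * y ∈ J)
    {k : ℕ}
    (hk : IsUnit (f π) ∧ k = 1 ∨ f π ^ 2 = 0 ∧ k = 0) :
    ∃ g : A →+* (Fin k → R), Function.Surjective g ∧ ∀ t, g t = 0 → t ∈ J.map ι := by
  rcases hk with ⟨hu, rfl⟩ | ⟨hu, rfl⟩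
  · obtain ⟨g, hg⟩ := hc.exists_extension hu
    refine ⟨RingHom.pi fun _ => g, fun x => ?_, fun t ht => ?_⟩
    · obtain ⟨y, hy⟩ := hf (x 0)
      refine ⟨ι y, funext fun i => ?_⟩
      rw [Subsingleton.elim i 0, ← hy, ← hg]
      rfl
    · obtain ⟨k, y, h⟩ := hc.den t
      refine hc.mem_map h (hJ _ ?_)
      have ht : g t = 0 := congrFun ht 0
      rw [map_mul, ← hg y, ← h, map_mul g, ht, mul_zero, mul_zero]
  · refine ⟨RingHom.pi fun i => i.elim0, fun x => ⟨0, Subsingleton.elim _ _⟩, fun t _ => ?_⟩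
    obtain ⟨k, y, h⟩ := hc.den t
    refine hc.mem_map h (hJ _ ?_)
    rw [map_mul, map_pow, hu, zero_mul]

/-- Extending two independent homomorphisms as far as possible. -/
theorem exists_extension_two (hc : Ctx ι π) {R : Type*} [CommRing R] {f₁ f₂ : Quad a b →+* R}
    (hf : ∀ u v, ∃ y, f₁ y = u ∧ f₂ y = v) {J : Ideal (Quad a b)}
    (hJ : ∀ y, f₁ y = 0 → f₂ y = 0 → y ∈ J) {k₁ k₂ : ℕ}
    (hk₁ : IsUnit (f₁ π) ∧ k₁ = 1 ∨ f₁ π ^ 2 = 0 ∧ k₁ = 0)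
    (hk₂ : IsUnit (f₂ π) ∧ k₂ = 1 ∨ f₂ π ^ 2 = 0 ∧ k₂ = 0) :
    ∃ g : A →+* (Fin (k₁ + k₂) → R), Function.Surjective g ∧ ∀ t, g t = 0 → t ∈ J.map ι := by
  rcases hk₁ with ⟨h₁, rfl⟩ | ⟨h₁, rfl⟩ <;> rcases hk₂ with ⟨h₂, rfl⟩ | ⟨h₂, rfl⟩
  · obtain ⟨g₁, hg₁⟩ := hc.exists_extension h₁
    obtain ⟨g₂, hg₂⟩ := hc.exists_extension h₂
    refine ⟨RingHom.pi ![g₁, g₂], fun x => ?_, fun t ht => ?_⟩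
    · obtain ⟨y, h1, h2⟩ := hf (x 0) (x 1)
      refine ⟨ι y, funext fun i => ?_⟩
      fin_cases i
      exacts [(hg₁ y).trans h1, (hg₂ y).trans h2]
    · obtain ⟨k, y, h⟩ := hc.den t
      have t₁ : g₁ t = 0 := congrFun ht 0
      have t₂ : g₂ t = 0 := congrFun ht 1
      refine hc.mem_map h (hJ _ ?_ ?_)
      · rw [map_mul, ← hg₁ y, ← h, map_mul g₁, t₁, mul_zero, mul_zero]
      · rw [map_mul, ← hg₂ y, ← h, map_mul g₂, t₂, mul_zero, mul_zero]
  · exact hc.exists_extension_one (f := f₁) (k := 1) (fun u => (hf u 0).imp fun _ h => h.1)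
      (fun y h => hJ _ h (by rw [map_mul, map_pow, h₂, zero_mul])) (.inl ⟨h₁, rfl⟩)
  · exact hc.exists_extension_one (f := f₂) (k := 1) (fun u => (hf 0 u).imp fun _ h => h.2)
      (fun y h => hJ _ (by rw [map_mul, map_pow, h₁, zero_mul]) h) (.inl ⟨h₂, rfl⟩)
  · exact hc.exists_extension_one (f := f₂) (k := 0) (fun u => (hf 0 u).imp fun _ h => h.2)
      (fun y h => hJ _ (by rw [map_mul, map_pow, h₁, zero_mul]) h) (.inr ⟨h₂, rfl⟩)

end Ctx

theorem beta_of_mem {X : Type*} {S : Finset X} {x : X} (h : x ∈ S) : beta S x = 0 := by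
  simp [beta, h]

theorem beta_of_notMem {X : Type*} {S : Finset X} {x : X} (h : x ∉ S) : beta S x = 1 := by
  simp [beta, h]

/-- The homomorphism from a quadratic order given by a root of the defining equation. -/
def Quad.toRing {a b : ℤ} {R : Type*} [CommRing R] {r : R} (hr : r ^ 2 = a + b * r) :
    Quad a b →+* R where
  toFun z := z.re + z.im * r
  map_one' := by simp
  map_zero' := by simp
  map_add' x y := by simp; ring
  map_mul' x y := by simp; linear_combination (-(x.im : R) * y.im) * hr

theorem Quad.toRing_apply {a b : ℤ} {R : Type*} [CommRing R] {r : R} (hr : r ^ 2 = a + b * r)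
    (z : Quad a b) : Quad.toRing hr z = z.re + z.im * r := rfl

/-- Every element is either a unit or has square zero, according to its image in a residue field. -/
def IsLocalMap {R k : Type*} [CommRing R] [CommRing k] (ρ : R →+* k) : Prop :=
  ∀ x, (ρ x = 0 → x ^ 2 = 0) ∧ (ρ x ≠ 0 → IsUnit x)

theorem isLocalMap_three : IsLocalMap (RingHom.id (ZMod 3)) := by
  have : ∀ x : ZMod 3, (x = 0 → x ^ 2 = 0) ∧ (x ≠ 0 → ∃ y, x * y = 1) := by decide
  exact fun x => ⟨(this x).1, fun h => IsUnit.of_mul_eq_one _ ((this x).2 h).choose_spec⟩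

theorem isLocalMap_four : IsLocalMap (ZMod.castHom (show 2 ∣ 4 by norm_num) (ZMod 2)) := by
  have : ∀ x : ZMod 4, (ZMod.castHom (show 2 ∣ 4 by norm_num) (ZMod 2) x = 0 → x ^ 2 = 0) ∧
    (ZMod.castHom (show 2 ∣ 4 by norm_num) (ZMod 2) x ≠ 0 → ∃ y, x * y = 1) := by decide
  exact fun x => ⟨(this x).1, fun h => IsUnit.of_mul_eq_one _ ((this x).2 h).choose_spec⟩

/-- The residue map of a ramified quadratic algebra over the field with two elements. -/
def residueTwo (a : ZMod 2) : QuadraticAlgebra (ZMod 2) a 0 →+* ZMod 2 where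
  toFun z := z.re + z.im * a
  map_one' := by simp
  map_zero' := by simp
  map_add' x y := by simp; ring
  map_mul' x y := by
    have : a ^ 2 = a := by revert a; decide
    simp; linear_combination (- x.im * y.im) * this

theorem isLocalMap_residueTwo (a : ZMod 2) : IsLocalMap (residueTwo a) := by
  have : ∀ a : ZMod 2, ∀ x : QuadraticAlgebra (ZMod 2) a 0, (residueTwo a x = 0 → x ^ 2 = 0) ∧
    (residueTwo a x ≠ 0 → ∃ y, x * y = 1) := by decide +kernel
  exact fun x => ⟨(this a x).1, fun h => IsUnit.of_mul_eq_one _ ((this a x).2 h).choose_spec⟩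

/-- The primes above a rational prime are the kernels of homomorphisms to the prime field. -/
theorem ker_eq_or {B : Type*} [CommRing B] [IsDedekindDomain B] {l : ℕ} [Fact l.Prime]
    (f : B →+* ZMod l)
    {p q : HeightOneSpectrum B} (h : Ideal.span {(l : B)} = p.asIdeal * q.asIdeal) :
    RingHom.ker f = p.asIdeal ∨ RingHom.ker f = q.asIdeal := by
  have hk : p.asIdeal * q.asIdeal ≤ RingHom.ker f := by
    rw [← h, Ideal.span_le, Set.singleton_subset_iff]
    simp [RingHom.mem_ker]
  have hne : RingHom.ker f ≠ ⊤ := RingHom.ker_ne_top f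
  rcases (Ideal.IsPrime.mul_le (RingHom.ker_isPrime f)).mp hk with h | h
  · exact .inl (p.isMaximal.eq_of_le hne h).symm
  · exact .inr (q.isMaximal.eq_of_le hne h).symm

section Local

variable {a b : ℤ} {π : Quad a b} {B : Type*} [CommRing B] {φ : Quad a b ≃+* B}
  {S : Finset (HeightOneSpectrum B)} (hπ : ∀ q : HeightOneSpectrum B, φ π ∈ q.asIdeal ↔ q ∈ S)
include hπ

theorem isUnit_and_beta {R k : Type*} [CommRing R] [CommRing k] {ρ : R →+* k} (hρ : IsLocalMap ρ)
    (f : Quad a b →+* R) {p : HeightOneSpectrum B}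
    (h : RingHom.ker ((ρ.comp f).comp φ.symm.toRingHom) = p.asIdeal) :
    IsUnit (f π) ∧ beta S p = 1 ∨ f π ^ 2 = 0 ∧ beta S p = 0 := by
  have key : ρ (f π) = 0 ↔ p ∈ S := by
    rw [← hπ, ← h, RingHom.mem_ker]
    simp
  by_cases hp : p ∈ S
  · exact .inr ⟨(hρ _).1 (key.mpr hp), beta_of_mem hp⟩
  · exact .inl ⟨(hρ _).2 (mt key.mp hp), beta_of_notMem hp⟩

variable [IsDedekindDomain B] {A : Type*} [CommRing A] {ι : Quad a b →+* A} (hc : Ctx ι π)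
include hc

theorem exists_of_sq {R : Type*} [CommRing R] {l : ℕ} [Fact l.Prime] {ρ : R →+* ZMod l}
    (hρ : IsLocalMap ρ) {f : Quad a b →+* R}
    (hf : Function.Surjective f) {J : Ideal (Quad a b)} (hJ : ∀ y, f y = 0 → y ∈ J)
    {p : HeightOneSpectrum B} (h : Ideal.span {(l : B)} = p.asIdeal ^ 2) :
    ∃ g : A →+* (Fin (beta S p) → R), Function.Surjective g ∧ ∀ t, g t = 0 → t ∈ J.map ι := by
  rw [pow_two] at h
  refine hc.exists_extension_one hf (fun y => hJ _) (isUnit_and_beta hπ hρ f ?_)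
  exact (or_self_iff).mp (ker_eq_or _ h)

theorem exists_of_mul {n l : ℕ} [Fact l.Prime] {ρ : ZMod n →+* ZMod l} (hρ : IsLocalMap ρ)
    {r : ZMod n} (h₁ : r ^ 2 = a + b * r) (h₂ : (r + 1) ^ 2 = a + b * (r + 1))
    {p q : HeightOneSpectrum B} (h : Ideal.span {(l : B)} = p.asIdeal * q.asIdeal) :
    ∃ g : A →+* (Fin (beta S p + beta S q) → ZMod n), Function.Surjective g ∧
      ∀ t, g t = 0 → (n : A) ∣ t := by
  have hf : ∀ u v : ZMod n, ∃ y, Quad.toRing h₁ y = u ∧ Quad.toRing h₂ y = v := fun u v => by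
    obtain ⟨x, hx⟩ := ZMod.intCast_surjective (u - (v - u) * r)
    obtain ⟨y, hy⟩ := ZMod.intCast_surjective (v - u)
    refine ⟨⟨x, y⟩, ?_, ?_⟩ <;> simp only [Quad.toRing_apply, hx, hy] <;> ring
  have hJ : ∀ y, Quad.toRing h₁ y = 0 → Quad.toRing h₂ y = 0 → (n : Quad a b) ∣ y := by
    intro y e₁ e₂
    simp only [Quad.toRing_apply] at e₁ e₂
    have e₃ : (y.im : ZMod n) = 0 := by linear_combination e₂ - e₁
    have e₄ : (y.re : ZMod n) = 0 := by linear_combination e₁ - r * e₃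
    rw [ZMod.intCast_zmod_eq_zero_iff_dvd] at e₃ e₄
    exact_mod_cast (Quad.intCast_dvd_iff (n := (n : ℤ))).mpr ⟨e₄, e₃⟩
  suffices ∃ g : A →+* (Fin (beta S p + beta S q) → ZMod n), Function.Surjective g ∧
      ∀ t, g t = 0 → t ∈ (Ideal.span {(n : Quad a b)}).map ι by
    obtain ⟨g, h, h'⟩ := this
    refine ⟨g, h, fun t ht => ?_⟩
    have := h' t ht
    rwa [Ideal.map_span, Set.image_singleton, Ideal.mem_span_singleton, map_natCast] at this
  set σ := φ.symm.toRingHom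
  have hne : RingHom.ker ((ρ.comp (Quad.toRing h₁)).comp σ) ≠
      RingHom.ker ((ρ.comp (Quad.toRing h₂)).comp σ) := fun he => by
    obtain ⟨y, h1, h2⟩ := hf 0 1
    have : φ y ∈ RingHom.ker ((ρ.comp (Quad.toRing h₁)).comp σ) := by simp [RingHom.mem_ker, σ, h1]
    rw [he] at this
    simp [RingHom.mem_ker, σ, h2] at this
  rcases ker_eq_or ((ρ.comp (Quad.toRing h₁)).comp σ) h with k₁ | k₁ <;>
    rcases ker_eq_or ((ρ.comp (Quad.toRing h₂)).comp σ) h with k₂ | k₂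
  · exact absurd (k₁.trans k₂.symm) hne
  · exact hc.exists_extension_two hf (fun y e₁ e₂ => Ideal.mem_span_singleton.mpr (hJ y e₁ e₂))
      (isUnit_and_beta hπ hρ _ k₁) (isUnit_and_beta hπ hρ _ k₂)
  · exact hc.exists_extension_two (fun u v => (hf v u).imp fun _ h => h.symm)
      (fun y e₁ e₂ => Ideal.mem_span_singleton.mpr (hJ y e₂ e₁))
      (isUnit_and_beta hπ hρ _ k₂) (isUnit_and_beta hπ hρ _ k₁)
  · exact absurd (k₁.trans k₂.symm) hne

variable {d : ℕ} (hm : IsMaximal a b d)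
include hm

theorem exists_two_split (hd : d % 8 = 7) {p q : HeightOneSpectrum B}
    (h : Ideal.span {(2 : B)} = p.asIdeal * q.asIdeal) :
    ∃ g : A →+* (Fin (beta S p + beta S q) → ZMod 4), Function.Surjective g ∧
      ∀ t, g t = 0 → (4 : A) ∣ t := by
  rcases hm with ⟨-, -, _⟩ | ⟨rfl, hm⟩
  · omega
  obtain ⟨c, rfl⟩ : ∃ c, a = 2 * c := ⟨a / 2, by omega⟩
  have h4 : (4 : ZMod 4) = 0 := rfl
  refine exists_of_mul (n := 4) (l := 2) hπ hc isLocalMap_four (r := 2 * c) ?_ ?_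
    (by exact_mod_cast h)
  · push_cast
    linear_combination (c ^ 2 - c : ZMod 4) * h4
  · push_cast
    linear_combination (c ^ 2 : ZMod 4) * h4

theorem exists_three_split (hd : d % 3 = 2) {p q : HeightOneSpectrum B}
    (h : Ideal.span {(3 : B)} = p.asIdeal * q.asIdeal) :
    ∃ g : A →+* (Fin (beta S p + beta S q) → ZMod 3), Function.Surjective g ∧
      ∀ t, g t = 0 → (3 : A) ∣ t := by
  have h3 : (3 : ZMod 3) = 0 := rfl
  have key : ∃ c, a = 3 * c + 1 - b ∧ (b = 0 ∨ b = 1) := by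
    refine ⟨(a - 1 + b) / 3, ?_⟩
    rcases hm with ⟨rfl, rfl, -⟩ | ⟨rfl, hm⟩ <;> omega
  obtain ⟨c, rfl, hb⟩ := key
  refine exists_of_mul (n := 3) (l := 3) hπ hc isLocalMap_three (r := 1 - b) ?_ ?_
    (by exact_mod_cast h)
  · rcases hb with rfl | rfl
    · push_cast; linear_combination (-c : ZMod 3) * h3
    · push_cast; linear_combination (-c : ZMod 3) * h3
  · rcases hb with rfl | rfl
    · push_cast; linear_combination (-c + 1 : ZMod 3) * h3
    · push_cast; linear_combination (-c : ZMod 3) * h3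

theorem exists_three_ramified (hd : d % 3 = 0) {p : HeightOneSpectrum B}
    (h : Ideal.span {(3 : B)} = p.asIdeal ^ 2) :
    ∃ g : A →+* (Fin (beta S p) → ZMod 3), Function.Surjective g ∧
      ∀ t, g t = 0 → ∃ x y, t = 3 * x + ι (Quad.root b) * y := by
  have h3 : (3 : ZMod 3) = 0 := rfl
  have key : ∃ c, a = 3 * c - b ∧ (b = 0 ∨ b = 1) := by
    refine ⟨(a + b) / 3, ?_⟩
    rcases hm with ⟨rfl, rfl, -⟩ | ⟨rfl, hm⟩ <;> omega
  obtain ⟨c, rfl, hb⟩ := key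
  have hr : (2 * b : ZMod 3) ^ 2 = ((3 * c - b : ℤ) : ZMod 3) + b * (2 * b) := by
    rcases hb with rfl | rfl
    · push_cast; linear_combination (-c : ZMod 3) * h3
    · push_cast; linear_combination (-c + 1 : ZMod 3) * h3
  have hs : Function.Surjective (Quad.toRing hr) := fun u => by
    obtain ⟨x, hx⟩ := ZMod.intCast_surjective u
    exact ⟨⟨x, 0⟩, by simp [Quad.toRing_apply, hx]⟩
  have hk : ∀ y, Quad.toRing hr y = 0 → y ∈ Ideal.span {(3 : Quad (3 * c - b) b), Quad.root b} :=
    fun y hy => by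
    rw [Quad.toRing_apply] at hy
    have : ((y.re + y.im * (2 * b) : ℤ) : ZMod 3) = 0 := by push_cast; exact hy
    rw [ZMod.intCast_zmod_eq_zero_iff_dvd] at this
    obtain ⟨k, hk⟩ := this
    push_cast at hk
    rw [Ideal.mem_span_pair]
    rcases hb with rfl | rfl
    · refine ⟨⟨k, 0⟩, ⟨y.im, 0⟩, ?_⟩
      ext
      · simp [Quad.root]; linarith
      · simp [Quad.root]
    · refine ⟨⟨k - y.im, y.im⟩, ⟨-y.im, 0⟩, ?_⟩
      ext
      · simp [Quad.root]; linarith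
      · simp [Quad.root]; ring
  obtain ⟨g, hg, hg'⟩ := exists_of_sq (l := 3) hπ hc isLocalMap_three (f := Quad.toRing hr)
    hs (J := Ideal.span {(3 : Quad (3 * c - b) b), Quad.root b}) hk
    (p := p) (by exact_mod_cast h)
  refine ⟨g, hg, fun t ht => ?_⟩
  have := hg' t ht
  rw [Ideal.map_span, Set.image_pair, Ideal.mem_span_pair, map_ofNat] at this
  obtain ⟨x, y, e⟩ := this
  exact ⟨x, y, by rw [← e]; ring⟩
theorem exists_two_ramified (hd : d % 4 ≠ 3) {p : HeightOneSpectrum B}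
    (h : Ideal.span {(2 : B)} = p.asIdeal ^ 2) :
    ∃ g : A →+* (Fin (beta S p) → QuadraticAlgebra (ZMod 2) a 0), Function.Surjective g ∧
      ∀ t, g t = 0 → (2 : A) ∣ t := by
  rcases hm with ⟨rfl, -, _⟩ | ⟨rfl, hm⟩
  swap
  · omega
  have hr : (⟨0, 1⟩ : QuadraticAlgebra (ZMod 2) a 0) ^ 2 = a +
    ((0 : ℤ) : QuadraticAlgebra (ZMod 2) a 0) * ⟨0, 1⟩ := by
    rw [pow_two]
    ext <;> simp
  have hs : Function.Surjective (Quad.toRing hr) := fun u => by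
    obtain ⟨x, hx⟩ := ZMod.intCast_surjective u.re
    obtain ⟨y, hy⟩ := ZMod.intCast_surjective u.im
    refine ⟨⟨x, y⟩, ?_⟩
    ext <;> simp [Quad.toRing_apply, hx, hy]
  have hk : ∀ y, Quad.toRing hr y = 0 → y ∈ Ideal.span {(2 : Quad a 0)} := fun y hy => by
    rw [Quad.toRing_apply] at hy
    have h1 := congrArg QuadraticAlgebra.re hy
    have h2 := congrArg QuadraticAlgebra.im hy
    simp at h1 h2
    have h1 := (ZMod.intCast_zmod_eq_zero_iff_dvd _ 2).mp h1
    have h2 := (ZMod.intCast_zmod_eq_zero_iff_dvd _ 2).mp h2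
    rw [Ideal.mem_span_singleton]
    exact_mod_cast (Quad.intCast_dvd_iff (n := 2)).mpr ⟨by exact_mod_cast h1, by exact_mod_cast h2⟩
  obtain ⟨g, hg, hg'⟩ := exists_of_sq (l := 2) hπ hc (isLocalMap_residueTwo a) (f := Quad.toRing hr)
    hs (J := Ideal.span {(2 : Quad a 0)}) hk
    (p := p) (by exact_mod_cast h)
  refine ⟨g, hg, fun t ht => ?_⟩
  have := hg' t ht
  rwa [Ideal.map_span, Set.image_singleton, Ideal.mem_span_singleton, map_ofNat] at this

end Local

end SL2Ab

namespace SL2Ab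

open QuadraticAlgebra Polynomial
theorem exists_int_eq_of_squarefree {d : ℕ} (hd : Squarefree d) {w : ℚ} {k : ℤ}
    (h : (d : ℚ) * w ^ 2 = k) :
    ∃ n : ℤ, w = n := by
  have e : (d : ℤ) * w.num ^ 2 = k * (w.den : ℤ) ^ 2 := by
    have h0 : (w.den : ℚ) ≠ 0 := by exact_mod_cast w.den_ne_zero
    have h1 : w * w.den = w.num := Rat.mul_den_eq_num w
    have : (d : ℚ) * (w.num : ℚ) ^ 2 = k * (w.den : ℚ) ^ 2 := by
      rw [← h1, ← h]; ring
    exact_mod_cast this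
  have hc : IsCoprime ((w.den : ℤ) ^ 2) (w.num ^ 2) := by
    apply IsCoprime.pow
    rw [Int.isCoprime_iff_gcd_eq_one]
    have := w.reduced
    rw [Int.gcd_comm]
    simpa [Int.gcd, Nat.Coprime] using this
  have h2 : (w.den : ℤ) ^ 2 ∣ d := hc.dvd_of_dvd_mul_right ⟨k, by rw [e]; ring⟩
  have h3 : w.den * w.den ∣ d := by
    rw [← pow_two]
    exact_mod_cast h2
  have h4 : w.den = 1 := Nat.isUnit_iff.mp (hd _ h3)
  exact ⟨w.num, by rw [← Rat.mul_den_eq_num w, h4]; simp⟩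

variable {K : Type*} [Field K] [NumberField K] {d : ℕ} {α : K}

theorem eq_zero_of_add_mul (hd0 : 0 < d) (hα : α ^ 2 = -(d : K)) {u v : ℚ}
    (h : (u : K) + v * α = 0) :
    u = 0 ∧ v = 0 := by
  have hK : ((u ^ 2 + d * v ^ 2 : ℚ) : K) = 0 := by
    push_cast
    linear_combination (u - v * α : K) * h + (v : K) ^ 2 * hα
  have hQ : u ^ 2 + d * v ^ 2 = 0 := by exact_mod_cast hK
  have hd' : (0 : ℚ) < d := by exact_mod_cast hd0
  have hv : v = 0 := by
    by_contra hv
    have : 0 < d * v ^ 2 := by positivity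
    nlinarith [sq_nonneg u]
  rw [hv] at hQ
  exact ⟨by simpa using hQ, hv⟩

theorem exists_add_mul (hd0 : 0 < d) (hdeg : Module.finrank ℚ K = 2) (hα : α ^ 2 = -(d : K))
    (x : K) :
    ∃ u v : ℚ, x = u + v * α := by
  have hli : LinearIndependent ℚ ![(1 : K), α] := by
    rw [LinearIndependent.pair_iff]
    intro s t h
    refine eq_zero_of_add_mul hd0 hα (u := s) (v := t) ?_
    simpa [Algebra.smul_def] using h
  have hx : x ∈ Submodule.span ℚ (Set.range ![(1 : K), α]) := by
    rw [hli.span_eq_top_of_card_eq_finrank' (by simp [hdeg])]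
    trivial
  simp only [Matrix.range_cons, Matrix.range_empty, Set.union_empty, Set.singleton_union,
    Submodule.mem_span_pair] at hx
  obtain ⟨u, v, h⟩ := hx
  exact ⟨u, v, by rw [← h]; simp [Algebra.smul_def]⟩

theorem exists_int_of_isIntegral (hd0 : 0 < d) (hα : α ^ 2 = -(d : K)) {u v : ℚ}
    (h : IsIntegral ℤ ((u : K) + v * α)) :
    (∃ m : ℤ, 2 * u = m) ∧ ∃ k : ℤ, u ^ 2 + d * v ^ 2 = k := by
  by_cases hv : v = 0
  · subst hv
    obtain ⟨m, hm⟩ : ∃ m : ℤ, algebraMap ℤ ℚ m = u := by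
      refine IsIntegrallyClosed.isIntegral_iff.mp ?_
      rw [← isIntegral_algebraMap_iff (algebraMap ℚ K).injective]
      simpa using h
    exact ⟨⟨2 * m, by rw [← hm]; simp⟩, ⟨m ^ 2, by rw [← hm]; simp⟩⟩
  · set x : K := u + v * α with hx
    obtain ⟨c, hc⟩ : ∃ c, c = u ^ 2 + d * v ^ 2 := ⟨_, rfl⟩
    set P : ℚ[X] := X ^ 2 + C (-2 * u) * X + C c with hP
    have hdegP : P.natDegree = 2 := by rw [hP]; compute_degree!
    have hmon : P.Monic := by rw [hP]; monicity!
    have hroot : aeval x P = 0 := by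
      simp [hP, hx, hc]
      linear_combination (v : K) ^ 2 * hα
    have hxQ : IsIntegral ℚ x := h.tower_top
    have h2 : 2 ≤ (minpoly ℚ x).natDegree := by
      rw [minpoly.two_le_natDegree_iff hxQ]
      rintro ⟨q, hq⟩
      have : ((u - q : ℚ) : K) + v * α = 0 := by
        have hq : (q : K) = x := by simpa using hq
        push_cast
        rw [hq, hx]
        ring
      exact hv (eq_zero_of_add_mul hd0 hα this).2
    have heq : P = minpoly ℚ x :=
      eq_of_monic_of_dvd_of_natDegree_le (minpoly.monic hxQ) hmon (minpoly.dvd ℚ x hroot)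
        (by rw [hdegP]; exact h2)
    rw [minpoly.isIntegrallyClosed_eq_field_fractions' ℚ h] at heq
    constructor
    · refine ⟨-(minpoly ℤ x).coeff 1, ?_⟩
      have := congrArg (fun p => p.coeff 1) heq
      simp [hP] at this
      push_cast
      linarith
    · refine ⟨(minpoly ℤ x).coeff 0, ?_⟩
      have := congrArg (fun p => p.coeff 0) heq
      simp [hP] at this
      rw [← hc, this]

theorem exists_quad_of_root {a b : ℤ} (hd0 : 0 < d) (hα : α ^ 2 = -(d : K)) {θ : K} {r s : ℚ}
    (hs : s ≠ 0)
    (hθ : θ = r + s * α) (h : θ ^ 2 = a + b * θ)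
    (hInt : ∀ x : K, IsIntegral ℤ x → ∃ m n : ℤ, x = m + n * θ) :
    Nonempty (Quad a b ≃+* 𝓞 K) := by
  have hθi : IsIntegral ℤ θ := by
    refine ⟨X ^ 2 + (-(C b * X + C a)), monic_X_pow_add (by compute_degree!), ?_⟩
    simp only [eval₂_add, eval₂_pow, eval₂_neg, eval₂_mul, eval₂_C, eval₂_X, algebraMap_int_eq]
    simp only [eq_intCast]
    linear_combination h
  let w : 𝓞 K := ⟨θ, hθi⟩
  have hω : w ^ 2 = a + b * w := by
    apply RingOfIntegers.ext
    change algebraMap (𝓞 K) K (w ^ 2) = algebraMap (𝓞 K) K (a + b * w)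
    rw [map_pow, map_add, map_mul, map_intCast, map_intCast]
    exact h
  refine ⟨RingEquiv.ofBijective (Quad.toRing hω) ⟨?_, ?_⟩⟩
  · rw [injective_iff_map_eq_zero]
    intro z hz
    have h0 := congrArg (algebraMap (𝓞 K) K) hz
    rw [Quad.toRing_apply, map_add, map_mul, map_intCast, map_intCast, map_zero] at h0
    change (z.re : K) + z.im * θ = 0 at h0
    have h1 := eq_zero_of_add_mul hd0 hα (u := z.re + z.im * r) (v := z.im * s) (by
      push_cast
      linear_combination h0 - (z.im : K) * hθ)
    have h2 : z.im = 0 := by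
      have := h1.2
      simpa [hs] using this
    have h3 := h1.1
    rw [h2] at h3
    ext
    · simpa using h3
    · simpa using h2
  · intro x
    obtain ⟨m, n, e⟩ := hInt x x.isIntegral_coe
    refine ⟨⟨m, n⟩, RingOfIntegers.ext ?_⟩
    rw [e]
    change algebraMap (𝓞 K) K (m + n * w) = _
    rw [map_add, map_mul, map_intCast, map_intCast]
    rfl

/-- The ring of integers of an imaginary quadratic field. -/
theorem exists_quad (hd0 : 0 < d) (hd : Squarefree d) (hdeg : Module.finrank ℚ K = 2)
    (hα : α ^ 2 = -(d : K)) : ∃ a b : ℤ, IsMaximal a b d ∧ Nonempty (Quad a b ≃+* 𝓞 K) := by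
  have key : ∀ x : K, IsIntegral ℤ x → ∃ m n k : ℤ, 2 * x = m + n * α ∧
    m ^ 2 + d * n ^ 2 = 4 * k := by
    intro x hx
    obtain ⟨u, v, rfl⟩ := exists_add_mul hd0 hdeg hα x
    obtain ⟨⟨m, hm⟩, k, hk⟩ := exists_int_of_isIntegral hd0 hα hx
    obtain ⟨n, hn⟩ := exists_int_eq_of_squarefree hd (w := 2 * v) (k := 4 * k - m ^ 2) (by
      push_cast
      rw [← hk, ← hm]
      ring)
    refine ⟨m, n, k, ?_, ?_⟩
    · have h1 := congrArg (fun q : ℚ => (q : K)) hm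
      have h2 := congrArg (fun q : ℚ => (q : K)) hn
      push_cast at h1 h2
      linear_combination h1 + α * h2
    · have : (m : ℚ) ^ 2 + d * n ^ 2 = 4 * k := by
        rw [← hm, ← hn, ← hk]
        ring
      exact_mod_cast this
  have h2K : (2 : K) ≠ 0 := two_ne_zero
  by_cases h3 : d % 4 = 3
  · refine ⟨-((d + 1) / 4 : ℕ), 1, .inr ⟨rfl, by omega⟩,
      exists_quad_of_root hd0 hα (θ := (1 + α) / 2)
      (r := 1 / 2) (s := 1 / 2) (by norm_num) (by push_cast; ring) ?_ fun x hx => ?_⟩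
    · obtain ⟨e, he⟩ : ∃ e, d = 4 * e + 3 := ⟨d / 4, by omega⟩
      rw [show (d + 1) / 4 = e + 1 by omega]
      rw [he] at hα
      push_cast at hα ⊢
      field_simp
      linear_combination hα
    · obtain ⟨m, n, k, h1, h2⟩ := key x hx
      obtain ⟨j, hj⟩ : ∃ j, m - n = 2 * j := by
        obtain ⟨e, he⟩ : ∃ e, d = 4 * e + 3 := ⟨d / 4, by omega⟩
        rw [he] at h2
        push_cast at h2
        have : Even ((m - n) * (m + n)) := ⟨2 * (k - e * n ^ 2 - n ^ 2), by linear_combination h2⟩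
        rcases Int.even_mul.mp this with ⟨c, h⟩ | ⟨c, h⟩
        · exact ⟨c, by linarith⟩
        · exact ⟨c - n, by linarith⟩
      refine ⟨j, n, mul_left_cancel₀ h2K ?_⟩
      have hj' := congrArg (fun z : ℤ => (z : K)) hj
      push_cast at hj'
      field_simp
      linear_combination h1 + hj'
  · refine ⟨-d, 0, .inl ⟨rfl, rfl, h3⟩, exists_quad_of_root hd0 hα (θ := α)
      (r := 0) (s := 1) (by norm_num) (by push_cast; ring) (by push_cast; linear_combination hα)
      fun x hx => ?_⟩
    obtain ⟨m, n, k, h1, h2⟩ := key x hx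
    have hd4 : d % 4 = 1 ∨ d % 4 = 2 := by
      have : d % 4 ≠ 0 := fun h => by
        have := hd 2 (Nat.dvd_of_mod_eq_zero h)
        exact absurd (Nat.isUnit_iff.mp this) (by norm_num)
      omega
    have h4 : (m : ZMod 4) ^ 2 + d * (n : ZMod 4) ^ 2 = 0 := by
      have := congrArg (fun z : ℤ => (z : ZMod 4)) h2
      push_cast at this
      rw [this, show (4 : ZMod 4) = 0 from rfl, zero_mul]
    have hmn : 2 * (m : ZMod 4) = 0 ∧ 2 * (n : ZMod 4) = 0 := by
      rw [← ZMod.natCast_mod] at h4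
      generalize (m : ZMod 4) = m at *
      generalize (n : ZMod 4) = n at *
      rcases hd4 with h | h <;> rw [h] at h4 <;> revert m n <;> decide
    obtain ⟨i, hi⟩ : ∃ i, m = 2 * i := by
      have := (ZMod.intCast_zmod_eq_zero_iff_dvd (2 * m) 4).mp (by exact_mod_cast hmn.1)
      exact ⟨m / 2, by omega⟩
    obtain ⟨j, hj⟩ : ∃ j, n = 2 * j := by
      have := (ZMod.intCast_zmod_eq_zero_iff_dvd (2 * n) 4).mp (by exact_mod_cast hmn.2)
      exact ⟨n / 2, by omega⟩
    refine ⟨i, j, mul_left_cancel₀ h2K ?_⟩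
    rw [h1, hi, hj]
    push_cast
    ring

end SL2Ab

namespace SL2Ab

open QuadraticAlgebra

local notation "𝐍" => QuadraticAlgebra.norm (R := ℤ)

section Dedekind

variable {B : Type*} [CommRing B] [IsDedekindDomain B]

theorem exists_generator [Finite (ClassGroup B)] (q : HeightOneSpectrum B) :
    ∃ x : B, x ≠ 0 ∧ ∀ v : HeightOneSpectrum B, x ∈ v.asIdeal ↔ v = q := by
  have hq : q.asIdeal ∈ nonZeroDivisors (Ideal B) := mem_nonZeroDivisors_of_ne_zero q.ne_bot
  have h1 : (ClassGroup.mk0 ⟨q.asIdeal, hq⟩) ^ Nat.card (ClassGroup B) = 1 := pow_card_eq_one'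
  have h0 : Nat.card (ClassGroup B) ≠ 0 := Nat.card_pos.ne'
  rw [← map_pow, SubmonoidClass.mk_pow, ClassGroup.mk0_eq_one_iff] at h1
  obtain ⟨x, hx⟩ := h1
  change q.asIdeal ^ _ = Ideal.span {x} at hx
  refine ⟨x, ?_, fun v => ?_⟩
  · rintro rfl
    rw [Ideal.span_singleton_eq_bot.mpr rfl] at hx
    exact q.ne_bot (pow_eq_zero_iff h0 |>.mp hx)
  · rw [← Ideal.span_singleton_le_iff_mem, ← hx, v.isPrime.pow_le_iff h0]
    refine ⟨fun h => HeightOneSpectrum.ext (q.isMaximal.eq_of_le v.isPrime.ne_top h).symm, ?_⟩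
    rintro rfl
    exact le_rfl

theorem exists_generator_finset [Finite (ClassGroup B)] (S : Finset (HeightOneSpectrum B)) :
    ∃ x : B, x ≠ 0 ∧ ∀ v : HeightOneSpectrum B, x ∈ v.asIdeal ↔ v ∈ S := by
  classical
  induction S using Finset.induction_on with
  | empty => exact ⟨1, one_ne_zero, fun v => by simpa using (Ideal.ne_top_iff_one _).mp v.isPrime.ne_top⟩
  | insert q S _ ih =>
    obtain ⟨x, hx, h⟩ := ih
    obtain ⟨y, hy, h'⟩ := exists_generator q
    exact ⟨y * x, mul_ne_zero hy hx, fun v => by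
      rw [v.isPrime.mul_mem_iff_mem_or_mem, h, h', Finset.mem_insert]⟩

variable {K : Type*} [Field K] [Algebra B K] [IsFractionRing B K] {S : Set (HeightOneSpectrum B)}

theorem dvd_integer_iff {x y : B} (hx : x ≠ 0) :
    algebraMap B (S.integer K) x ∣ algebraMap B (S.integer K) y ↔
      ∀ v ∉ S, v.valuation K (algebraMap B K y) ≤ v.valuation K (algebraMap B K x) := by
  have hx' : algebraMap B K x ≠ 0 := by simpa using hx
  constructor
  · rintro ⟨z, hz⟩ v hv
    have hz : algebraMap B K y = algebraMap B K x * z := congrArg Subtype.val hz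
    rw [hz, map_mul]
    exact mul_le_of_le_one_right' (z.2 v hv)
  · intro h
    refine ⟨⟨algebraMap B K y / algebraMap B K x, fun v hv => ?_⟩, Subtype.ext ?_⟩
    · rw [map_div₀]
      exact div_le_one_of_le₀ (h v hv) zero_le
    · exact (mul_div_cancel₀ _ hx').symm

theorem isUnit_integer {x : B} (hx : x ≠ 0) (h : ∀ v : HeightOneSpectrum B, x ∈ v.asIdeal → v ∈ S) :
    IsUnit (algebraMap B (S.integer K) x) := by
  rw [isUnit_iff_dvd_one, ← map_one (algebraMap B _), dvd_integer_iff hx]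
  intro v hv
  rw [(v.valuation_eq_one_iff_notMem (K := K)).mpr (fun hx => hv (h v hx)), map_one, map_one]

theorem exists_pow_mul_mem {S : Finset (HeightOneSpectrum B)} {x : B} (hx : x ≠ 0)
    (h : ∀ v : HeightOneSpectrum B, x ∈ v.asIdeal ↔ v ∈ S)
    (z : (S : Set (HeightOneSpectrum B)).integer K) :
    ∃ k y, algebraMap B ((S : Set (HeightOneSpectrum B)).integer K) x ^ k * z =
      algebraMap B _ y := by
  have hx' : algebraMap B K x ≠ 0 := by simpa using hx
  have key : ∀ v : HeightOneSpectrum B, ∃ k : ℕ, v ∈ S →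
      v.valuation K (algebraMap B K x ^ k * z) ≤ 1 := by
    intro v
    by_cases hv : v ∈ S
    · have h0 : v.valuation K (algebraMap B K x) ≠ 0 := (Valuation.ne_zero_iff _).mpr hx'
      have h1 : 1 < (v.valuation K (algebraMap B K x))⁻¹ := by
        rw [one_lt_inv₀ (zero_lt_iff.mpr h0), v.valuation_lt_one_iff_mem]
        exact (h v).mpr hv
      obtain ⟨k, hk⟩ := MulArchimedean.arch (v.valuation K (z : K)) h1
      refine ⟨k, fun _ => ?_⟩
      rw [map_mul, map_pow]
      calc _ ≤ v.valuation K (algebraMap B K x) ^ k * (v.valuation K (algebraMap B K x))⁻¹ ^ k :=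
            mul_le_mul_right hk _
        _ = 1 := by rw [← mul_pow, mul_inv_cancel₀ h0, one_pow]
    · exact ⟨0, fun h => absurd h hv⟩
  choose k hk using key
  have hInt : ∀ v : HeightOneSpectrum B, v.valuation K
    (algebraMap B K x ^ (∑ u ∈ S, k u) * z) ≤ 1 := by
    intro v
    have h1 := v.valuation_le_one (K := K) x
    by_cases hv : v ∈ S
    · classical
      rw [← Finset.add_sum_erase S k hv, pow_add, mul_right_comm, map_mul, map_pow (v.valuation K)]
      exact mul_le_one' (hk v hv) (pow_le_one₀ zero_le h1)
    · rw [map_mul, map_pow]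
      exact mul_le_one' (pow_le_one₀ zero_le h1) (z.2 v hv)
  obtain ⟨y, hy⟩ := HeightOneSpectrum.mem_integers_of_valuation_le_one K _ hInt
  exact ⟨_, y, Subtype.ext hy.symm⟩

theorem exists_ctx [Finite (ClassGroup B)] {a b : ℤ} (hn : b ^ 2 + 4 * a < 0) (φ : Quad a b ≃+* B)
    {S : Finset (HeightOneSpectrum B)} (hS : S.Nonempty) :
    ∃ π : Quad a b, Ctx ((algebraMap B ((S : Set
      (HeightOneSpectrum B)).integer K)).comp φ.toRingHom) π ∧
      ∀ q : HeightOneSpectrum B, φ π ∈ q.asIdeal ↔ q ∈ S := by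
  obtain ⟨x, hx, h⟩ := exists_generator_finset S
  have hinj : Function.Injective (algebraMap B ((S : Set (HeightOneSpectrum B)).integer K)) :=
    fun u v huv => IsFractionRing.injective B K (congrArg Subtype.val huv)
  refine ⟨φ.symm x, ⟨hinj.comp φ.injective, hn, ?_, fun z => ?_, ?_⟩, by simpa using h⟩
  · simpa using isUnit_integer (S := (S : Set (HeightOneSpectrum B))) (K := K) hx
      (fun v hv => (h v).mp hv)
  · obtain ⟨k, y, e⟩ := exists_pow_mul_mem (K := K) hx h z
    exact ⟨k, φ.symm y, by simpa using e⟩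
  · obtain ⟨q, hq⟩ := hS
    refine ⟨_, isUnit_integer (S := (S : Set (HeightOneSpectrum B))) (K := K) hx
      (fun v hv => (h v).mp hv), fun k hk he => ?_⟩
    rw [← map_pow, ← map_one (algebraMap B _)] at he
    have := hinj he
    have h1 := q.asIdeal.pow_mem_of_mem ((h q).mpr hq) k hk
    rw [this] at h1
    exact (Ideal.ne_top_iff_one _).mp q.isPrime.ne_top h1

end Dedekind

theorem exists_prime_mem {B : Type*} [CommRing B] {P : Ideal B} [P.IsPrime] {n : ℕ} (hn : n ≠ 0)
    (h : (n : B) ∈ P) : ∃ p : ℕ, p.Prime ∧ (p : B) ∈ P := by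
  induction n using Nat.strongRecOn with
  | ind n ih =>
    have h1 : n ≠ 1 := by
      rintro rfl
      exact Ideal.IsPrime.ne_top ‹_› ((Ideal.eq_top_iff_one P).mpr (by simpa using h))
    have hp := Nat.minFac_prime h1
    obtain ⟨m, hm⟩ := Nat.minFac_dvd n
    rw [hm, Nat.cast_mul] at h
    rcases Ideal.IsPrime.mem_or_mem ‹_› h with h | h
    · exact ⟨_, hp, h⟩
    · have h0 : m ≠ 0 := by
        rintro rfl
        exact hn (by simpa using hm)
      refine ih m ?_ h0 h
      have := Nat.mul_lt_mul_of_pos_right hp.one_lt (Nat.pos_of_ne_zero h0)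
      omega

theorem intCast_mem_iff {B : Type*} [CommRing B] {P : Ideal B} [P.IsPrime] {p : ℕ} (hp : p.Prime)
    (h : (p : B) ∈ P) (n : ℤ) : (n : B) ∈ P ↔ (p : ℤ) ∣ n := by
  constructor
  · intro hn
    by_contra hpn
    obtain ⟨u, v, e⟩ := (Nat.prime_iff_prime_int.mp hp).coprime_iff_not_dvd.mpr hpn
    have e' : (u : B) * p + v * n = 1 := by exact_mod_cast congrArg (fun z : ℤ => (z : B)) e
    exact Ideal.IsPrime.ne_top ‹_› ((Ideal.eq_top_iff_one P).mpr
      (e' ▸ P.add_mem (P.mul_mem_left _ h) (P.mul_mem_left _ hn)))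
  · rintro ⟨k, rfl⟩
    push_cast
    exact P.mul_mem_right _ h

/-- An element of norm divisible exactly once by a prime, in a given prime ideal. -/
theorem exists_norm_exact {a b : ℤ} {d p : ℕ} (hd : Squarefree d) (hm : IsMaximal a b d)
    (h7 : d % 8 = 7)
    (hp : p.Prime) {m : ℤ} (h : (p : ℤ) ∣ 𝐍 (⟨m, 1⟩ : Quad a b)) :
    ∃ k : ℤ, (p : ℤ) ∣ 𝐍 (⟨m + p * k, 1⟩ : Quad a b) ∧
      ¬ (p ^ 2 : ℤ) ∣ 𝐍 (⟨m + p * k, 1⟩ : Quad a b) := by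
  rcases hm with ⟨-, -, _⟩ | ⟨rfl, hm⟩
  · omega
  have hN : ∀ k : ℤ, 𝐍 (⟨k, 1⟩ : Quad a 1) = k ^ 2 + k - a := fun k => by
    rw [norm_def]; simp; ring
  rw [hN] at h
  by_cases h2 : (p ^ 2 : ℤ) ∣ m ^ 2 + m - a
  · refine ⟨1, ?_, fun h3 => ?_⟩
    · rw [hN]
      exact (h.add (dvd_mul_right (p : ℤ) (2 * m + 1 + p))).trans (dvd_of_eq (by ring))
    · rw [hN] at h3
      have h4 : (p ^ 2 : ℤ) ∣ p * (2 * m + 1) := by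
        have := (h3.sub h2).sub (dvd_refl (p ^ 2 : ℤ))
        exact this.trans (dvd_of_eq (by ring))
      have h5 : (p : ℤ) ∣ 2 * m + 1 := by
        rw [pow_two] at h4
        exact Int.dvd_of_mul_dvd_mul_left (by exact_mod_cast hp.ne_zero) h4
      have h6 : (p ^ 2 : ℤ) ∣ d := by
        have := (h2.mul_left 4).sub (pow_dvd_pow_of_dvd h5 2)
        exact this.trans (dvd_of_eq (by linear_combination -hm))
      have h7 : p * p ∣ d := by
        rw [← pow_two]
        exact_mod_cast h6
      exact hp.one_lt.ne' (Nat.isUnit_iff.mp (hd p h7))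
  · exact ⟨0, by simpa [hN] using h, by simpa [hN] using h2⟩

section

variable {B : Type*} [CommRing B] [IsDedekindDomain B] {K : Type*} [Field K] [Algebra B K]
  [IsFractionRing B K]

theorem exists_unit_or_split {a b : ℤ} (hn : b ^ 2 + 4 * a < 0) (φ : Quad a b ≃+* B)
    {S : Set (HeightOneSpectrum B)} (hS : S.Nonempty) {d : ℕ} (hd : Squarefree d)
    (hm : IsMaximal a b d) (h7 : d % 8 = 7) :
    ∃ p : ℕ, p.Prime ∧ ((IsUnit (p : S.integer K) ∧ ¬ p ∣ d) ∨ ∃ m : ℤ,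
      (p : ℤ) ∣ 𝐍 (⟨m, 1⟩ : Quad a b) ∧ ¬ (p ^ 2 : ℤ) ∣ 𝐍 (⟨m, 1⟩ : Quad a b) ∧
      (p : S.integer K) ∣ (algebraMap B (S.integer K)).comp φ.toRingHom ⟨m, 1⟩) := by
  obtain ⟨v, hv⟩ := hS
  have hmul : ∀ z, φ z * φ (star z) = ((𝐍 z : ℤ) : B) := fun z => by
    rw [← map_mul, Quad.mul_star_self, map_intCast]
  have hB : ∀ n : ℤ, n ≠ 0 → (n : B) ≠ 0 := fun n h0 h1 => by
    rw [← map_intCast φ, map_eq_zero_iff φ φ.injective] at h1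
    exact h0 (by simpa using congrArg QuadraticAlgebra.re h1)
  obtain ⟨p, hp, hpv⟩ : ∃ p : ℕ, p.Prime ∧ (p : B) ∈ v.asIdeal := by
    obtain ⟨x, hx, hx0⟩ := Submodule.exists_mem_ne_zero_of_ne_bot v.ne_bot
    have h0 : φ.symm x ≠ 0 := by simpa using hx0
    have h1 := Quad.norm_pos hn h0
    refine exists_prime_mem (n := (𝐍 (φ.symm x)).natAbs) (by omega) ?_
    have h2 := hmul (φ.symm x)
    rw [φ.apply_symm_apply] at h2
    have h3 : ((𝐍 (φ.symm x)).natAbs : ℤ) = 𝐍 (φ.symm x) := Int.natAbs_of_nonneg h1.le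
    have h4 := congrArg (fun z : ℤ => (z : B)) h3
    simp only [Int.cast_natCast] at h4
    rw [h4, ← h2]
    exact v.asIdeal.mul_mem_right _ hx
  have hpB : (p : B) ≠ 0 := by exact_mod_cast hB p (by exact_mod_cast hp.ne_zero)
  have hdec : ∀ z : Quad a b, φ z = (z.re : B) + z.im * φ ⟨0, 1⟩ := fun z => by
    conv_lhs => rw [Quad.eq_add_mul z, map_add, map_mul, map_intCast, map_intCast]
  refine ⟨p, hp, ?_⟩
  by_cases hex : ∃ m : ℤ, φ ⟨m, 1⟩ ∈ v.asIdeal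
  · right
    obtain ⟨m₀, hm₀⟩ := hex
    have h1 : (p : ℤ) ∣ 𝐍 (⟨m₀, 1⟩ : Quad a b) := by
      rw [← intCast_mem_iff hp hpv, ← hmul]
      exact v.asIdeal.mul_mem_right _ hm₀
    obtain ⟨k, h2, h3⟩ := exists_norm_exact hd hm h7 hp h1
    set m := m₀ + p * k with hmk
    have hmem : φ ⟨m, 1⟩ ∈ v.asIdeal := by
      have : φ ⟨m, 1⟩ = φ ⟨m₀, 1⟩ + p * k := by
        rw [hdec, hdec ⟨m₀, 1⟩, hmk]
        push_cast
        ring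
      rw [this]
      exact v.asIdeal.add_mem hm₀ (v.asIdeal.mul_mem_right _ hpv)
    have hstar : (⟨-m - b, 1⟩ : Quad a b) = -star ⟨m, 1⟩ := by
      ext
      · simp; ring
      · simp
    refine ⟨-m - b, ?_, ?_, ?_⟩
    · rwa [hstar, QuadraticAlgebra.norm_neg, QuadraticAlgebra.norm_star]
    · rwa [hstar, QuadraticAlgebra.norm_neg, QuadraticAlgebra.norm_star]
    · rw [hstar, map_neg, dvd_neg, ← map_natCast (algebraMap B (S.integer K)), RingHom.comp_apply,
        dvd_integer_iff hpB]
      intro u hu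
      by_cases hpu : (p : B) ∈ u.asIdeal
      · have hcu : φ ⟨m, 1⟩ ∉ u.asIdeal := by
          intro hcu
          have hle : v.asIdeal ≤ u.asIdeal := by
            intro y hy
            obtain ⟨z, rfl⟩ := φ.surjective y
            have e : φ z = ((z.re - z.im * m : ℤ) : B) + z.im * φ ⟨m, 1⟩ := by
              rw [hdec, hdec ⟨m, 1⟩]
              push_cast
              ring
            have : ((z.re - z.im * m : ℤ) : B) ∈ v.asIdeal := by
              rw [e] at hy
              exact (v.asIdeal.add_mem_iff_left (v.asIdeal.mul_mem_left _ hmem)).mp hy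
            rw [intCast_mem_iff hp hpv, ← intCast_mem_iff hp hpu] at this
            rw [e]
            exact u.asIdeal.add_mem this (u.asIdeal.mul_mem_left _ hcu)
          exact hu (HeightOneSpectrum.ext (v.isMaximal.eq_of_le u.isPrime.ne_top hle) ▸ hv)
        have h4 := (u.valuation_eq_one_iff_notMem (K := K)).mpr hcu
        obtain ⟨n, hn⟩ := h2
        have h5 := hmul ⟨m, 1⟩
        rw [hn, Int.cast_mul, Int.cast_natCast] at h5
        have h6 := congrArg (fun x => u.valuation K (algebraMap B K x)) h5
        simp only [map_mul, h4, one_mul] at h6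
        change u.valuation K (algebraMap B K (φ (star ⟨m, 1⟩))) ≤ _
        rw [h6]
        exact mul_le_of_le_one_right' (u.valuation_le_one _)
      · rw [(u.valuation_eq_one_iff_notMem (K := K)).mpr hpu]
        exact u.valuation_le_one _
  · left
    push Not at hex
    have hstep : ∀ z, φ z ∈ v.asIdeal → (p : ℤ) ∣ z.im ∧ (p : ℤ) ∣ z.re := by
      intro z hz
      have h1 : (p : ℤ) ∣ z.im := by
        by_contra hpz
        obtain ⟨s, t, e⟩ := (Nat.prime_iff_prime_int.mp hp).coprime_iff_not_dvd.mpr hpz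
        refine hex (t * z.re) ?_
        have e' := congrArg (fun z : ℤ => (z : B)) e
        push_cast at e'
        have : φ ⟨t * z.re, 1⟩ = t * φ z + p * (s * φ ⟨0, 1⟩) := by
          rw [hdec, hdec z]
          push_cast
          linear_combination (-φ ⟨0, 1⟩) * e'
        rw [this]
        exact v.asIdeal.add_mem (v.asIdeal.mul_mem_left _ hz) (v.asIdeal.mul_mem_right _ hpv)
      refine ⟨h1, ?_⟩
      rw [hdec] at hz
      rw [← intCast_mem_iff hp hpv]
      exact (v.asIdeal.add_mem_iff_left (v.asIdeal.mul_mem_right _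
        ((intCast_mem_iff hp hpv _).mpr h1))).mp hz
    constructor
    · rw [← map_natCast (algebraMap B (S.integer K))]
      refine isUnit_integer hpB fun u hu => ?_
      have hle : v.asIdeal ≤ u.asIdeal := by
        intro y hy
        obtain ⟨z, rfl⟩ := φ.surjective y
        obtain ⟨h1, h2⟩ := hstep z hy
        rw [hdec]
        exact u.asIdeal.add_mem ((intCast_mem_iff hp hu _).mpr h2)
          (u.asIdeal.mul_mem_right _ ((intCast_mem_iff hp hu _).mpr h1))
      exact HeightOneSpectrum.ext (v.isMaximal.eq_of_le u.isPrime.ne_top hle) ▸ hv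
    · rintro hpd
      rcases hm with ⟨-, -, _⟩ | ⟨rfl, hm⟩
      · omega
      have hp2 : p ≠ 2 := by
        rintro rfl
        omega
      obtain ⟨c, hc⟩ : ∃ c, p = 2 * c + 1 := ⟨p / 2, by have := hp.eq_two_or_odd; omega⟩
      have hN : (p : ℤ) ∣ 𝐍 (⟨c, 1⟩ : Quad a 1) := by
        have h4 : 4 * 𝐍 (⟨c, 1⟩ : Quad a 1) = p ^ 2 + d := by
          rw [norm_def, hc]
          simp
          linear_combination -hm
        have : (p : ℤ) ∣ 4 * 𝐍 (⟨c, 1⟩ : Quad a 1) := by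
          rw [h4]
          exact (dvd_pow_self _ two_ne_zero).add (by exact_mod_cast hpd)
        refine IsCoprime.dvd_of_dvd_mul_left ?_ this
        rw [hc]
        exact ⟨1 - 2 * c, c ^ 2, by push_cast; ring⟩
      rw [← intCast_mem_iff hp hpv, ← hmul] at hN
      rcases v.isPrime.mem_or_mem hN with h | h
      · exact hex _ h
      · have := hstep _ h
        simp only [QuadraticAlgebra.im_star] at this
        have := Int.isUnit_iff.mp (isUnit_of_dvd_unit this.1 (by decide : IsUnit (-1 : ℤ)))
        have := hp.two_le
        omega

end

end SL2Ab

namespace SL2Ab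

open QuadraticAlgebra

/-- A quadratic algebra over `ZMod 2` as an additive group. -/
def quadPiAddEquiv (a : ZMod 2) (k : ℕ) :
    (Fin k → QuadraticAlgebra (ZMod 2) a 0) ≃+ (Fin k × Fin 2 → ZMod 2) where
  toFun f x := ![(f x.1).re, (f x.1).im] x.2
  invFun g i := ⟨g (i, 0), g (i, 1)⟩
  left_inv f := by
    ext i <;> simp
  right_inv g := by
    funext ⟨i, j⟩
    fin_cases j <;> simp
  map_add' f g := by
    funext ⟨i, j⟩
    fin_cases j <;> simp

/-- Reindexing functions by a bijection, additively. -/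
def piReindex {I J R : Type*} [AddCommMonoid R] (e : I ≃ J) : (I → R) ≃+ (J → R) :=
  { Equiv.arrowCongr e (Equiv.refl R) with
    map_add' := fun _ _ => rfl }

theorem nonempty_quadPi (a : ZMod 2) (k : ℕ) :
    Nonempty ((Fin k → QuadraticAlgebra (ZMod 2) a 0) ≃+ (Fin (2 * k) → ZMod 2)) :=
  ⟨(quadPiAddEquiv a k).trans (piReindex (finProdFinEquiv.trans (finCongr (mul_comm k 2))))⟩

end SL2Ab

open SL2Ab QuadraticAlgebra in
theorem sl2_abelianization_imaginary_quadratic_S_integers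
    (d : ℕ) (hd0 : 0 < d) (hd : Squarefree (-(d : ℤ)))
    (K : Type*) [Field K] [NumberField K]
    (hdeg : Module.finrank ℚ K = 2)
    (α : K) (hα : α ^ 2 = -(d : K))
    (S : Finset (HeightOneSpectrum (𝓞 K))) (hS : S.Nonempty)
    (A : Subalgebra (𝓞 K) K)
    (hA : A = (S : Set (HeightOneSpectrum (𝓞 K))).integer K) :
    ((-(d : ℤ)) % 24 = 5 → Nonempty (SL2ab ↥A ≃+ ZMod 1)) ∧
    ((-(d : ℤ)) % 24 = 1 → ∀ p₁ p₂ q₁ q₂ : HeightOneSpectrum (𝓞 K), p₁ ≠ p₂ →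
      Ideal.span {(2 : 𝓞 K)} = p₁.asIdeal * p₂.asIdeal → q₁ ≠ q₂ →
      Ideal.span {(3 : 𝓞 K)} = q₁.asIdeal * q₂.asIdeal →
      Nonempty (SL2ab ↥A ≃+ ((Fin (beta S p₁ + beta S p₂) → ZMod 4) ×
        (Fin (beta S q₁ + beta S q₂) → ZMod 3)))) ∧
    ((-(d : ℤ)) % 24 = 9 → ∀ p₁ p₂ q : HeightOneSpectrum (𝓞 K), p₁ ≠ p₂ →
      Ideal.span {(2 : 𝓞 K)} = p₁.asIdeal * p₂.asIdeal →
      Ideal.span {(3 : 𝓞 K)} = q.asIdeal ^ 2 →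
      Nonempty (SL2ab ↥A ≃+ ((Fin (beta S p₁ + beta S p₂) → ZMod 4) ×
        (Fin (beta S q) → ZMod 3)))) ∧
    ((-(d : ℤ)) % 24 = 13 → ∀ q₁ q₂ : HeightOneSpectrum (𝓞 K), q₁ ≠ q₂ →
      Ideal.span {(3 : 𝓞 K)} = q₁.asIdeal * q₂.asIdeal →
      Nonempty (SL2ab ↥A ≃+ (Fin (beta S q₁ + beta S q₂) → ZMod 3))) ∧
    ((-(d : ℤ)) % 24 = 21 → ∀ q : HeightOneSpectrum (𝓞 K),
      Ideal.span {(3 : 𝓞 K)} = q.asIdeal ^ 2 →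
      Nonempty (SL2ab ↥A ≃+ (Fin (beta S q) → ZMod 3))) ∧
    ((-(d : ℤ)) % 24 = 17 → ∀ p₁ p₂ : HeightOneSpectrum (𝓞 K), p₁ ≠ p₂ →
      Ideal.span {(2 : 𝓞 K)} = p₁.asIdeal * p₂.asIdeal →
      Nonempty (SL2ab ↥A ≃+ (Fin (beta S p₁ + beta S p₂) → ZMod 4))) ∧
    ((-(d : ℤ)) % 24 ∈ ({2, 11, 14, 20, 23} : Set ℤ) → ∀ p : HeightOneSpectrum (𝓞 K),
      Ideal.span {(2 : 𝓞 K)} = p.asIdeal ^ 2 →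
      Nonempty (SL2ab ↥A ≃+ (Fin (2 * beta S p) → ZMod 2))) ∧
    ((-(d : ℤ)) % 24 ∈ ({4, 7, 10, 19, 22} : Set ℤ) →
      ∀ p q₁ q₂ : HeightOneSpectrum (𝓞 K),
      Ideal.span {(2 : 𝓞 K)} = p.asIdeal ^ 2 → q₁ ≠ q₂ →
      Ideal.span {(3 : 𝓞 K)} = q₁.asIdeal * q₂.asIdeal →
      Nonempty (SL2ab ↥A ≃+ ((Fin (2 * beta S p) → ZMod 2) ×
        (Fin (beta S q₁ + beta S q₂) → ZMod 3)))) ∧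
    ((-(d : ℤ)) % 24 ∉
        ({5, 1, 9, 13, 21, 17, 2, 11, 14, 20, 23, 4, 7, 10, 19, 22} : Set ℤ) →
      ∀ p q : HeightOneSpectrum (𝓞 K),
      Ideal.span {(2 : 𝓞 K)} = p.asIdeal ^ 2 →
      Ideal.span {(3 : 𝓞 K)} = q.asIdeal ^ 2 →
      Nonempty (SL2ab ↥A ≃+ ((Fin (2 * beta S p) → ZMod 2) ×
        (Fin (beta S q) → ZMod 3)))) := by
  subst hA
  have hd' : Squarefree d := Int.squarefree_natCast.mp fun x hx => hd x (hx.neg_right)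
  obtain ⟨a, b, hm, ⟨φ⟩⟩ := exists_quad hd0 hd' hdeg hα
  have hn : b ^ 2 + 4 * a < 0 := by
    rcases hm with ⟨rfl, rfl, _⟩ | ⟨rfl, hm⟩ <;> omega
  obtain ⟨π, hc, hπ⟩ := exists_ctx (K := K) hn φ hS
  have hu : d % 8 = 7 → _ := exists_unit_or_split (K := K) hn φ (Finset.coe_nonempty.mpr hS) hd' hm
  have h4 : ¬ 4 ∣ d := fun h => by
    have := Nat.isUnit_iff.mp (hd' 2 h)
    omega
  have e4 : ∀ k, (4 : Fin k → ZMod 4) = 0 := fun k => funext fun _ => rfl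
  have e3 : ∀ k, (3 : Fin k → ZMod 3) = 0 := fun k => funext fun _ => rfl
  have eQ : ∀ k, (4 : Fin k → QuadraticAlgebra (ZMod 2) a 0) = 0 := fun k => by
    funext i
    exact (QuadraticAlgebra.ext rfl rfl : (4 : QuadraticAlgebra (ZMod 2) a 0) = 0)
  have cQ : ∀ k, HasChi (Fin k → QuadraticAlgebra (ZMod 2) a 0) := fun k =>
    (hasChi_quadraticAlgebra a).pi
  have c4 : ∀ k, HasChi (Fin k → ZMod 4) := fun k => hasChi_zmod_four.pi
  have c3 : ∀ k, HasChi (Fin k → ZMod 3) := fun k => hasChi_zmod_three.pi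
  set A := (S : Set (HeightOneSpectrum (𝓞 K))).integer K with hAdef
  obtain ⟨gu, su⟩ : ∃ g : A →+* PUnit.{1}, Function.Surjective g :=
    ⟨{ toFun := fun _ => ⟨⟩, map_one' := rfl, map_mul' := fun _ _ => rfl, map_zero' := rfl,
       map_add' := fun _ _ => rfl }, fun _ => ⟨0, rfl⟩⟩
  refine ⟨fun hr => ?_, fun hr p₁ p₂ q₁ q₂ _ h2 _ h3 => ?_, fun hr p₁ p₂ q _ h2 h3 => ?_,
    fun hr q₁ q₂ _ h3 => ?_, fun hr q h3 => ?_, fun hr p₁ p₂ _ h2 => ?_, fun hr p h2 => ?_,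
    fun hr p q₁ q₂ h2 _ h3 => ?_, fun hr p q h2 h3 => ?_⟩
  · have r2 : d % 8 = 3 := by omega
    have r3 : d % 3 = 1 := by omega
    obtain ⟨e⟩ := hc.nonempty_addEquiv hd' hm hu rfl rfl hasChi_punit hasChi_punit su su
      (fun _ _ => Or.inl r2) (fun _ _ => Or.inl r3)
    exact ⟨(e.trans AddEquiv.prodUnique).trans AddEquiv.ofUnique⟩
  · have r2 : d % 8 = 7 := by omega
    have r3 : d % 3 = 2 := by omega
    obtain ⟨g₂, s₂, k₂⟩ := exists_two_split hπ hc hm r2 h2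
    obtain ⟨g₃, s₃, k₃⟩ := exists_three_split hπ hc hm r3 h3
    exact hc.nonempty_addEquiv hd' hm hu (e4 _) (e3 _) (c4 _) (c3 _) s₂ s₃
      (fun t h => Or.inr (Or.inl ⟨r2, k₂ t h⟩)) (fun t h => Or.inr (Or.inl ⟨r3, k₃ t h⟩))
  · have r2 : d % 8 = 7 := by omega
    have r3 : d % 3 = 0 := by omega
    obtain ⟨g₂, s₂, k₂⟩ := exists_two_split hπ hc hm r2 h2
    obtain ⟨g₃, s₃, k₃⟩ := exists_three_ramified hπ hc hm r3 h3
    exact hc.nonempty_addEquiv hd' hm hu (e4 _) (e3 _) (c4 _) (c3 _) s₂ s₃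
      (fun t h => Or.inr (Or.inl ⟨r2, k₂ t h⟩)) (fun t h => Or.inr (Or.inr ⟨r3, k₃ t h⟩))
  · have r2 : d % 8 = 3 := by omega
    have r3 : d % 3 = 2 := by omega
    obtain ⟨g₃, s₃, k₃⟩ := exists_three_split hπ hc hm r3 h3
    obtain ⟨e⟩ := hc.nonempty_addEquiv hd' hm hu rfl (e3 _) hasChi_punit (c3 _) su s₃
      (fun _ _ => Or.inl r2) (fun t h => Or.inr (Or.inl ⟨r3, k₃ t h⟩))
    exact ⟨e.trans AddEquiv.uniqueProd⟩
  · have r2 : d % 8 = 3 := by omega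
    have r3 : d % 3 = 0 := by omega
    obtain ⟨g₃, s₃, k₃⟩ := exists_three_ramified hπ hc hm r3 h3
    obtain ⟨e⟩ := hc.nonempty_addEquiv hd' hm hu rfl (e3 _) hasChi_punit (c3 _) su s₃
      (fun _ _ => Or.inl r2) (fun t h => Or.inr (Or.inr ⟨r3, k₃ t h⟩))
    exact ⟨e.trans AddEquiv.uniqueProd⟩
  · have r2 : d % 8 = 7 := by omega
    have r3 : d % 3 = 1 := by omega
    obtain ⟨g₂, s₂, k₂⟩ := exists_two_split hπ hc hm r2 h2
    obtain ⟨e⟩ := hc.nonempty_addEquiv hd' hm hu (e4 _) rfl (c4 _) hasChi_punit s₂ su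
      (fun t h => Or.inr (Or.inl ⟨r2, k₂ t h⟩)) (fun _ _ => Or.inl r3)
    exact ⟨e.trans AddEquiv.prodUnique⟩
  · simp only [Set.mem_insert_iff, Set.mem_singleton_iff] at hr
    have r2 : d % 4 ≠ 3 := by omega
    have r3 : d % 3 = 1 := by omega
    obtain ⟨g₂, s₂, k₂⟩ := exists_two_ramified hπ hc hm r2 h2
    obtain ⟨e⟩ := hc.nonempty_addEquiv hd' hm hu (eQ _) rfl (cQ _) hasChi_punit s₂ su
      (fun t h => Or.inr (Or.inr ⟨r2, k₂ t h⟩)) (fun _ _ => Or.inl r3)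
    obtain ⟨f⟩ := nonempty_quadPi a (beta S p)
    exact ⟨(e.trans AddEquiv.prodUnique).trans f⟩
  · simp only [Set.mem_insert_iff, Set.mem_singleton_iff] at hr
    have r2 : d % 4 ≠ 3 := by omega
    have r3 : d % 3 = 2 := by omega
    obtain ⟨g₂, s₂, k₂⟩ := exists_two_ramified hπ hc hm r2 h2
    obtain ⟨g₃, s₃, k₃⟩ := exists_three_split hπ hc hm r3 h3
    obtain ⟨e⟩ := hc.nonempty_addEquiv hd' hm hu (eQ _) (e3 _) (cQ _) (c3 _) s₂ s₃
      (fun t h => Or.inr (Or.inr ⟨r2, k₂ t h⟩)) (fun t h => Or.inr (Or.inl ⟨r3, k₃ t h⟩))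
    obtain ⟨f⟩ := nonempty_quadPi a (beta S p)
    exact ⟨e.trans (f.prodCongr (AddEquiv.refl _))⟩
  · simp only [Set.mem_insert_iff, Set.mem_singleton_iff, not_or] at hr
    have r2 : d % 4 ≠ 3 := by omega
    have r3 : d % 3 = 0 := by omega
    obtain ⟨g₂, s₂, k₂⟩ := exists_two_ramified hπ hc hm r2 h2
    obtain ⟨g₃, s₃, k₃⟩ := exists_three_ramified hπ hc hm r3 h3
    obtain ⟨e⟩ := hc.nonempty_addEquiv hd' hm hu (eQ _) (e3 _) (cQ _) (c3 _) s₂ s₃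
      (fun t h => Or.inr (Or.inr ⟨r2, k₂ t h⟩)) (fun t h => Or.inr (Or.inr ⟨r3, k₃ t h⟩))
    obtain ⟨f⟩ := nonempty_quadPi a (beta S p)
    exact ⟨e.trans (f.prodCongr (AddEquiv.refl _))⟩
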